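/- Let (R,m) be a Noetherian local ring and M a finitely generated unmixed R-module with r = dim_R M ≥ 2. Assume that the set Λ(M) = {e_1(Q,M) : Q a parameter ideal for M} is finite, and put ℓ = −min Λ(M). Then m^ℓ H^i_m(M) = (0) for every i ≠ r, so that M is a generalized Cohen–Macaulay R-module. -/

import Mathlib

open IsLocalRing

section Defs

variable (R : Type) [CommRing R]

/-- The length of a module, as the Krull dimension of its lattice of submodules. -/
noncomputable def mLength (M : Type) [AddCommGroup M] [Module R M] : WithBot ℕ∞ :=
  Order.krullDim (Submodule R M)

/-- The (Krull) dimension of a module. -/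
noncomputable def mDim (M : Type) [AddCommGroup M] [Module R M] : WithBot ℕ∞ :=
  ringKrullDim (R ⧸ Submodule.annihilator (⊤ : Submodule R M))

/-- `f` is eventually given by the Hilbert-type polynomial of degree `t` with
coefficients `s 0, …, s t` (written in the binomial basis with alternating signs). -/
def IsHilbPolyAt (f : ℕ → WithBot ℕ∞) (t : ℕ) (s : ℕ → ℤ) : Prop :=
  ∃ N : ℕ, ∀ n ≥ N, ∃ l : ℕ, f n = (l : ℕ∞) ∧
    (l : ℤ) = ∑ i ∈ Finset.range (t + 1), (-1 : ℤ) ^ i * s i * ((n + t - i).choose (t - i) : ℤ)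

/-- `s 0, …, s t` are the Hilbert coefficients `e_i(I, M)`, i.e.
`λ(M/I^{n+1}M) = ∑ (-1)^i e_i(I,M) C(n+t-i, t-i)` for `n ≫ 0`. -/
def HasHilbCoeffs (I : Ideal R) (M : Type) [AddCommGroup M] [Module R M]
    (t : ℕ) (s : ℕ → ℤ) : Prop :=
  IsHilbPolyAt (fun n => mLength R (M ⧸ (I ^ (n + 1) • (⊤ : Submodule R M)))) t s

/-- The unmixed component `U_M(0)` of `M`: the largest submodule of dimension `< dim M`. -/
noncomputable def unmixedComp (M : Type) [AddCommGroup M] [Module R M] : Submodule R M :=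
  sSup {N : Submodule R M | mDim R ↥N < mDim R M}

/-- `x` is a d-sequence on `M`. -/
def IsDSeq {r : ℕ} (x : Fin r → R) (M : Type) [AddCommGroup M] [Module R M] : Prop :=
  ∀ i j : Fin r, i ≤ j →
    Submodule.comap (LinearMap.lsmul R M (x i * x j))
        (Ideal.span (x '' {k | k < i}) • (⊤ : Submodule R M))
      = Submodule.comap (LinearMap.lsmul R M (x j))
        (Ideal.span (x '' {k | k < i}) • (⊤ : Submodule R M))

/-- `x` is a standard (d⁺-) system: all power sequences in any order are d-sequences. -/
def IsStandardSeq {r : ℕ} (x : Fin r → R) (M : Type) [AddCommGroup M] [Module R M] : Prop :=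
  ∀ n : Fin r → ℕ, (∀ k, 1 ≤ n k) → ∀ σ : Equiv.Perm (Fin r),
    IsDSeq R (fun k => x (σ k) ^ n (σ k)) M

/-- The integral closure of an ideal, as a set. -/
def intClos (Q : Ideal R) : Set R :=
  {x : R | ∃ n : ℕ, 0 < n ∧ ∃ a : ℕ → R, (∀ i, 1 ≤ i → i ≤ n → a i ∈ Q ^ i) ∧
    x ^ n + ∑ i ∈ Finset.Icc 1 n, a i * x ^ (n - i) = 0}

variable [IsLocalRing R]

/-- `h ∈ I` is superficial for `M` with respect to `I`. -/
def IsSuperficial (I : Ideal R) (M : Type) [AddCommGroup M] [Module R M] (h : R) : Prop :=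
  h ∈ I ∧ ∃ c N : ℕ, ∀ n ≥ N,
    Submodule.comap (LinearMap.lsmul R M h) (I ^ (n + 1) • (⊤ : Submodule R M))
        ⊓ (I ^ c • (⊤ : Submodule R M))
      = I ^ n • (⊤ : Submodule R M)

/-- `Q` is a parameter ideal for `M` (`r` the dimension of `M`):
generated by `r` elements of the maximal ideal with `M/QM` of finite length. -/
def IsParamIdeal (Q : Ideal R) (M : Type) [AddCommGroup M] [Module R M] (r : ℕ) : Prop :=
  Q ≤ maximalIdeal R ∧ (∃ x : Fin r → R, Q = Ideal.span (Set.range x)) ∧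
    IsFiniteLength R (M ⧸ Q • (⊤ : Submodule R M))

/-- Local cohomology `H^i_𝔪(M)` with support in the maximal ideal. -/
noncomputable def LC (i : ℕ) (M : Type) [AddCommGroup M] [Module R M] : ModuleCat R :=
  (localCohomology (maximalIdeal R) i).obj (ModuleCat.of R M)

/-- `M` is Cohen–Macaulay: there is a regular sequence on `M` in the maximal ideal
whose length equals `dim M`. -/
def IsCM (M : Type) [AddCommGroup M] [Module R M] : Prop :=
  ∃ rs : List R, (∀ x ∈ rs, x ∈ maximalIdeal R) ∧ RingTheory.Sequence.IsRegular M rs ∧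
    (rs.length : WithBot ℕ∞) = mDim R M

/-- `M` is unmixed: `dim R̂/p = dim M` for every associated prime `p` of the completion `M̂`. -/
def IsUnmixed (M : Type) [AddCommGroup M] [Module R M] : Prop :=
  ∀ p ∈ associatedPrimes (AdicCompletion (maximalIdeal R) R)
      (AdicCompletion (maximalIdeal R) M),
    ringKrullDim ((AdicCompletion (maximalIdeal R) R) ⧸ p) = mDim R M

/-- `M` is generalized Cohen–Macaulay: `H^i_𝔪(M)` has finite length for `i < r = dim M`. -/
def IsGenCM (M : Type) [AddCommGroup M] [Module R M] (r : ℕ) : Prop :=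
  ∀ i < r, IsFiniteLength R ↥(LC R i M)

/-- The set `Λ(M)` of first Hilbert coefficients of parameter ideals for `M`. -/
def Lambda (M : Type) [AddCommGroup M] [Module R M] (r : ℕ) : Set ℤ :=
  {a : ℤ | ∃ (Q : Ideal R) (e : ℕ → ℤ),
    IsParamIdeal R Q M r ∧ HasHilbCoeffs R Q M r e ∧ e 1 = a}

/-- A standard parameter ideal: one generated by a standard system of parameters. -/
def IsStandardParamIdeal (Q : Ideal R) (M : Type) [AddCommGroup M] [Module R M]
    (r : ℕ) : Prop :=
  IsParamIdeal R Q M r ∧ ∃ x : Fin r → R, Q = Ideal.span (Set.range x) ∧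
    IsStandardSeq R x M

/-- `M` is Buchsbaum: every parameter ideal for `M` is standard. -/
def IsBuchsbaum (M : Type) [AddCommGroup M] [Module R M] (r : ℕ) : Prop :=
  ∀ Q : Ideal R, IsParamIdeal R Q M r → IsStandardParamIdeal R Q M r

/-- `M` is a Vasconcelos module. -/
def IsVasconcelos (M : Type) [AddCommGroup M] [Module R M] : Prop :=
  mDim R M ≤ 0 ∨ (0 < mDim R M ∧ ∃ (r : ℕ) (Q : Ideal R) (e : ℕ → ℤ),
    mDim R M = (r : ℕ∞) ∧ IsParamIdeal R Q M r ∧ HasHilbCoeffs R Q M r e ∧ e 1 = 0)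

/-- A Gorenstein local ring: Noetherian, Cohen–Macaulay, with an irreducible parameter ideal. -/
def IsGorensteinLocalRing : Prop :=
  IsNoetherianRing R ∧ IsCM R R ∧ ∃ (r : ℕ) (Q : Ideal R),
    mDim R R = (r : ℕ∞) ∧ IsParamIdeal R Q R r ∧
    ∀ I J : Ideal R, Q = I ⊓ J → Q = I ∨ Q = J

/-- `E` is an injective envelope of the residue field `R/𝔪`. -/
def IsInjEnvResidue (E : Type) [AddCommGroup E] [Module R E] : Prop :=
  Module.Injective R E ∧ ∃ ι : (R ⧸ maximalIdeal R) →ₗ[R] E, Function.Injective ι ∧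
    ∀ N : Submodule R E, N ⊓ LinearMap.range ι = ⊥ → N = ⊥

end Defs

/-- A (not necessarily local) Cohen–Macaulay ring: Noetherian,
with all localizations at primes Cohen–Macaulay. -/
def IsCMRing (S : Type) [CommRing S] : Prop :=
  IsNoetherianRing S ∧ ∀ (p : Ideal S) [p.IsPrime],
    IsCM (Localization.AtPrime p) (Localization.AtPrime p)

/-- A (not necessarily local) Gorenstein ring. -/
def IsGorensteinRing (S : Type) [CommRing S] : Prop :=
  IsNoetherianRing S ∧ ∀ (p : Ideal S) [p.IsPrime],
    IsGorensteinLocalRing (Localization.AtPrime p)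

/-- `HDegRel R I E M v` : `v` is the homological degree `hdeg_I(M)` computed
with Matlis duals taken relative to `E`. -/
inductive HDegRel (R : Type) [CommRing R] [IsLocalRing R] (I : Ideal R)
    (E : Type) [AddCommGroup E] [Module R E] : ModuleCat R → ℕ → Prop where
  | base : ∀ (M : ModuleCat R) (l : ℕ), mDim R M ≤ 0 → mLength R M = (l : ℕ∞) →
      HDegRel R I E M l
  | step : ∀ (M : ModuleCat R) (r : ℕ), mDim R M = (r : ℕ∞) → 0 < r →
      ∀ (e : ℕ → ℤ) (e0 : ℕ), HasHilbCoeffs R I M r e → e 0 = (e0 : ℤ) →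
      ∀ v : ℕ → ℕ,
        (∀ j < r, HDegRel R I E (ModuleCat.of R ((LC R j M) →ₗ[R] E)) (v j)) →
      HDegRel R I E M (e0 + ∑ j ∈ Finset.range r, (r - 1).choose j * v j)

section HomologicalAlgebra
open CategoryTheory Limits Opposite

section LeftDerivedLES
universe v u v' u'
variable {C : Type u} [Category.{v} C] {D : Type u'} [Category.{v'} D]
  [Abelian C] [HasProjectiveResolutions C] [Abelian D]
  {F G H : C ⥤ D} [F.Additive] [G.Additive] [H.Additive]
  (α : F ⟶ G) (β : G ⟶ H)

omit [Abelian C] [HasProjectiveResolutions C] in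
lemma exact_conj {A B E A' B' E' : D} {f : A ⟶ B} {g : B ⟶ E} {h : f ≫ g = 0}
    (ex : (ShortComplex.mk f g h).Exact) (i : A' ≅ A) (j : B' ≅ B) (k : E' ≅ E)
    {f' : A' ⟶ B'} {g' : B' ⟶ E'} (hf : f' = i.hom ≫ f ≫ j.inv) (hg : g' = j.hom ≫ g ≫ k.inv) :
    ∃ h', (ShortComplex.mk f' g' h').Exact := by
  subst hf hg
  refine ⟨by simp [reassoc_of% h], ?_⟩
  exact ShortComplex.exact_of_iso (ShortComplex.isoMk i.symm j.symm k.symm (by simp) (by simp)) ex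

omit [Abelian C] [HasProjectiveResolutions C] [Abelian D] in
lemma conj_naturality {A B A' B' a b a' b' : D} {iA : A ⟶ a} {iB : b ⟶ B} {iA' : A' ⟶ a'}
    {iB' : b' ⟶ B'} {d : a ⟶ b} {d' : a' ⟶ b'} {F : A ⟶ A'} {G : B ⟶ B'} {f : a ⟶ a'}
    {g : b ⟶ b'} (e1 : F ≫ iA' = iA ≫ f) (e2 : iB ≫ G = g ≫ iB') (e3 : d ≫ g = f ≫ d') :
    F ≫ iA' ≫ d' ≫ iB' = (iA ≫ d ≫ iB) ≫ G := by
  rw [reassoc_of% e1, Category.assoc, Category.assoc, e2, reassoc_of% e3]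

/-- The short complex of complexes obtained by evaluating `F ⟶ G ⟶ H` on a complex. -/
noncomputable def evalComplexShort (w : α ≫ β = 0) (K : ChainComplex C ℕ) :
    ShortComplex (ChainComplex D ℕ) :=
  ShortComplex.mk ((NatTrans.mapHomologicalComplex α _).app K)
    ((NatTrans.mapHomologicalComplex β _).app K) (by
      ext i
      have := congr_app w (K.X i)
      exact this)

/-- `evalComplexShort` is functorial in the complex. -/
noncomputable def evalComplexShortMap (w : α ≫ β = 0) {K L : ChainComplex C ℕ} (φ : K ⟶ L) :
    evalComplexShort α β w K ⟶ evalComplexShort α β w L where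
  τ₁ := (F.mapHomologicalComplex _).map φ
  τ₂ := (G.mapHomologicalComplex _).map φ
  τ₃ := (H.mapHomologicalComplex _).map φ
  comm₁₂ := (NatTrans.mapHomologicalComplex α _).naturality φ
  comm₂₃ := (NatTrans.mapHomologicalComplex β _).naturality φ

omit [HasProjectiveResolutions C] in
lemma evalComplexShort_shortExact (w : α ≫ β = 0)
    (hse : ∀ (P : C) [Projective P],
      (ShortComplex.mk (α.app P) (β.app P) (by rw [← NatTrans.comp_app, w]; rfl)).ShortExact)
    {X : C} (P : ProjectiveResolution X) :
    (evalComplexShort α β w P.complex).ShortExact :=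
  HomologicalComplex.shortExact_of_degreewise_shortExact _ fun i => hse (P.complex.X i)

theorem exists_leftDerived_connecting (w : α ≫ β = 0)
    (hse : ∀ (P : C) [Projective P],
      (ShortComplex.mk (α.app P) (β.app P) (by rw [← NatTrans.comp_app, w]; rfl)).ShortExact)
    (n : ℕ) :
    ∃ δ : H.leftDerived (n + 1) ⟶ F.leftDerived n, ∀ X : C,
      (∃ h, (ShortComplex.mk ((NatTrans.leftDerived β (n + 1)).app X) (δ.app X) h).Exact) ∧
      (∃ h, (ShortComplex.mk (δ.app X) ((NatTrans.leftDerived α n).app X) h).Exact) ∧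
      (∃ h, (ShortComplex.mk ((NatTrans.leftDerived α n).app X)
        ((NatTrans.leftDerived β n).app X) h).Exact) := by
  have hS (X : C) := evalComplexShort_shortExact α β w hse (projectiveResolution X)
  have hij : (ComplexShape.down ℕ).Rel (n + 1) n := rfl
  let δ : H.leftDerived (n + 1) ⟶ F.leftDerived n :=
    { app := fun X => ((projectiveResolution X).isoLeftDerivedObj H (n + 1)).hom ≫
        (hS X).δ (n + 1) n hij ≫ ((projectiveResolution X).isoLeftDerivedObj F n).inv
      naturality := by
        intro X Y f
        have e1 := ProjectiveResolution.isoLeftDerivedObj_hom_naturality f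
          (projectiveResolution X) (projectiveResolution Y)
          (ProjectiveResolution.lift f _ _) (ProjectiveResolution.lift_commutes_zero f _ _) H (n + 1)
        have e2 := ProjectiveResolution.isoLeftDerivedObj_inv_naturality f
          (projectiveResolution X) (projectiveResolution Y)
          (ProjectiveResolution.lift f _ _) (ProjectiveResolution.lift_commutes_zero f _ _) F n
        have e3 := HomologicalComplex.HomologySequence.δ_naturality
          (evalComplexShortMap α β w (ProjectiveResolution.lift f (projectiveResolution X)
            (projectiveResolution Y))) (hS X) (hS Y) (n + 1) n hij
        exact conj_naturality e1 e2 e3 }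
  refine ⟨δ, fun X => ?_⟩
  let P := projectiveResolution X
  have a1 := P.leftDerived_app_eq α n
  have b1 := P.leftDerived_app_eq β n
  have b2 := P.leftDerived_app_eq β (n + 1)
  exact ⟨exact_conj ((hS X).homology_exact₃ (n + 1) n hij) (P.isoLeftDerivedObj G (n + 1))
      (P.isoLeftDerivedObj H (n + 1)) (P.isoLeftDerivedObj F n) b2 rfl,
    exact_conj ((hS X).homology_exact₁ (n + 1) n hij) (P.isoLeftDerivedObj H (n + 1))
      (P.isoLeftDerivedObj F n) (P.isoLeftDerivedObj G n) rfl a1,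
    exact_conj ((hS X).homology_exact₂ n) (P.isoLeftDerivedObj F n)
      (P.isoLeftDerivedObj G n) (P.isoLeftDerivedObj H n) a1 b1⟩

end LeftDerivedLES

section LocalCohomologyLES

lemma colimMap_exact {J : Type} [SmallCategory J] [IsFiltered J] {R : Type} [CommRing R]
    {A B C : J ⥤ ModuleCat.{0} R} (α : A ⟶ B) (β : B ⟶ C)
    (h : ∀ j, Function.Exact (α.app j).hom (β.app j).hom) :
    Function.Exact (colimMap α).hom (colimMap β).hom := by
  intro y
  constructor
  · intro hy
    obtain ⟨j, y, rfl⟩ := Concrete.colimit_exists_rep _ y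
    have h1 : (colimit.ι C j).hom ((β.app j).hom y) = 0 := by
      rw [← hy]
      exact (congrArg (fun t => t.hom y) (ι_colimMap β j)).symm
    obtain ⟨k, f, hk⟩ := Concrete.colimit_rep_eq_zero R C _ _ h1
    have h2 : (β.app k).hom ((B.map f).hom y) = 0 := by
      rw [← hk]
      exact (congrArg (fun t => t.hom y) (β.naturality f))
    obtain ⟨x, hx⟩ := (h k _).1 h2
    refine ⟨(colimit.ι A k).hom x, ?_⟩
    have e1 : (colimMap α).hom ((colimit.ι A k).hom x) = (colimit.ι B k).hom ((α.app k).hom x) :=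
      congrArg (fun t => t.hom x) (ι_colimMap α k)
    rw [e1, hx]
    exact congrArg (fun t => t.hom y) (colimit.w B f)
  · rintro ⟨x, rfl⟩
    obtain ⟨j, x, rfl⟩ := Concrete.colimit_exists_rep _ x
    have e1 : (colimMap α).hom ((colimit.ι A j).hom x) = (colimit.ι B j).hom ((α.app j).hom x) :=
      congrArg (fun t => t.hom x) (ι_colimMap α j)
    have e2 : (colimMap β).hom ((colimit.ι B j).hom ((α.app j).hom x)) =
        (colimit.ι C j).hom ((β.app j).hom ((α.app j).hom x)) :=
      congrArg (fun t => t.hom ((α.app j).hom x)) (ι_colimMap β j)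
    change (colimMap β).hom ((colimMap α).hom ((colimit.ι A j).hom x)) = 0
    rw [e1, e2, (h j).apply_apply_eq_zero, map_zero]

variable (R : Type) [CommRing R]

/-- The contravariant hom functor into `N`, valued in the opposite category. -/
noncomputable abbrev homInto (N : ModuleCat.{0} R) : ModuleCat.{0} R ⥤ (ModuleCat.{0} R)ᵒᵖ :=
  ((linearYoneda R (ModuleCat.{0} R)).obj N).rightOp

/-- Functoriality of `homInto`. -/
noncomputable abbrev homIntoMap {A B : ModuleCat.{0} R} (f : A ⟶ B) : homInto R B ⟶ homInto R A :=
  NatTrans.rightOp ((linearYoneda R (ModuleCat.{0} R)).map f)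

lemma homIntoMap_shortExact {A B C : ModuleCat.{0} R} (f : A ⟶ B) (g : B ⟶ C)
    (hf : Function.Injective f.hom) (hg : Function.Surjective g.hom)
    (hfg : Function.Exact f.hom g.hom) (P : ModuleCat.{0} R) [Projective P]
    (h : (homIntoMap R g).app P ≫ (homIntoMap R f).app P = 0) :
    (ShortComplex.mk ((homIntoMap R g).app P) ((homIntoMap R f).app P) h).ShortExact := by
  have w : f ≫ g = 0 := by ext x; exact hfg.apply_apply_eq_zero x
  have hS : (ShortComplex.mk f g w).ShortExact :=
    { exact := (ShortComplex.ShortExact.moduleCat_exact_iff_function_exact _).2 hfg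
      mono_f := (ModuleCat.mono_iff_injective _).2 hf
      epi_g := (ModuleCat.epi_iff_surjective _).2 hg }
  let S : ShortComplex (ModuleCat.{0} R) :=
    ShortComplex.mk (((linearYoneda R (ModuleCat.{0} R)).map f).app (op P))
      (((linearYoneda R (ModuleCat.{0} R)).map g).app (op P)) (by
        ext φ
        change (φ ≫ f) ≫ g = 0
        exact (Category.assoc _ _ _).trans ((congrArg (φ ≫ ·) w).trans comp_zero))
  have : S.ShortExact :=
    { exact := by
        rw [ShortComplex.moduleCat_exact_iff]
        intro φ hφ
        have := hS.mono_f
        change φ ≫ g = 0 at hφ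
        exact ⟨hS.exact.lift φ hφ, hS.exact.lift_f φ hφ⟩
      mono_f := by
        rw [ModuleCat.mono_iff_injective]
        intro φ ψ hφ
        have := hS.mono_f
        exact (cancel_mono f).1 hφ
      epi_g := by
        rw [ModuleCat.epi_iff_surjective]
        intro φ
        have := hS.epi_g
        exact ⟨Projective.factorThru φ g, Projective.factorThru_comp φ g⟩ }
  exact this.op

end LocalCohomologyLES

section LocalCohomologySystem

variable (R : Type) [CommRing R]

/-- The directed system of `Ext`-modules computing local cohomology of `N`. -/
noncomputable def extSystem (I : Ideal R) (i : ℕ) (N : ModuleCat.{0} R) :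
    (ℕᵒᵖ)ᵒᵖ ⥤ ModuleCat.{0} R :=
  (localCohomology.ringModIdeals (localCohomology.idealPowersDiagram I)).op ⋙
    ((homInto R N).leftDerived i).leftOp

/-- Functoriality of `extSystem`. -/
noncomputable def extSystemMap (I : Ideal R) (i : ℕ) {N N' : ModuleCat.{0} R} (f : N ⟶ N') :
    extSystem R I i N ⟶ extSystem R I i N' :=
  Functor.whiskerLeft (localCohomology.ringModIdeals (localCohomology.idealPowersDiagram I)).op
    (NatTrans.leftOp (NatTrans.leftDerived (homIntoMap R f) i))

/-- Local cohomology of `N` as the colimit of `extSystem`. -/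
noncomputable def localCohomologyIso (I : Ideal R) (i : ℕ) (N : ModuleCat.{0} R) :
    (localCohomology I i).obj N ≅ colimit (extSystem R I i N) :=
  colimitObjIsoColimitCompEvaluation (localCohomology.diagram
    (localCohomology.idealPowersDiagram I) i) N

lemma localCohomologyIso_naturality (I : Ideal R) (i : ℕ) {N N' : ModuleCat.{0} R} (f : N ⟶ N') :
    (localCohomology I i).map f ≫ (localCohomologyIso R I i N').hom =
      (localCohomologyIso R I i N).hom ≫ colimMap (extSystemMap R I i f) :=
  colimit_map_colimitObjIsoColimitCompEvaluation_hom (localCohomology.diagram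
    (localCohomology.idealPowersDiagram I) i) f

instance : IsFiltered (ℕᵒᵖ)ᵒᵖ := inferInstance

lemma exact_unop {A B C : (ModuleCat.{0} R)ᵒᵖ} {f : A ⟶ B} {g : B ⟶ C} {h : f ≫ g = 0}
    (hE : (ShortComplex.mk f g h).Exact) : Function.Exact g.unop.hom f.unop.hom :=
  (ShortComplex.ShortExact.moduleCat_exact_iff_function_exact _).1 hE.unop

theorem exists_extSystem_connecting (I : Ideal R) {A B C : ModuleCat.{0} R} (f : A ⟶ B) (g : B ⟶ C)
    (hf : Function.Injective f.hom) (hg : Function.Surjective g.hom)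
    (hfg : Function.Exact f.hom g.hom) (i : ℕ) :
    ∃ δ : extSystem R I i C ⟶ extSystem R I (i + 1) A, ∀ j,
      Function.Exact ((extSystemMap R I i f).app j).hom ((extSystemMap R I i g).app j).hom ∧
      Function.Exact ((extSystemMap R I i g).app j).hom (δ.app j).hom ∧
      Function.Exact (δ.app j).hom ((extSystemMap R I (i + 1) f).app j).hom := by
  have w : f ≫ g = 0 := by ext x; exact hfg.apply_apply_eq_zero x
  have w' : homIntoMap R g ≫ homIntoMap R f = 0 := by
    ext P
    apply Quiver.Hom.unop_inj
    ext φ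
    exact (Category.assoc _ _ _).trans ((congrArg (φ ≫ ·) w).trans comp_zero)
  obtain ⟨δ, hδ⟩ := exists_leftDerived_connecting (homIntoMap R g) (homIntoMap R f) w'
    (fun P _ => homIntoMap_shortExact R f g hf hg hfg P _) i
  refine ⟨Functor.whiskerLeft
    (localCohomology.ringModIdeals (localCohomology.idealPowersDiagram I)).op
    (NatTrans.leftOp δ), fun j => ?_⟩
  obtain ⟨⟨h1, e1⟩, ⟨h2, e2⟩, ⟨h3, e3⟩⟩ := hδ
    ((localCohomology.ringModIdeals (localCohomology.idealPowersDiagram I)).obj j.unop)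
  exact ⟨exact_unop R e3, exact_unop R e2, exact_unop R e1⟩

lemma function_exact_conj {A B C A' B' C' : ModuleCat.{0} R} {f : A ⟶ B} {g : B ⟶ C}
    {f' : A' ⟶ B'} {g' : B' ⟶ C'} (a : A' ≅ A) (b : B' ≅ B) (c : C' ≅ C)
    (e1 : f' ≫ b.hom = a.hom ≫ f) (e2 : g' ≫ c.hom = b.hom ≫ g)
    (h : Function.Exact f.hom g.hom) : Function.Exact f'.hom g'.hom := by
  refine (Function.Exact.iff_of_ladder_linearEquiv (e₁ := a.toLinearEquiv) (e₂ := b.toLinearEquiv)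
    (e₃ := c.toLinearEquiv) (f₁₂ := f'.hom) (f₂₃ := g'.hom) (g₁₂ := f.hom) (g₂₃ := g.hom) ?_ ?_).1 h
  · ext x; exact (congrArg (fun t => t.hom x) e1).symm
  · ext x; exact (congrArg (fun t => t.hom x) e2).symm

end LocalCohomologySystem

section LocalCohomologyMaps

variable (R : Type) [CommRing R] [IsLocalRing R]
  {A B C : Type} [AddCommGroup A] [Module R A] [AddCommGroup B] [Module R B]
  [AddCommGroup C] [Module R C]

/-- Functoriality of local cohomology. -/
noncomputable def LCmap (i : ℕ) (f : A →ₗ[R] B) : LC R i A →ₗ[R] LC R i B :=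
  ((localCohomology (maximalIdeal R) i).map (ModuleCat.ofHom f)).hom

@[simp] lemma LCmap_id (i : ℕ) : LCmap R i (LinearMap.id : A →ₗ[R] A) = LinearMap.id := by
  have : (localCohomology (maximalIdeal R) i).map (𝟙 (ModuleCat.of R A)) = 𝟙 _ :=
    CategoryTheory.Functor.map_id _ _
  exact congrArg (fun t => t.hom) this

lemma LCmap_comp (i : ℕ) (f : A →ₗ[R] B) (g : B →ₗ[R] C) :
    LCmap R i (g ∘ₗ f) = LCmap R i g ∘ₗ LCmap R i f := by
  have : (localCohomology (maximalIdeal R) i).map (ModuleCat.ofHom f ≫ ModuleCat.ofHom g) = _ ≫ _ :=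
    CategoryTheory.Functor.map_comp _ _ _
  exact congrArg (fun t => t.hom) this

/-- Isomorphic modules have isomorphic local cohomology. -/
noncomputable def LCequiv (i : ℕ) (e : A ≃ₗ[R] B) : LC R i A ≃ₗ[R] LC R i B :=
  LinearEquiv.ofLinearMap (LCmap R i e.toLinearMap) (LCmap R i e.symm.toLinearMap)
    (by rw [← LCmap_comp, LinearEquiv.comp_symm, LCmap_id])
    (by rw [← LCmap_comp, LinearEquiv.symm_comp, LCmap_id])

theorem exists_LC_connecting (f : A →ₗ[R] B) (g : B →ₗ[R] C)
    (hf : Function.Injective f) (hg : Function.Surjective g) (hfg : Function.Exact f g) (i : ℕ) :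
    Function.Exact (LCmap R i f) (LCmap R i g) ∧
    ∃ δ : LC R i C →ₗ[R] LC R (i + 1) A,
      Function.Exact (LCmap R i g) δ ∧ Function.Exact δ (LCmap R (i + 1) f) := by
  obtain ⟨δ, hδ⟩ := exists_extSystem_connecting R (maximalIdeal R) (ModuleCat.ofHom f)
    (ModuleCat.ofHom g) hf hg hfg i
  have e1 := colimMap_exact _ _ fun j => (hδ j).1
  have e2 := colimMap_exact _ _ fun j => (hδ j).2.1
  have e3 := colimMap_exact _ _ fun j => (hδ j).2.2
  have nf := localCohomologyIso_naturality R (maximalIdeal R) i (ModuleCat.ofHom f)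
  have ng := localCohomologyIso_naturality R (maximalIdeal R) i (ModuleCat.ofHom g)
  have nf' := localCohomologyIso_naturality R (maximalIdeal R) (i + 1) (ModuleCat.ofHom f)
  let δ' := (localCohomologyIso R (maximalIdeal R) i (ModuleCat.of R C)).hom ≫ colimMap δ ≫
    (localCohomologyIso R (maximalIdeal R) (i + 1) (ModuleCat.of R A)).inv
  have nd : δ' ≫ (localCohomologyIso R (maximalIdeal R) (i + 1) (ModuleCat.of R A)).hom =
      (localCohomologyIso R (maximalIdeal R) i (ModuleCat.of R C)).hom ≫ colimMap δ := by
    simp [δ']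
  exact ⟨function_exact_conj R _ _ _ nf ng e1, δ'.hom, function_exact_conj R _ _ _ ng nd e2,
    function_exact_conj R _ _ _ nd nf' e3⟩

end LocalCohomologyMaps

section LocalCohomologyScalars

lemma homologyMap_eq_center {D : Type*} [Category D] [Abelian D] (z : 𝟭 D ⟶ 𝟭 D)
    {K : ChainComplex D ℕ} (φ : K ⟶ K) (h : ∀ i, φ.f i = z.app (K.X i)) (n : ℕ) :
    HomologicalComplex.homologyMap φ n = z.app (K.homology n) := by
  rw [← cancel_epi (K.homologyπ n), HomologicalComplex.homologyπ_naturality]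
  have h1 : HomologicalComplex.cyclesMap φ n = z.app (K.cycles n) := by
    rw [← cancel_mono (K.iCycles n), HomologicalComplex.cyclesMap_i, h]
    exact z.naturality (K.iCycles n)
  rw [h1]
  exact (z.naturality (K.homologyπ n)).symm

lemma center_conj {D : Type*} [Category D] (z : 𝟭 D ⟶ 𝟭 D) {A B : D} (e : A ≅ B)
    {t : B ⟶ B} (ht : t = z.app B) : e.hom ≫ t ≫ e.inv = z.app A := by
  subst ht
  have := z.naturality e.hom
  simp only [Functor.id_map] at this
  rw [reassoc_of% this]; simp

variable (R : Type) [CommRing R]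

/-- Multiplication by `r` as an endomorphism of the identity functor. -/
noncomputable def scalarEnd (r : R) : 𝟭 (ModuleCat.{0} R)ᵒᵖ ⟶ 𝟭 (ModuleCat.{0} R)ᵒᵖ where
  app X := (r • 𝟙 X.unop).op
  naturality X Y f := by
    apply Quiver.Hom.unop_inj
    simp

lemma leftDerived_homIntoMap_smul (N X : ModuleCat.{0} R) (r : R) (n : ℕ) :
    (NatTrans.leftDerived (homIntoMap R (r • 𝟙 N)) n).app X = (scalarEnd R r).app _ := by
  let P := projectiveResolution X
  have := P.leftDerived_app_eq (homIntoMap R (r • 𝟙 N)) n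
  refine this.trans (center_conj _ _ (homologyMap_eq_center (scalarEnd R r) _ ?_ n))
  · intro i
    apply Quiver.Hom.unop_inj
    ext φ
    exact (Linear.comp_smul _ _ _ φ r (𝟙 N)).trans (congrArg (r • ·) (Category.comp_id φ))

lemma leftDerived_map_smul (N X : ModuleCat.{0} R) (r : R) (n : ℕ) :
    ((homInto R N).leftDerived n).map (r • 𝟙 X) = (scalarEnd R r).app _ := by
  let P := projectiveResolution X
  have := Functor.leftDerived_map_eq (homInto R N) n (r • 𝟙 X) (P := P) (Q := P) (r • 𝟙 P.complex) (by
    ext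
    simp
    have e : r • P.π.f 0 = P.π.f 0 ≫ (r • 𝟙 X) := ((Linear.comp_smul _ _ _ (P.π.f 0) r (𝟙 X)).trans
      (congrArg (r • ·) (Category.comp_id _))).symm
    exact DFunLike.congr_fun (congrArg ModuleCat.Hom.hom e) _)
  refine this.trans (center_conj _ _ (homologyMap_eq_center (scalarEnd R r) _ ?_ n))
  · intro i
    apply Quiver.Hom.unop_inj
    ext φ
    exact (Linear.smul_comp _ _ _ r (𝟙 (P.complex.X i)) φ).trans
      (congrArg (r • ·) (Category.id_comp φ))

lemma leftDerived_smul_eq_zero (N X : ModuleCat.{0} R) (r : R) (n : ℕ) (h : r • 𝟙 X = 0) :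
    (scalarEnd R r).app (((homInto R N).leftDerived n).obj X) = 0 := by
  refine (leftDerived_map_smul R N X r n).symm.trans ?_
  rw [h, ← zero_smul R (𝟙 X)]
  refine (leftDerived_map_smul R N X 0 n).trans ?_
  apply Quiver.Hom.unop_inj
  exact zero_smul R (𝟙 _)

end LocalCohomologyScalars

section
variable (R : Type) [CommRing R] [IsLocalRing R]
  {A : Type} [AddCommGroup A] [Module R A] 

lemma LCmap_smul_id (i : ℕ) (r : R) : LCmap R i (r • (LinearMap.id : A →ₗ[R] A)) =
    r • LinearMap.id := by
  have h := localCohomologyIso_naturality R (maximalIdeal R) i (r • 𝟙 (ModuleCat.of R A))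
  have h2 : colimMap (extSystemMap R (maximalIdeal R) i (r • 𝟙 (ModuleCat.of R A))) =
      r • 𝟙 _ := by
    apply colimit.hom_ext
    intro j
    have h3 : (extSystemMap R (maximalIdeal R) i (r • 𝟙 (ModuleCat.of R A))).app j = r • 𝟙 _ :=
      congrArg Quiver.Hom.unop (leftDerived_homIntoMap_smul R (ModuleCat.of R A)
        ((localCohomology.ringModIdeals (localCohomology.idealPowersDiagram (maximalIdeal R))).obj
          j.unop) r i)
    rw [ι_colimMap, h3]
    simp
  rw [h2, Linear.comp_smul, Category.comp_id] at h
  have h4 : (localCohomology (maximalIdeal R) i).map (r • 𝟙 (ModuleCat.of R A)) = r • 𝟙 _ := by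
    rw [← cancel_mono (localCohomologyIso R (maximalIdeal R) i (ModuleCat.of R A)).hom, h]
    simp
  exact congrArg (fun t => t.hom) h4

lemma LC_torsion (i : ℕ) (x : LC R i A) : ∃ k, ∀ r ∈ maximalIdeal R ^ k, r • x = 0 := by
  obtain ⟨y, rfl⟩ := (localCohomologyIso R (maximalIdeal R) i (ModuleCat.of R A)).toLinearEquiv.symm.surjective x
  obtain ⟨j, y, rfl⟩ := Concrete.colimit_exists_rep _ y
  refine ⟨j.unop.unop, fun r hr => ?_⟩
  have h := leftDerived_smul_eq_zero R (ModuleCat.of R A)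
    ((localCohomology.ringModIdeals (localCohomology.idealPowersDiagram (maximalIdeal R))).obj
      j.unop) r i (by
      ext x
      obtain ⟨x, rfl⟩ := Ideal.Quotient.mk_surjective x
      change Ideal.Quotient.mk _ (r * x) = 0
      exact Ideal.Quotient.eq_zero_iff_mem.2 (Ideal.mul_mem_right _ _ hr))
  have h2 : r • y = 0 := congrArg (fun t => t.unop.hom y) h
  have h3 : r • (colimit.ι (extSystem R (maximalIdeal R) i (ModuleCat.of R A)) j).hom y = 0 :=
    (map_smul _ _ _).symm.trans ((congrArg _ h2).trans (map_zero _))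
  exact (map_smul (localCohomologyIso R (maximalIdeal R) i
    (ModuleCat.of R A)).toLinearEquiv.symm r _).symm.trans ((congrArg _ h3).trans (map_zero _))

end

section LocalCohomologyInjective
variable (R : Type) [CommRing R]

lemma homInto_map_exact (N : ModuleCat.{0} R) [Injective N] (S : ShortComplex (ModuleCat.{0} R))
    (hS : S.Exact) : (S.map (homInto R N)).Exact := by
  let T : ShortComplex (ModuleCat.{0} R) :=
    ShortComplex.mk (((linearYoneda R (ModuleCat.{0} R)).obj N).map S.g.op)
      (((linearYoneda R (ModuleCat.{0} R)).obj N).map S.f.op) (by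
        ext φ
        exact (Category.assoc _ _ _).symm.trans ((congrArg (· ≫ φ) S.zero).trans zero_comp))
  have hT : T.Exact := by
    rw [ShortComplex.moduleCat_exact_iff]
    intro φ hφ
    exact ⟨hS.descToInjective φ hφ, hS.comp_descToInjective φ hφ⟩
  exact hT.op

lemma isZero_leftDerived_homInto (N : ModuleCat.{0} R) [Injective N] (X : ModuleCat.{0} R) (n : ℕ) :
    IsZero (((homInto R N).leftDerived (n + 1)).obj X) := by
  let P := projectiveResolution X
  refine IsZero.of_iso ?_ (P.isoLeftDerivedObj (homInto R N) (n + 1))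
  have : (((homInto R N).mapHomologicalComplex (ComplexShape.down ℕ)).obj P.complex).ExactAt (n + 1) :=
    homInto_map_exact R N _ (P.complex_exactAt_succ n)
  exact this.isZero_homology

instance homInto_preservesFiniteColimits (N : ModuleCat.{0} R) :
    PreservesFiniteColimits (homInto R N) := by
  have : PreservesLimits ((linearYoneda R (ModuleCat.{0} R)).obj N ⋙ forget _) :=
    (inferInstance : PreservesLimits (yoneda.obj N))
  have : PreservesLimits ((linearYoneda R (ModuleCat.{0} R)).obj N) :=
    preservesLimits_of_reflects_of_preserves _ (forget _)
  have : PreservesFiniteLimits ((linearYoneda R (ModuleCat.{0} R)).obj N) := inferInstance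
  exact preservesFiniteColimits_rightOp _

end LocalCohomologyInjective

section
variable (R : Type) [CommRing R] [IsLocalRing R]
  {A : Type} [AddCommGroup A] [Module R A] 

lemma LC_eq_zero_of_injective [hA : Module.Injective R A] (i : ℕ) (x : LC R (i + 1) A) : x = 0 := by
  have : Injective (ModuleCat.of R A) :=
    (Module.injective_iff_injective_object R A).1 hA
  obtain ⟨y, rfl⟩ := (localCohomologyIso R (maximalIdeal R) (i + 1)
    (ModuleCat.of R A)).toLinearEquiv.symm.surjective x
  obtain ⟨j, y, rfl⟩ := Concrete.colimit_exists_rep _ y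
  have h := (isZero_leftDerived_homInto R (ModuleCat.of R A)
    ((localCohomology.ringModIdeals (localCohomology.idealPowersDiagram (maximalIdeal R))).obj
      j.unop) i).unop
  have := ModuleCat.subsingleton_of_isZero h
  have hy : y = 0 := @Subsingleton.elim _ this _ _
  rw [hy]
  exact (congrArg _ (map_zero _)).trans (map_zero _)

end

section LeftDerivedZero
universe v u v' u'
variable {C : Type u} [Category.{v} C] {D : Type u'} [Category.{v'} D]
  [Abelian C] [HasProjectiveResolutions C] [Abelian D]
  {F G : C ⥤ D} [F.Additive] [G.Additive] (α : F ⟶ G)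

omit [Abelian C] [HasProjectiveResolutions C] [Abelian D] in
lemma conj_naturality_desc {A A' a a' o o' b b' : D} {iA : A ⟶ a} {iA' : A' ≅ a'}
    {h : a ⟶ a'} {j : a ⟶ o} {j' : a' ⟶ o'} {k : o ⟶ o'} {p : o ⟶ b} {p' : o' ⟶ b'} {t : b ⟶ b'}
    {L : A ⟶ A'} {M : A ⟶ b} {M' : A' ⟶ b'} (e0 : L = iA ≫ h ≫ iA'.inv) (e1 : M = iA ≫ j ≫ p)
    (e2 : M' = iA'.hom ≫ j' ≫ p') (e3 : h ≫ j' = j ≫ k) (e4 : k ≫ p' = p ≫ t) :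
    L ≫ M' = M ≫ t := by
  subst e0 e1 e2
  simp [reassoc_of% e3, e4]

lemma fromLeftDerivedZero_naturality (X : C) :
    (NatTrans.leftDerived α 0).app X ≫ G.fromLeftDerivedZero.app X =
      F.fromLeftDerivedZero.app X ≫ α.app X := by
  let P := projectiveResolution X
  refine conj_naturality_desc (P.leftDerived_app_eq α 0) (P.fromLeftDerivedZero_eq F)
    (P.fromLeftDerivedZero_eq G) (HomologicalComplex.homologyι_naturality _ _) ?_
  rw [← cancel_epi (HomologicalComplex.pOpcycles _ _)]
  have h1 := P.pOpcycles_comp_fromLeftDerivedZero' F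
  have h2 := P.pOpcycles_comp_fromLeftDerivedZero' G
  have h3 := HomologicalComplex.p_opcyclesMap
    ((NatTrans.mapHomologicalComplex α (ComplexShape.down ℕ)).app P.complex) 0
  rw [reassoc_of% h3, h2, reassoc_of% h1]
  exact (α.naturality (P.π.f 0)).symm

lemma leftDerivedZeroIsoSelf_inv_naturality [PreservesFiniteColimits F] [PreservesFiniteColimits G]
    (X : C) : α.app X ≫ G.leftDerivedZeroIsoSelf.inv.app X =
      F.leftDerivedZeroIsoSelf.inv.app X ≫ (NatTrans.leftDerived α 0).app X := by
  rw [← cancel_epi (F.fromLeftDerivedZero.app X), ← reassoc_of% fromLeftDerivedZero_naturality]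
  simp

end LeftDerivedZero

section LCzero

lemma comp_eq_of_comp_eq {C : Type*} [Category C] {A B D E G H : C} {a : A ⟶ B} {u' : B ⟶ D}
    {c' : D ⟶ E} {u : A ⟶ G} {t : G ⟶ D} {c : G ⟶ H} {f : H ⟶ E} (e1 : a ≫ u' = u ≫ t)
    (e2 : t ≫ c' = c ≫ f) : a ≫ u' ≫ c' = u ≫ c ≫ f := by
  rw [reassoc_of% e1, e2]

lemma comp_assoc_eq_of_comp_eq {C : Type*} [Category C] {A A' X X' Y Y' B B' : C} {m : A ⟶ A'}
    {i : A ⟶ X} {i' : A' ⟶ X'} {k : X ⟶ X'} {j : X ⟶ Y} {j' : X' ⟶ Y'} {d : Y ⟶ B}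
    {d' : Y' ⟶ B'} {f : B ⟶ B'} (h : m ≫ i' = i ≫ k) (key : k ≫ j' ≫ d' = j ≫ d ≫ f) :
    m ≫ (i' ≫ j') ≫ d' = ((i ≫ j) ≫ d) ≫ f := by
  simp only [Category.assoc]
  rw [reassoc_of% h, key]

lemma colimMap_isoOfNatIso_desc {J C : Type*} [Category J] [Category C] [HasColimitsOfShape J C]
    {F F' G G' : J ⥤ C} (a : F ⟶ F') (u : F ≅ G) (u' : F' ≅ G') (c : Cocone G) (c' : Cocone G')
    (f : c.pt ⟶ c'.pt)
    (h : ∀ j, a.app j ≫ u'.hom.app j ≫ c'.ι.app j = u.hom.app j ≫ c.ι.app j ≫ f) :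
    colimMap a ≫ (HasColimit.isoOfNatIso u').hom ≫ colimit.desc _ c' =
      (HasColimit.isoOfNatIso u).hom ≫ colimit.desc _ c ≫ f := by
  apply colimit.hom_ext
  intro j
  rw [ι_colimMap_assoc, HasColimit.isoOfNatIso_ι_hom_assoc, colimit.ι_desc,
      HasColimit.isoOfNatIso_ι_hom_assoc, colimit.ι_desc_assoc, h]

variable (R : Type) [CommRing R] [IsLocalRing R]
  {A : Type} [AddCommGroup A] [Module R A]

/-- The directed system of the submodules `{x | 𝔪 ^ t x = 0}`. -/
noncomputable def extSystemZeroIso (N : ModuleCat.{0} R) :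
    extSystem R (maximalIdeal R) 0 N ≅ 
    (localCohomology.ringModIdeals (localCohomology.idealPowersDiagram (maximalIdeal R))).op ⋙
      (homInto R N).leftOp :=
  Functor.isoWhiskerLeft _ (Functor.isoWhiskerRight
    (NatIso.op (homInto R N).leftDerivedZeroIsoSelf.symm) (unopUnop _))

/-- Evaluation at `1`. -/
noncomputable def evalOneCocone (N : ModuleCat.{0} R) : Cocone
    ((localCohomology.ringModIdeals (localCohomology.idealPowersDiagram (maximalIdeal R))).op ⋙
      (homInto R N).leftOp) where
  pt := N
  ι :=
    { app := fun j => ModuleCat.ofHom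
        { toFun := fun φ => (show ModuleCat.of R (R ⧸ maximalIdeal R ^ j.unop.unop) ⟶ N from φ).hom
            (Ideal.Quotient.mk _ 1)
          map_add' := fun _ _ => rfl
          map_smul' := fun _ _ => rfl }
      naturality := fun j k f => by
        ext φ
        rfl }

/-- The target of `localCohomologyIso` in degree zero. -/
noncomputable def LCzeroIso (N : ModuleCat.{0} R) : (localCohomology (maximalIdeal R) 0).obj N ≅
    colimit ((localCohomology.ringModIdeals (localCohomology.idealPowersDiagram
      (maximalIdeal R))).op ⋙ (homInto R N).leftOp) :=
  localCohomologyIso R (maximalIdeal R) 0 N ≪≫ HasColimit.isoOfNatIso (extSystemZeroIso R N)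

/-- The canonical map from the zeroth local cohomology, as a morphism. -/
noncomputable def LCzeroHom (N : ModuleCat.{0} R) :
    (localCohomology (maximalIdeal R) 0).obj N ⟶ N :=
  (LCzeroIso R N).hom ≫ colimit.desc _ (evalOneCocone R N)

lemma LCzeroHom_naturality {N N' : ModuleCat.{0} R} (f : N ⟶ N') :
    (localCohomology (maximalIdeal R) 0).map f ≫ LCzeroHom R N' = LCzeroHom R N ≫ f := by
  have h := localCohomologyIso_naturality R (maximalIdeal R) 0 f
  have key : colimMap (extSystemMap R (maximalIdeal R) 0 f) ≫
      (HasColimit.isoOfNatIso (extSystemZeroIso R N')).hom ≫ colimit.desc _ (evalOneCocone R N') =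
      (HasColimit.isoOfNatIso (extSystemZeroIso R N)).hom ≫
        colimit.desc _ (evalOneCocone R N) ≫ f := by
    refine colimMap_isoOfNatIso_desc (extSystemMap R (maximalIdeal R) 0 f) (extSystemZeroIso R N)
      (extSystemZeroIso R N') (evalOneCocone R N) (evalOneCocone R N') f fun j => ?_
    have e1 : (extSystemMap R (maximalIdeal R) 0 f).app j ≫ (extSystemZeroIso R N').hom.app j =
        (extSystemZeroIso R N).hom.app j ≫ (homIntoMap R f |> NatTrans.leftOp).app
          (op ((localCohomology.ringModIdeals
            (localCohomology.idealPowersDiagram (maximalIdeal R))).obj j.unop)) :=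
      congrArg Quiver.Hom.unop (leftDerivedZeroIsoSelf_inv_naturality (homIntoMap R f)
        ((localCohomology.ringModIdeals
            (localCohomology.idealPowersDiagram (maximalIdeal R))).obj j.unop)).symm
    have e2 : (homIntoMap R f |> NatTrans.leftOp).app
          (op ((localCohomology.ringModIdeals
            (localCohomology.idealPowersDiagram (maximalIdeal R))).obj j.unop)) ≫
          (evalOneCocone R N').ι.app j = (evalOneCocone R N).ι.app j ≫ f := by
      ext φ
      rfl
    exact comp_eq_of_comp_eq e1 e2
  exact comp_assoc_eq_of_comp_eq h key

variable (A) in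
/-- The canonical map from the zeroth local cohomology. -/
noncomputable def LCzero : LC R 0 A →ₗ[R] A := (LCzeroHom R (ModuleCat.of R A)).hom

lemma LCzero_LCmap {B : Type} [AddCommGroup B] [Module R B] (f : A →ₗ[R] B) (x : LC R 0 A) :
    LCzero R B (LCmap R 0 f x) = f (LCzero R A x) :=
  DFunLike.congr_fun (congrArg ModuleCat.Hom.hom (LCzeroHom_naturality R (ModuleCat.ofHom f))) x

theorem LCzero_injective_and_range : Function.Injective (LCzero R A) ∧
    ∀ x, (∃ y, LCzero R A y = x) ↔ ∃ k, ∀ r ∈ maximalIdeal R ^ k, r • x = 0 := by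
  let N := ModuleCat.of R A
  let G := (localCohomology.ringModIdeals (localCohomology.idealPowersDiagram
    (maximalIdeal R))).op ⋙ (homInto R N).leftOp
  let ε : LC R 0 A ≅ colimit G := LCzeroIso R N
  let d : colimit G ⟶ N := colimit.desc G (evalOneCocone R N)
  have hd (j) (φ : ModuleCat.of R (R ⧸ maximalIdeal R ^ j) ⟶ N) :
      d.hom ((colimit.ι G (op (op j))).hom φ) = φ.hom (Ideal.Quotient.mk _ 1) :=
    congrArg (fun t => t.hom φ) (colimit.ι_desc (evalOneCocone R N) (op (op j)))
  refine ⟨?_, fun x => ⟨?_, ?_⟩⟩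
  · have : Function.Injective d.hom := by
      rw [injective_iff_map_eq_zero]
      intro y hy
      obtain ⟨j, φ, rfl⟩ := Concrete.colimit_exists_rep _ y
      have h1 := (hd j.unop.unop φ).symm.trans hy
      have : φ = 0 := by
        refine ModuleCat.hom_ext (M := ModuleCat.of R (R ⧸ maximalIdeal R ^ j.unop.unop)) (N := N) ?_
        refine LinearMap.ext fun x => ?_
        obtain ⟨x, rfl⟩ := Ideal.Quotient.mk_surjective x
        have h3 : (Ideal.Quotient.mk (maximalIdeal R ^ j.unop.unop) x) = x • Ideal.Quotient.mk _ 1 := by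
          rw [← Ideal.Quotient.mk_eq_mk, ← Ideal.Quotient.mk_eq_mk, ← Submodule.Quotient.mk_smul]
          simp
        rw [h3, map_smul]
        exact (congrArg (x • ·) h1).trans (smul_zero _)
      rw [this]
      exact map_zero _
    exact this.comp ε.toLinearEquiv.injective
  · rintro ⟨y, rfl⟩
    obtain ⟨k, hk⟩ := LC_torsion R 0 y
    exact ⟨k, fun r hr => by rw [← map_smul, hk r hr, map_zero]⟩
  · rintro ⟨k, hk⟩
    let φ : ModuleCat.of R (R ⧸ maximalIdeal R ^ k) ⟶ N := ModuleCat.ofHom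
      (Submodule.liftQ _ (LinearMap.toSpanSingleton R A x) fun r hr => by simpa using hk r hr)
    refine ⟨ε.inv.hom ((colimit.ι G (op (op k))).hom φ), ?_⟩
    have h1 : ε.hom.hom (ε.inv.hom ((colimit.ι G (op (op k))).hom φ)) = 
      (colimit.ι G (op (op k))).hom φ := DFunLike.congr_fun (congrArg ModuleCat.Hom.hom ε.inv_hom_id) _
    refine (congrArg d.hom h1).trans ((hd k φ).trans ?_)
    exact one_smul R x

end LCzero

section Torsion
variable (R : Type) [CommRing R] [IsLocalRing R]

/-- Every element is killed by a power of the maximal ideal. -/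
def IsMaxTorsion (A : Type) [AddCommGroup A] [Module R A] : Prop :=
  ∀ x : A, ∃ k, ∀ r ∈ maximalIdeal R ^ k, r • x = 0

/-- The submodule of elements killed by a power of the maximal ideal. -/
def maxTorsion (A : Type) [AddCommGroup A] [Module R A] : Submodule R A where
  carrier := {x | ∃ k, ∀ r ∈ maximalIdeal R ^ k, r • x = 0}
  zero_mem' := ⟨0, by simp⟩
  add_mem' := by
    rintro x y ⟨k, hk⟩ ⟨l, hl⟩
    refine ⟨k + l, fun r hr => ?_⟩
    rw [smul_add, hk r (Ideal.pow_le_pow_right (by omega) hr),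
      hl r (Ideal.pow_le_pow_right (by omega) hr), add_zero]
  smul_mem' := by
    rintro c x ⟨k, hk⟩
    exact ⟨k, fun r hr => by rw [smul_comm, hk r hr, smul_zero]⟩

variable {A B C : Type} [AddCommGroup A] [Module R A] [AddCommGroup B] [Module R B]
  [AddCommGroup C] [Module R C]

lemma isMaxTorsion_maxTorsion : IsMaxTorsion R (maxTorsion R A) := by
  rintro ⟨x, k, hk⟩
  exact ⟨k, fun r hr => Subtype.ext (hk r hr)⟩

lemma IsMaxTorsion.of_surjective {f : A →ₗ[R] B} (h : IsMaxTorsion R A)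
    (hf : Function.Surjective f) : IsMaxTorsion R B := by
  intro y
  obtain ⟨x, rfl⟩ := hf y
  obtain ⟨k, hk⟩ := h x
  exact ⟨k, fun r hr => by rw [← map_smul, hk r hr, map_zero]⟩

lemma exists_pow_smul_eq_zero_of_fg [IsNoetherianRing R] (h : IsMaxTorsion R A)
    {N : Submodule R A} (hN : N.FG) : ∃ k, ∀ r ∈ maximalIdeal R ^ k, ∀ x ∈ N, r • x = 0 := by
  induction N, hN using Submodule.fg_induction with
  | singleton x =>
    obtain ⟨k, hk⟩ := h x
    refine ⟨k, fun r hr y hy => ?_⟩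
    obtain ⟨c, rfl⟩ := Submodule.mem_span_singleton.1 hy
    rw [smul_comm, hk r hr, smul_zero]
  | sup N N' _ _ h1 h2 =>
    obtain ⟨k, hk⟩ := h1
    obtain ⟨l, hl⟩ := h2
    refine ⟨k + l, fun r hr y hy => ?_⟩
    obtain ⟨a, ha, b, hb, rfl⟩ := Submodule.mem_sup.1 hy
    rw [smul_add, hk r (Ideal.pow_le_pow_right (by omega) hr) a ha,
      hl r (Ideal.pow_le_pow_right (by omega) hr) b hb, add_zero]

lemma injective_maxTorsion [IsNoetherianRing R] [Module.Injective R A] :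
    Module.Injective R (maxTorsion R A) := by
  apply Module.Baer.injective
  intro J g
  obtain ⟨k, hk⟩ := exists_pow_smul_eq_zero_of_fg R (isMaxTorsion_maxTorsion R (A := A))
    (N := LinearMap.range g) (by
      rw [LinearMap.range_eq_map]
      exact (IsNoetherian.noetherian (⊤ : Submodule R J)).map g)
  obtain ⟨n, hn⟩ := Ideal.exists_pow_inf_eq_pow_smul (maximalIdeal R) (J : Submodule R R)
  have hAR := hn (n + k) (by omega)
  have hle : Submodule.comap (Submodule.subtype J) (maximalIdeal R ^ (n + k)) ≤ LinearMap.ker g := by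
    intro x hx
    have : (x : R) ∈ maximalIdeal R ^ k • (J : Submodule R R) := by
      have h1 : (x : R) ∈ (maximalIdeal R ^ (n + k) • ⊤ ⊓ J : Submodule R R) :=
        ⟨by simpa using hx, x.2⟩
      rw [hAR] at h1
      have h2 := smul_mono_right (maximalIdeal R ^ (n + k - n)) (inf_le_right : (maximalIdeal R ^ n • ⊤ ⊓ J : Submodule R R) ≤ J) h1
      simpa using h2
    have key : ∀ y (_ : y ∈ maximalIdeal R ^ k • (J : Submodule R R)),
        ∃ hy : y ∈ J, g ⟨y, hy⟩ = 0 := by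
      intro y hy
      induction hy using Submodule.smul_induction_on' with
      | smul r hr n hn =>
        refine ⟨J.smul_mem r hn, ?_⟩
        have : g ⟨r • n, J.smul_mem r hn⟩ = r • g ⟨n, hn⟩ := by
          rw [← map_smul]; rfl
        rw [this]
        exact hk r hr _ ⟨_, rfl⟩
      | add x hx y hy h1 h2 =>
        obtain ⟨h1, h1'⟩ := h1
        obtain ⟨h2, h2'⟩ := h2
        refine ⟨J.add_mem h1 h2, ?_⟩
        have : g ⟨x + y, J.add_mem h1 h2⟩ = g ⟨x, h1⟩ + g ⟨y, h2⟩ := by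
          rw [← map_add]; rfl
        rw [this, h1', h2', add_zero]
    exact (key x this).2
  let q : (J ⧸ Submodule.comap (Submodule.subtype J) (maximalIdeal R ^ (n + k))) →ₗ[R] R ⧸ maximalIdeal R ^ (n + k) :=
    Submodule.mapQ _ _ (Submodule.subtype J) le_rfl
  have hq : Function.Injective q := by
    rw [← LinearMap.ker_eq_bot, Submodule.ker_mapQ, Submodule.mkQ_map_self]
  obtain ⟨h, hh⟩ := Module.Injective.out q hq
    (((maxTorsion R A).subtype ∘ₗ Submodule.liftQ _ g hle))
  have he : h (Submodule.Quotient.mk 1) ∈ maxTorsion R A := by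
    refine ⟨n + k, fun r hr => ?_⟩
    rw [← map_smul, ← Submodule.Quotient.mk_smul, (Submodule.Quotient.mk_eq_zero _).2, map_zero]
    simpa using hr
  refine ⟨LinearMap.toSpanSingleton R _ ⟨_, he⟩, fun x hx => Subtype.ext ?_⟩
  have := hh (Submodule.Quotient.mk ⟨x, hx⟩)
  simp only [LinearMap.coe_comp, Function.comp_apply, Submodule.liftQ_apply, Submodule.subtype_apply] at this
  rw [← this]
  simp only [LinearMap.toSpanSingleton_apply, SetLike.val_smul, q, Submodule.mapQ_apply]
  rw [← map_smul, ← Submodule.Quotient.mk_smul]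
  simp

omit [IsLocalRing R] in
lemma exists_injective_embedding (A : Type) [AddCommGroup A] [Module R A] :
    ∃ (I : Type) (_ : AddCommGroup I) (_ : Module R I) (_ : Module.Injective R I)
      (f : A →ₗ[R] I), Function.Injective f := by
  obtain ⟨⟨J, hJ, f, hf⟩⟩ := (inferInstance : EnoughInjectives (ModuleCat.{0} R)).presentation (ModuleCat.of R A)
  exact ⟨J, inferInstance, inferInstance, Module.injective_module_of_injective_object R J, f.hom,
    (ModuleCat.mono_iff_injective f).1 hf⟩

lemma LC_zero_map_surjective (f : A →ₗ[R] B) (hf : Function.Surjective f) (hA : IsMaxTorsion R A) :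
    Function.Surjective (LCmap R 0 f) := by
  intro y
  obtain ⟨x, hx⟩ := hf (LCzero R B y)
  obtain ⟨z, hz⟩ := ((LCzero_injective_and_range R).2 x).2 (hA x)
  refine ⟨z, (LCzero_injective_and_range R).1 ?_⟩
  rw [LCzero_LCmap, hz, hx]

theorem LC_succ_eq_zero_of_isMaxTorsion [IsNoetherianRing R] (i : ℕ) (hA : IsMaxTorsion R A)
    (x : LC R (i + 1) A) : x = 0 := by
  induction i generalizing A with
  | zero =>
    obtain ⟨I, _, _, _, f, hf⟩ := exists_injective_embedding R A
    have := injective_maxTorsion R (A := I)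
    let g : A →ₗ[R] maxTorsion R I := f.codRestrict _ fun x => by
      obtain ⟨k, hk⟩ := hA x
      exact ⟨k, fun r hr => by rw [← map_smul, hk r hr, map_zero]⟩
    have hg : Function.Injective g := fun a b h => hf (congrArg Subtype.val h)
    obtain ⟨-, δ, h1, h2⟩ := exists_LC_connecting R g (LinearMap.range g).mkQ hg
      (Submodule.mkQ_surjective _) (LinearMap.exact_map_mkQ_range g) 0
    obtain ⟨y, rfl⟩ := (h2 x).1 (LC_eq_zero_of_injective R 0 _)
    exact (h1 y).2 (LC_zero_map_surjective R _ (Submodule.mkQ_surjective _)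
      (isMaxTorsion_maxTorsion R) y)
  | succ i ih =>
    obtain ⟨I, _, _, _, f, hf⟩ := exists_injective_embedding R A
    have := injective_maxTorsion R (A := I)
    let g : A →ₗ[R] maxTorsion R I := f.codRestrict _ fun x => by
      obtain ⟨k, hk⟩ := hA x
      exact ⟨k, fun r hr => by rw [← map_smul, hk r hr, map_zero]⟩
    have hg : Function.Injective g := fun a b h => hf (congrArg Subtype.val h)
    obtain ⟨-, δ, h1, h2⟩ := exists_LC_connecting R g (LinearMap.range g).mkQ hg
      (Submodule.mkQ_surjective _) (LinearMap.exact_map_mkQ_range g) (i + 1)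
    obtain ⟨y, rfl⟩ := (h2 x).1 (LC_eq_zero_of_injective R _ _)
    rw [ih ((isMaxTorsion_maxTorsion R).of_surjective R (Submodule.mkQ_surjective _)) y, map_zero]

end Torsion

end HomologicalAlgebra

section Colength
variable {S : Type} [CommRing S] [IsLocalRing S] {M : Type} [AddCommGroup M] [Module S M]

/-- A submodule containing a power of the maximal ideal times the ambient module. -/
def IsPrim (K : Submodule S M) : Prop :=
  ∃ k, maximalIdeal S ^ k • (⊤ : Submodule S M) ≤ K

lemma IsPrim.mono {K L : Submodule S M} (h : IsPrim K) (hKL : K ≤ L) : IsPrim L :=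
  h.imp fun _ hk => hk.trans hKL

variable [IsNoetherianRing S]

lemma isArtinianRing_quotient_pow (k : ℕ) : IsArtinianRing (S ⧸ maximalIdeal S ^ (k + 1)) := by
  apply IsLocalRing.quotient_artinian_of_mem_minimalPrimes_of_isLocalRing
  refine ⟨⟨inferInstance, Ideal.pow_le_self (by omega)⟩, fun p hp _ => ?_⟩
  exact (hp.1.pow_le_iff (by omega)).1 hp.2

lemma isFiniteLength_of_pow_smul_eq_zero {N : Type*} [AddCommGroup N] [Module S N]
    [Module.Finite S N] {k : ℕ} (h : ∀ a ∈ maximalIdeal S ^ k, ∀ x : N, a • x = 0) :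
    IsFiniteLength S N := by
  rw [isFiniteLength_iff_isNoetherian_isArtinian]
  refine ⟨inferInstance, ?_⟩
  have htor : Module.IsTorsionBySet S N (maximalIdeal S ^ (k + 1) : Ideal S) := fun x a =>
    h a (Ideal.pow_le_pow_right (by omega) a.2) x
  let _ := htor.module
  have := htor.isScalarTower (S := S)
  have := isArtinianRing_quotient_pow (S := S) k
  have : Module.Finite (S ⧸ maximalIdeal S ^ (k + 1)) N := Module.Finite.of_restrictScalars_finite S _ _
  exact isArtinian_of_surjective_algebraMap (R := S ⧸ maximalIdeal S ^ (k + 1))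
    Ideal.Quotient.mk_surjective

variable [Module.Finite S M]

lemma IsPrim.isFiniteLength {K : Submodule S M} (h : IsPrim K) : IsFiniteLength S (M ⧸ K) := by
  obtain ⟨k, hk⟩ := h
  refine isFiniteLength_of_pow_smul_eq_zero (k := k) fun a ha x => ?_
  obtain ⟨x, rfl⟩ := Submodule.Quotient.mk_surjective _ x
  rw [← Submodule.Quotient.mk_smul, Submodule.Quotient.mk_eq_zero]
  exact hk (Submodule.smul_mem_smul ha trivial)

lemma IsPrim.length_ne_top {K : Submodule S M} (h : IsPrim K) : Module.length S (M ⧸ K) ≠ ⊤ :=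
  Module.length_ne_top_iff.2 h.isFiniteLength

omit [IsLocalRing S] [IsNoetherianRing S] [Module.Finite S M] in
/-- The relative length of two submodules, `⊤` when infinite. -/
noncomputable def relLength (A B : Submodule S M) : ℕ∞ :=
  Module.length S (B ⧸ A.comap B.subtype)

omit [IsLocalRing S] [IsNoetherianRing S] [Module.Finite S M] in
lemma length_quotient_eq_add {A B : Submodule S M} (h : A ≤ B) :
    Module.length S (M ⧸ A) = relLength A B + Module.length S (M ⧸ B) := by
  refine Module.length_eq_add_of_exact (Submodule.mapQ _ A B.subtype le_rfl)
    (Submodule.factor h) ?_ (Submodule.factor_surjective h) ?_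
  · rw [← LinearMap.ker_eq_bot, Submodule.ker_mapQ]
    exact Submodule.mkQ_map_self _
  · rw [LinearMap.exact_iff, Submodule.range_mapQ]
    simp [Submodule.factor, Submodule.ker_mapQ]

omit [IsLocalRing S] [IsNoetherianRing S] [Module.Finite S M] in
lemma relLength_sup (A B : Submodule S M) : relLength A (A ⊔ B) = relLength (A ⊓ B) B := by
  have e := (LinearMap.quotientInfEquivSupQuotient B A).length_eq
  unfold relLength
  rw [sup_comm, inf_comm]
  simp only [Submodule.comap_inf]
  exact e.symm

omit [IsLocalRing S] [IsNoetherianRing S] [Module.Finite S M] in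
lemma length_quotient_eq_colon (A : Submodule S M) (x : S) :
    Module.length S (M ⧸ A) = Module.length S (M ⧸ A.comap (LinearMap.lsmul S M x)) +
      Module.length S (M ⧸ (A ⊔ Ideal.span {x} • ⊤)) := by
  refine Module.length_eq_add_of_exact (Submodule.mapQ _ A (LinearMap.lsmul S M x) le_rfl)
    (Submodule.factor le_sup_left) ?_ (Submodule.factor_surjective _) ?_
  · rw [← LinearMap.ker_eq_bot, Submodule.ker_mapQ]
    exact Submodule.mkQ_map_self _
  · rw [LinearMap.exact_iff, Submodule.range_mapQ]
    simp only [Submodule.factor, Submodule.ker_mapQ, Submodule.comap_id, Submodule.map_sup,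
      Submodule.mkQ_map_self, bot_sup_eq]
    congr 1
    ext u
    simp [Submodule.ideal_span_singleton_smul,
      LinearMap.mem_range, Submodule.mem_smul_pointwise_iff_exists]

/-- The colength of a submodule as a natural number. -/
noncomputable def colen (K : Submodule S M) : ℕ := (Module.length S (M ⧸ K)).toNat

/-- The relative length of two submodules as a natural number. -/
noncomputable def relLen (A B : Submodule S M) : ℕ := (relLength A B).toNat

lemma IsPrim.coe_colen {K : Submodule S M} (h : IsPrim K) :
    (colen K : ℕ∞) = Module.length S (M ⧸ K) := ENat.natCast_toNat h.length_ne_top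

lemma IsPrim.coe_relLen {A B : Submodule S M} (h : IsPrim A) :
    (relLen A B : ℕ∞) = relLength A B := by
  have : relLength A B ≠ ⊤ := by
    obtain ⟨k, hk⟩ := h
    refine Module.length_ne_top_iff.2 (isFiniteLength_of_pow_smul_eq_zero (k := k) fun a ha x => ?_)
    obtain ⟨x, rfl⟩ := Submodule.Quotient.mk_surjective _ x
    rw [← Submodule.Quotient.mk_smul, Submodule.Quotient.mk_eq_zero]
    exact hk (Submodule.smul_mem_smul ha trivial)
  exact ENat.natCast_toNat this

lemma IsPrim.colen_eq_add {A B : Submodule S M} (hA : IsPrim A) (h : A ≤ B) :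
    colen A = relLen A B + colen B := by
  have := length_quotient_eq_add h
  rw [← hA.coe_colen, ← (hA.mono h).coe_colen, ← hA.coe_relLen] at this
  exact_mod_cast this

lemma IsPrim.colen_eq_colon {A : Submodule S M} (hA : IsPrim A) (x : S) :
    colen A = colen (A.comap (LinearMap.lsmul S M x)) + colen (A ⊔ Ideal.span {x} • ⊤) := by
  have := length_quotient_eq_colon A x
  rw [← hA.coe_colen, ← (hA.mono le_sup_left).coe_colen, ← IsPrim.coe_colen
    (hA.mono fun u hu => A.smul_mem x hu)] at this
  exact_mod_cast this

end Colength

section DimLT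
variable {S : Type} [CommRing S]

/-- The quotient by `J` has Krull dimension less than `s`. -/
def DimLT (s : ℕ) (J : Ideal S) : Prop :=
  ∀ p : LTSeries (PrimeSpectrum S), J ≤ p.head.asIdeal → p.length < s

lemma DimLT.mono {s t : ℕ} {I J : Ideal S} (h : DimLT s I) (hIJ : I ≤ J) (hst : s ≤ t) :
    DimLT t J := fun p hp => (h p (hIJ.trans hp)).trans_le hst

lemma DimLT.mul {s : ℕ} {I J : Ideal S} (hI : DimLT s I) (hJ : DimLT s J) : DimLT s (I * J) :=
  fun p hp => (p.head.isPrime.mul_le.1 hp).elim (hI p) (hJ p)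

lemma dimLT_top (s : ℕ) : DimLT s (⊤ : Ideal S) :=
  fun p hp => (p.head.isPrime.ne_top (top_le_iff.1 hp)).elim

lemma dimLT_zero_iff {J : Ideal S} : DimLT 0 J ↔ J = ⊤ := by
  refine ⟨fun h => ?_, fun h => h ▸ dimLT_top 0⟩
  by_contra hJ
  obtain ⟨P, hP, hJP⟩ := Ideal.exists_le_maximal J hJ
  exact absurd (h (RelSeries.singleton _ ⟨P, hP.isPrime⟩) hJP) (by simp)

lemma dimLT_of_forall_prime {s : ℕ} {J : Ideal S}
    (h : ∀ P : Ideal S, P.IsPrime → J ≤ P → DimLT s P) : DimLT s J :=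
  fun p hp => h _ p.head.isPrime hp p le_rfl

lemma DimLT.of_forall_minimalPrimes {s : ℕ} {J : Ideal S}
    (h : ∀ P ∈ J.minimalPrimes, DimLT s P) : DimLT s J :=
  dimLT_of_forall_prime fun P _ hJP => by
    obtain ⟨Q, hQ, hQP⟩ := Ideal.exists_minimalPrimes_le hJP
    exact (h Q hQ).mono hQP le_rfl

lemma DimLT.lt_of_prime {s : ℕ} {P Q : Ideal S} [P.IsPrime] [hQ : Q.IsPrime] (h : DimLT (s + 1) P)
    (hPQ : P < Q) : DimLT s Q := by
  intro p hp
  have hlt : (⟨P, ‹_›⟩ : PrimeSpectrum S) < p.head := lt_of_lt_of_le (b := (⟨Q, hQ⟩ : PrimeSpectrum S)) hPQ hp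
  have := h (p.cons ⟨P, ‹_›⟩ hlt) (by simp)
  simp at this
  omega

end DimLT

section Local
variable {S : Type} [CommRing S] [IsLocalRing S]

lemma dimLT_one_iff [IsNoetherianRing S] {J : Ideal S} :
    DimLT 1 J ↔ ∃ k, maximalIdeal S ^ k ≤ J := by
  constructor
  · intro h
    have : maximalIdeal S ≤ J.radical := by
      rw [Ideal.radical_eq_sInf]
      refine le_sInf fun P hP => ?_
      have := hP.2
      by_contra hlt
      have hPm : P < maximalIdeal S := lt_of_le_not_ge (IsLocalRing.le_maximalIdeal this.ne_top) hlt
      have := (h.mono hP.1 le_rfl).lt_of_prime hPm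
      exact (maximalIdeal.isMaximal S).ne_top (dimLT_zero_iff.1 this)
    obtain ⟨k, hk⟩ := Ideal.exists_pow_le_of_le_radical_of_fg this (IsNoetherian.noetherian _)
    exact ⟨k, hk⟩
  · rintro ⟨k, hk⟩ p hp
    have h1 : maximalIdeal S ≤ p.head.asIdeal := by
      rcases Nat.eq_zero_or_pos k with rfl | hk0
      · exact ((p.head.isPrime.ne_top) (top_le_iff.1 (by simpa using hk.trans hp))).elim
      · exact (p.head.isPrime.pow_le_iff hk0.ne').1 (hk.trans hp)
    by_contra hlen
    have : p.head < p.last := p.strictMono (Fin.lt_def.2 (by simp; omega))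
    have : p.head.asIdeal < p.last.asIdeal := this
    exact absurd (h1.trans_lt this) (IsLocalRing.le_maximalIdeal p.last.isPrime.ne_top).not_gt

end Local

section Satd
variable {S : Type} [CommRing S] {M : Type} [AddCommGroup M] [Module S M]

/-- Elements multiplied into `L` by an ideal of coheight less than `s`. -/
def satd (s : ℕ) (L : Submodule S M) : Submodule S M where
  carrier := {u | ∃ J : Ideal S, DimLT s J ∧ ∀ a ∈ J, a • u ∈ L}
  zero_mem' := ⟨⊤, dimLT_top s, by simp⟩
  add_mem' := by
    rintro x y ⟨I, hI, hI'⟩ ⟨J, hJ, hJ'⟩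
    refine ⟨I * J, hI.mul hJ, fun a ha => ?_⟩
    rw [smul_add]
    exact L.add_mem (hI' a (Ideal.mul_le_left ha)) (hJ' a (Ideal.mul_le_right ha))
  smul_mem' := by
    rintro c x ⟨I, hI, hI'⟩
    exact ⟨I, hI, fun a ha => by rw [smul_comm]; exact L.smul_mem _ (hI' a ha)⟩

variable {s t : ℕ} {K L : Submodule S M}

lemma mem_satd {u : M} : u ∈ satd s L ↔ ∃ J : Ideal S, DimLT s J ∧ ∀ a ∈ J, a • u ∈ L := Iff.rfl

lemma le_satd : L ≤ satd s L := fun _ hu => ⟨⊤, dimLT_top s, fun a _ => L.smul_mem a hu⟩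

lemma satd_mono (hst : s ≤ t) (h : K ≤ L) : satd s K ≤ satd t L := by
  rintro u ⟨J, hJ, hJ'⟩
  exact ⟨J, hJ.mono le_rfl hst, fun a ha => h (hJ' a ha)⟩

variable [IsNoetherianRing S]

omit [IsNoetherianRing S] in
lemma exists_dimLT_smul_le {N : Submodule S M} (hN : N.FG) (h : N ≤ satd s L) :
    ∃ J : Ideal S, DimLT s J ∧ J • N ≤ L := by
  induction N, hN using Submodule.fg_induction with
  | singleton x =>
    obtain ⟨J, hJ, hJ'⟩ := h (Submodule.mem_span_singleton_self x)
    refine ⟨J, hJ, Submodule.smul_le.2 fun a ha y hy => ?_⟩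
    obtain ⟨c, rfl⟩ := Submodule.mem_span_singleton.1 hy
    rw [smul_comm]
    exact L.smul_mem _ (hJ' a ha)
  | sup N N' _ _ h1 h2 =>
    obtain ⟨I, hI, hI'⟩ := h1 (le_sup_left.trans h)
    obtain ⟨J, hJ, hJ'⟩ := h2 (le_sup_right.trans h)
    refine ⟨I * J, hI.mul hJ, ?_⟩
    rw [Submodule.smul_sup, sup_le_iff]
    exact ⟨(Submodule.smul_mono_left Ideal.mul_le_left).trans hI',
      (Submodule.smul_mono_left Ideal.mul_le_right).trans hJ'⟩

lemma satd_satd : satd s (satd s L) = satd s L := by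
  refine le_antisymm ?_ le_satd
  rintro u ⟨J, hJ, hJ'⟩
  obtain ⟨I, hI, hI'⟩ := exists_dimLT_smul_le (s := s) (L := L) (N := J • Submodule.span S {u})
    (Submodule.FG.smul (IsNoetherian.noetherian J) (Submodule.fg_span_singleton u))
    (Submodule.smul_le.2 fun a ha y hy => by
      obtain ⟨c, rfl⟩ := Submodule.mem_span_singleton.1 hy
      rw [smul_comm]
      exact Submodule.smul_mem _ _ (hJ' a ha))
  refine ⟨I * J, hI.mul hJ, fun a ha => hI' ?_⟩
  rw [← Submodule.mul_smul]
  exact Submodule.smul_mem_smul ha (Submodule.mem_span_singleton_self u)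

lemma satd_le_of_le (h : K ≤ satd s L) : satd s K ≤ satd s L :=
  (satd_mono le_rfl h).trans satd_satd.le

lemma mem_satd_one [IsLocalRing S] {u : M} :
    u ∈ satd 1 L ↔ ∃ k, ∀ a ∈ maximalIdeal S ^ k, a • u ∈ L := by
  constructor
  · rintro ⟨J, hJ, hJ'⟩
    obtain ⟨k, hk⟩ := dimLT_one_iff.1 hJ
    exact ⟨k, fun a ha => hJ' a (hk ha)⟩
  · rintro ⟨k, hk⟩
    exact ⟨_, dimLT_one_iff.2 ⟨k, le_rfl⟩, hk⟩

lemma mem_satd_one_of_smul [IsLocalRing S] {u : M} {k : ℕ}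
    (h : ∀ a ∈ maximalIdeal S ^ k, a • u ∈ satd 1 L) : u ∈ satd 1 L := by
  rw [← satd_satd]
  exact mem_satd_one.2 ⟨k, h⟩

end Satd

section StrongSeq
variable {S : Type} [CommRing S] [IsLocalRing S] {M : Type} [AddCommGroup M] [Module S M]

/-- The submodule `K + x M`. -/
def extBy (K : Submodule S M) (x : S) : Submodule S M := K ⊔ Ideal.span {x} • ⊤

omit [IsLocalRing S] in
lemma mem_extBy {K : Submodule S M} {x : S} {u : M} :
    u ∈ extBy K x ↔ ∃ k ∈ K, ∃ w, u = k + x • w := by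
  simp only [extBy, Submodule.mem_sup, Submodule.ideal_span_singleton_smul,
    Submodule.mem_smul_pointwise_iff_exists, Submodule.mem_top, true_and]
  constructor
  · rintro ⟨k, hk, _, ⟨w, rfl⟩, rfl⟩
    exact ⟨k, hk, w, rfl⟩
  · rintro ⟨k, hk, w, rfl⟩
    exact ⟨k, hk, _, ⟨w, rfl⟩, rfl⟩

omit [IsLocalRing S] in
lemma le_extBy {K : Submodule S M} {x : S} : K ≤ extBy K x := le_sup_left

omit [IsLocalRing S] in
lemma smul_mem_extBy {K : Submodule S M} {x : S} (w : M) : x • w ∈ extBy K x :=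
  mem_extBy.2 ⟨0, K.zero_mem, w, by simp⟩

omit [IsLocalRing S] in
lemma extBy_mono {K L : Submodule S M} (h : K ≤ L) (x : S) : extBy K x ≤ extBy L x :=
  sup_le_sup_right h _

omit [IsLocalRing S] in
lemma sup_smul_mono (K : Submodule S M) {I J : Ideal S} (h : I ≤ J) :
    K ⊔ I • (⊤ : Submodule S M) ≤ K ⊔ J • ⊤ :=
  sup_le_sup_left (α := Submodule S M) (Submodule.smul_mono_left h) K

/-- A sequence such that all its members at each stage annihilate exactly the torsion. -/
def IsStrong : List S → Submodule S M → Prop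
  | [], K => IsPrim K
  | x :: l, K => (∀ y ∈ x :: l, ∀ u, (y • u ∈ K ↔ u ∈ satd 1 K)) ∧ IsStrong l (extBy K x)

lemma IsStrong.isPrim_sup {l : List S} {K : Submodule S M} (h : IsStrong l K) :
    IsPrim (K ⊔ Ideal.ofList l • ⊤) := by
  induction l generalizing K with
  | nil => simpa [IsStrong] using h
  | cons x l ih =>
    rw [Ideal.ofList_cons, Submodule.sup_smul, ← sup_assoc]
    exact ih h.2

omit [IsLocalRing S] in
lemma pow_smul_le_sup {𝔪 Q : Ideal S} {K : Submodule S M} {k : ℕ}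
    (h : 𝔪 ^ k • (⊤ : Submodule S M) ≤ K ⊔ Q • ⊤) (n : ℕ) :
    𝔪 ^ (k * n) • (⊤ : Submodule S M) ≤ K ⊔ Q ^ n • ⊤ := by
  induction n with
  | zero => simp
  | succ n ih =>
    calc 𝔪 ^ (k * (n + 1)) • (⊤ : Submodule S M) = 𝔪 ^ (k * n) • 𝔪 ^ k • ⊤ := by
          rw [← Submodule.mul_smul, ← pow_add, mul_add, mul_one]
      _ ≤ 𝔪 ^ (k * n) • (K ⊔ Q • ⊤) := smul_mono_right _ h
      _ ≤ K ⊔ Q • 𝔪 ^ (k * n) • ⊤ := by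
          rw [Submodule.smul_sup, ← Submodule.mul_smul, ← Submodule.mul_smul, mul_comm Q]
          exact sup_le_sup_right (Submodule.smul_le.2 fun a _ u hu => K.smul_mem a hu) _
      _ ≤ K ⊔ Q • (K ⊔ Q ^ n • ⊤) := sup_le_sup_left (smul_mono_right _ ih) _
      _ ≤ K ⊔ Q ^ (n + 1) • ⊤ := by
          rw [Submodule.smul_sup, ← Submodule.mul_smul, ← pow_succ']
          exact sup_le le_sup_left (sup_le ((Submodule.smul_le.2 fun a _ u hu => K.smul_mem a hu).trans le_sup_left) le_sup_right)

lemma IsPrim.sup_pow {Q : Ideal S} {K : Submodule S M} (h : IsPrim (K ⊔ Q • ⊤)) (n : ℕ) :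
    IsPrim (K ⊔ Q ^ n • ⊤) := by
  obtain ⟨k, hk⟩ := h
  exact ⟨_, pow_smul_le_sup hk n⟩

variable [IsNoetherianRing S]

lemma mem_satd_one_of_smul_mem {x : S} {K : Submodule S M} {k w : M} (hk : k ∈ K)
    (hx : ∀ u, x • u ∈ K → u ∈ satd 1 K) (h : k + x • w ∈ satd 1 K) : w ∈ satd 1 K := by
  have h1 : x • w ∈ satd 1 K := by
    simpa using Submodule.sub_mem _ h (le_satd hk)
  obtain ⟨m, hm⟩ := mem_satd_one.1 h1
  refine mem_satd_one_of_smul (k := m) fun a ha => hx _ ?_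
  rw [smul_comm]
  exact hm a ha

lemma IsStrong.satd_inf_le {l : List S} {K : Submodule S M} (h : IsStrong l K) :
    satd 1 K ⊓ (K ⊔ Ideal.ofList l • ⊤) ≤ K := by
  induction l generalizing K with
  | nil => simp
  | cons x l ih =>
    rintro u ⟨hu1, hu2⟩
    rw [Ideal.ofList_cons, Submodule.sup_smul, ← sup_assoc] at hu2
    obtain ⟨k, hk, w, rfl⟩ := mem_extBy.1 (ih h.2 ⟨satd_mono le_rfl le_extBy hu1, hu2⟩)
    have hw := mem_satd_one_of_smul_mem hk (fun u => ((h.1 x (by simp)) u).1) hu1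
    exact K.add_mem hk (((h.1 x (by simp)) w).2 hw)

/-- Valabrega-Valla type intersections for strong sequences. -/
lemma IsStrong.inf_le_mul {l : List S} {K : Submodule S M} {q : Ideal S}
    (h : IsStrong l (K ⊔ q • ⊤)) (n : ℕ) :
    (K ⊔ q • ⊤) ⊓ (K ⊔ (q ⊔ Ideal.ofList l) ^ (n + 1) • ⊤) ≤
      K ⊔ (q * (q ⊔ Ideal.ofList l) ^ n) • ⊤ := by
  induction l generalizing q n with
  | nil => simp [← pow_succ']
  | cons x l ih =>
    have hs : q ⊔ Ideal.ofList (x :: l) = (q ⊔ Ideal.span {x}) ⊔ Ideal.ofList l := by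
      rw [Ideal.ofList_cons, sup_assoc]
    have hs2 : extBy (K ⊔ q • ⊤) x = K ⊔ (q ⊔ Ideal.span {x}) • ⊤ := by
      rw [extBy, Submodule.sup_smul, sup_assoc]
    have hl := h.2
    rw [hs2] at hl
    have ih' := fun n => ih hl n
    have hsat := h.satd_inf_le
    rw [sup_assoc, ← Submodule.sup_smul, hs] at hsat
    rw [hs]
    set Q := q ⊔ Ideal.span {x} ⊔ Ideal.ofList l with hQ
    induction n with
    | zero => simp
    | succ n ihn =>
      rintro u ⟨hu1, hu2⟩
      have hu3 := ih' (n + 1) ⟨sup_smul_mono K le_sup_left hu1, hu2⟩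
      rw [Ideal.sup_mul, Submodule.sup_smul, ← sup_assoc, Submodule.mem_sup] at hu3
      obtain ⟨v, hv, z, hz, rfl⟩ := hu3
      rw [Submodule.mul_smul, Submodule.ideal_span_singleton_smul,
        Submodule.mem_smul_pointwise_iff_exists] at hz
      obtain ⟨w, hw, rfl⟩ := hz
      refine Submodule.add_mem _ hv ?_
      have hv1 : v ∈ K ⊔ q • ⊤ :=
        sup_smul_mono K Ideal.mul_le_left hv
      have hxw : x • w ∈ K ⊔ q • ⊤ := by simpa using Submodule.sub_mem _ hu1 hv1
      have hw1 : w ∈ K ⊔ Q ^ (n + 1) • ⊤ := Submodule.mem_sup_right hw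
      have hw2 : w ∈ K ⊔ q • ⊤ := hsat ⟨((h.1 x (by simp)) w).1 hxw,
        sup_smul_mono K (Ideal.pow_le_self (by simp)) hw1⟩
      have hw3 := ihn ⟨hw2, hw1⟩
      obtain ⟨k, hk, y, hy, rfl⟩ := Submodule.mem_sup.1 hw3
      rw [smul_add]
      refine Submodule.add_mem _ (Submodule.mem_sup_left (K.smul_mem _ hk))
        (Submodule.mem_sup_right ?_)
      have hxQ : x ∈ Q := by
        rw [hQ]
        exact (le_sup_right.trans le_sup_left : Ideal.span {x} ≤ _)
          (Ideal.mem_span_singleton_self x)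
      have := Submodule.smul_mem_smul hxQ hy
      rwa [← Submodule.mul_smul, mul_left_comm, ← pow_succ'] at this

lemma IsStrong.colon_eq {l : List S} {K : Submodule S M} {x : S} (h : IsStrong (x :: l) K)
    (n : ℕ) :
    (K ⊔ Ideal.ofList (x :: l) ^ (n + 1) • ⊤).comap (LinearMap.lsmul S M x) =
      satd 1 K ⊔ Ideal.ofList (x :: l) ^ n • ⊤ := by
  have hx : x ∈ Ideal.ofList (x :: l) := by
    rw [Ideal.ofList_cons]
    exact Submodule.mem_sup_left (Ideal.mem_span_singleton_self x)
  refine le_antisymm (fun u hu => ?_) (sup_le (fun u hu => ?_) (fun u hu => ?_))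
  · have hW := h.2.inf_le_mul (q := Ideal.span {x}) n
    rw [← Ideal.ofList_cons] at hW
    have := hW ⟨smul_mem_extBy u, hu⟩
    obtain ⟨k, hk, z, hz, hkz⟩ := Submodule.mem_sup.1 this
    rw [Submodule.mul_smul, Submodule.ideal_span_singleton_smul,
        Submodule.mem_smul_pointwise_iff_exists] at hz
    obtain ⟨w, hw, rfl⟩ := hz
    rw [← sub_add_cancel u w]
    refine Submodule.add_mem_sup (((h.1 x (by simp)) _).1 ?_) hw
    rw [smul_sub]
    have : x • u - x • w = k := by rw [sub_eq_iff_eq_add]; exact hkz.symm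
    rwa [this]
  · exact Submodule.mem_sup_left (((h.1 x (by simp)) u).2 hu)
  · refine Submodule.mem_sup_right ?_
    rw [pow_succ', Submodule.mul_smul]
    exact Submodule.smul_mem_smul hx hu

end StrongSeq

section Hilbert
variable {S : Type} [CommRing S] [IsLocalRing S] {M : Type} [AddCommGroup M] [Module S M]

/-- The Hilbert-Samuel function of the ideal generated by `l` on `M ⧸ K`. -/
noncomputable def hilb (l : List S) (K : Submodule S M) (n : ℕ) : ℕ :=
  colen (K ⊔ Ideal.ofList l ^ (n + 1) • ⊤)

/-- The length of the torsion of `M ⧸ K`. -/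
noncomputable def torLen (K : Submodule S M) : ℕ := relLen K (satd 1 K)

omit [IsLocalRing S] in
lemma sup_pow_le (I J : Ideal S) (n : ℕ) : (I ⊔ J) ^ n ≤ I ⊔ J ^ n := by
  induction n with
  | zero => simp
  | succ n ih =>
    rw [pow_succ]
    refine (Ideal.mul_mono_left ih).trans ?_
    rw [Ideal.sup_mul, Ideal.mul_sup (J ^ n), ← pow_succ]
    exact sup_le (Ideal.mul_le_left.trans le_sup_left)
      (sup_le (Ideal.mul_le_right.trans (le_sup_left)) le_sup_right)

omit [IsLocalRing S] in
lemma sup_pow_sup_span (K : Submodule S M) (x : S) (l : List S) (n : ℕ) :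
    (K ⊔ Ideal.ofList (x :: l) ^ n • ⊤) ⊔ Ideal.span {x} • ⊤ =
      extBy K x ⊔ Ideal.ofList l ^ n • ⊤ := by
  rw [extBy, sup_assoc, ← Submodule.sup_smul, sup_assoc, ← Submodule.sup_smul, Ideal.ofList_cons]
  congr 2
  refine le_antisymm (sup_le (sup_pow_le _ _ _) le_sup_left) (sup_le le_sup_right ?_)
  exact (Ideal.pow_right_mono le_sup_right n).trans le_sup_left

variable [IsNoetherianRing S] [Module.Finite S M]

omit [IsLocalRing S] [IsNoetherianRing S] [Module.Finite S M] in
lemma hilb_zero {l : List S} {K : Submodule S M} {x : S} :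
    hilb (x :: l) K 0 = hilb l (extBy K x) 0 := by
  simp only [hilb, zero_add, pow_one, extBy, Ideal.ofList_cons, Submodule.sup_smul, sup_assoc]

omit [Module.Finite S M] in
lemma IsStrong.relLength_eq {l : List S} {K : Submodule S M} (h : IsStrong l K) (n : ℕ) :
    relLength K (satd 1 K) = relLength (K ⊔ Ideal.ofList l ^ (n + 1) • ⊤)
      (satd 1 K ⊔ Ideal.ofList l ^ (n + 1) • ⊤) := by
  have h1 := relLength_sup (K ⊔ Ideal.ofList l ^ (n + 1) • ⊤) (satd 1 K)
  rw [sup_right_comm, sup_eq_right.2 (le_satd (L := K))] at h1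
  rw [h1]
  congr 1
  refine le_antisymm (le_inf le_sup_left le_satd) ?_
  rintro u ⟨hu1, hu2⟩
  exact h.satd_inf_le ⟨hu2, sup_smul_mono K (Ideal.pow_le_self (by simp)) hu1⟩

lemma IsStrong.coe_torLen {l : List S} {K : Submodule S M} (h : IsStrong l K) :
    (torLen K : ℕ∞) = relLength K (satd 1 K) := by
  have := h.relLength_eq 0
  rw [← (h.isPrim_sup.sup_pow 1).coe_relLen] at this
  rw [torLen, relLen, this, ENat.toNat_natCast]

lemma IsStrong.hilb_succ {l : List S} {K : Submodule S M} {x : S} (h : IsStrong (x :: l) K)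
    (n : ℕ) :
    hilb (x :: l) K (n + 1) + torLen K = hilb (x :: l) K n + hilb l (extBy K x) (n + 1) := by
  have h1 := (h.isPrim_sup.sup_pow (n + 1 + 1)).colen_eq_colon x
  rw [h.colon_eq, sup_pow_sup_span] at h1
  have h2 := (h.isPrim_sup.sup_pow (n + 1)).colen_eq_add
    (sup_le_sup_right (le_satd (s := 1)) _)
  have h3 : torLen K = relLen (K ⊔ Ideal.ofList (x :: l) ^ (n + 1) • ⊤)
      (satd 1 K ⊔ Ideal.ofList (x :: l) ^ (n + 1) • ⊤) :=
    congrArg ENat.toNat (h.relLength_eq n)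
  simp only [hilb]
  omega

/-- The Hilbert coefficients of a strong sequence. -/
noncomputable def hilbCoeff : List S → Submodule S M → ℕ → ℤ
  | [], K => fun i => if i = 0 then (colen K : ℤ) else 0
  | x :: l, K => fun i => hilbCoeff l (extBy K x) i +
      if i = l.length ∨ i = l.length + 1 then (-1) ^ (l.length + 1) * (torLen K : ℤ) else 0

omit [IsLocalRing S] [IsNoetherianRing S] [Module.Finite S M] in
lemma hilbCoeff_cons (x : S) (l : List S) (K : Submodule S M) (i : ℕ) :
    hilbCoeff (x :: l) K i = hilbCoeff l (extBy K x) i +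
      if i = l.length ∨ i = l.length + 1 then (-1) ^ (l.length + 1) * (torLen K : ℤ) else 0 := rfl

omit [IsLocalRing S] [IsNoetherianRing S] [Module.Finite S M] in
lemma hilbCoeff_eq_zero {l : List S} {K : Submodule S M} {i : ℕ} (hi : l.length < i) :
    hilbCoeff l K i = 0 := by
  induction l generalizing K with
  | nil => simp at hi; simp [hilbCoeff]; omega
  | cons x l ih =>
    simp only [List.length_cons] at hi
    rw [hilbCoeff_cons, ih (by omega), if_neg (by omega), add_zero]

omit [IsLocalRing S] [IsNoetherianRing S] [Module.Finite S M] in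
lemma sum_hilbCoeff_cons {l : List S} {K : Submodule S M} {x : S} (n : ℕ) :
    ∑ i ∈ Finset.range (l.length + 1 + 1), (-1 : ℤ) ^ i * hilbCoeff (x :: l) K i *
      ((n + (l.length + 1) - i).choose (l.length + 1 - i) : ℤ) =
    ∑ i ∈ Finset.range (l.length + 1), (-1 : ℤ) ^ i * hilbCoeff l (extBy K x) i *
      ((n + (l.length + 1) - i).choose (l.length + 1 - i) : ℤ) - n * torLen K := by
  rw [Finset.sum_range_succ, Finset.sum_range_succ, Finset.sum_range_succ]
  have h1 : ∀ i ∈ Finset.range l.length, hilbCoeff (x :: l) K i = hilbCoeff l (extBy K x) i := by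
    intro i hi
    rw [Finset.mem_range] at hi
    rw [hilbCoeff_cons, if_neg (by omega), add_zero]
  rw [Finset.sum_congr rfl fun i hi => by rw [h1 i hi]]
  have h2 : n + (l.length + 1) - l.length = n + 1 := by omega
  have h3 : l.length + 1 - l.length = 1 := by omega
  have h4 : hilbCoeff l (extBy K x) (l.length + 1) = 0 := hilbCoeff_eq_zero (by omega)
  have h5 : ((-1 : ℤ) ^ l.length) * (-1) ^ l.length = 1 := by rw [← mul_pow]; simp
  simp only [h2, h3, hilbCoeff_cons, h4, true_or, or_true, if_true, Nat.choose_one_right, Nat.sub_self,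
    Nat.choose_zero_right, pow_succ]
  push_cast
  linear_combination (-(torLen K : ℤ) * (n + 1) + torLen K) * h5

theorem IsStrong.hilb_eq {l : List S} {K : Submodule S M} (h : IsStrong l K) (n : ℕ) :
    (hilb l K n : ℤ) = ∑ i ∈ Finset.range (l.length + 1), (-1 : ℤ) ^ i * hilbCoeff l K i *
      ((n + l.length - i).choose (l.length - i) : ℤ) := by
  induction l generalizing K n with
  | nil => simp [hilb, hilbCoeff, Ideal.ofList]
  | cons x l ih =>
    rw [List.length_cons, sum_hilbCoeff_cons]
    induction n with
    | zero =>
      rw [hilb_zero, ih h.2]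
      simp
    | succ n ihn =>
      have h1 : (hilb (x :: l) K (n + 1) : ℤ) + torLen K =
        hilb (x :: l) K n + hilb l (extBy K x) (n + 1) := by exact_mod_cast h.hilb_succ n
      rw [ihn, ih h.2] at h1
      rw [eq_sub_iff_add_eq.2 h1]
      have key : ∑ i ∈ Finset.range (l.length + 1), (-1 : ℤ) ^ i * hilbCoeff l (extBy K x) i *
            ((n + 1 + (l.length + 1) - i).choose (l.length + 1 - i) : ℤ) =
          ∑ i ∈ Finset.range (l.length + 1), (-1 : ℤ) ^ i * hilbCoeff l (extBy K x) i *
            ((n + (l.length + 1) - i).choose (l.length + 1 - i) : ℤ) +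
          ∑ i ∈ Finset.range (l.length + 1), (-1 : ℤ) ^ i * hilbCoeff l (extBy K x) i *
            ((n + 1 + l.length - i).choose (l.length - i) : ℤ) := by
        rw [← Finset.sum_add_distrib]
        refine Finset.sum_congr rfl fun i hi => ?_
        rw [Finset.mem_range] at hi
        have e1 : n + 1 + (l.length + 1) - i = (n + 1 + l.length - i) + 1 := by omega
        have e2 : l.length + 1 - i = (l.length - i) + 1 := by omega
        have e3 : n + (l.length + 1) - i = n + 1 + l.length - i := by omega
        rw [e1, e2, e3, Nat.choose_succ_succ]
        push_cast
        ring
      rw [key]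
      push_cast
      ring

/-- The negative of the first Hilbert coefficient of a strong sequence of length at least two. -/
noncomputable def chernNum : List S → Submodule S M → ℤ
  | [x, _], K => torLen (extBy K x) - torLen K
  | x :: y :: z :: l, K => chernNum (y :: z :: l) (extBy K x)
  | _, _ => 0

omit [IsLocalRing S] [IsNoetherianRing S] [Module.Finite S M] in
theorem hilbCoeff_one {l : List S} {K : Submodule S M} (hl : 2 ≤ l.length) :
    hilbCoeff l K 1 = - chernNum l K := by
  induction l generalizing K with
  | nil => simp at hl
  | cons x l ih =>
    rcases l with _ | ⟨y, _ | ⟨z, l⟩⟩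
    · simp at hl
    · simp only [hilbCoeff, chernNum]
      simp
      ring
    · rw [hilbCoeff_cons, ih (by simp), if_neg (by simp), chernNum, add_zero]

omit [IsLocalRing S] [IsNoetherianRing S] [Module.Finite S M] in
lemma relLength_mono_right (A : Submodule S M) {B B' : Submodule S M} (h : B ≤ B') :
    relLength A B ≤ relLength A B' := by
  have hle : A.comap B.subtype = (A.comap B'.subtype).comap (Submodule.inclusion h) := rfl
  refine Module.length_le_of_injective (Submodule.mapQ _ _ (Submodule.inclusion h) hle.le) ?_
  rw [← LinearMap.ker_eq_bot, Submodule.ker_mapQ, ← hle]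
  exact Submodule.mkQ_map_self _

lemma IsStrong.torLen_le {x y : S} {l : List S} {K : Submodule S M}
    (h : IsStrong (x :: y :: l) K) : torLen K ≤ torLen (extBy K x) := by
  have h1 := h.coe_torLen
  have h2 := h.2.coe_torLen
  have h3 : relLength K (satd 1 K) = relLength (extBy K x) (extBy K x ⊔ satd 1 K) := by
    rw [relLength_sup]
    congr 1
    refine le_antisymm (le_inf le_extBy le_satd) ?_
    rintro u ⟨hu1, hu2⟩
    refine h.satd_inf_le ⟨hu2, sup_smul_mono K ?_ hu1⟩
    rw [Ideal.ofList_cons]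
    exact le_sup_left
  have h4 : relLength K (satd 1 K) ≤ relLength (extBy K x) (satd 1 (extBy K x)) :=
    h3.le.trans (relLength_mono_right _ (sup_le le_satd (satd_mono le_rfl le_extBy)))
  rw [← h1, ← h2] at h4
  exact_mod_cast h4

end Hilbert

section Krull
variable {S : Type} [CommRing S]

lemma dimLT_iff_ringKrullDim_lt {s : ℕ} {J : Ideal S} :
    DimLT s J ↔ ringKrullDim (S ⧸ J) < s := by
  rw [ringKrullDim_quotient, Order.krullDim_lt_coe_iff]
  constructor
  · intro h l
    refine h (l.map Subtype.val (fun _ _ h => h)) ?_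
    have := l.head.2
    rwa [PrimeSpectrum.mem_zeroLocus] at this
  · intro h p hp
    have hmem : ∀ i, p i ∈ PrimeSpectrum.zeroLocus (J : Set S) := fun i => by
      rw [PrimeSpectrum.mem_zeroLocus]
      exact hp.trans (show p.head ≤ p i from p.monotone (Fin.zero_le i))
    exact h ⟨p.length, fun i => ⟨p i, hmem i⟩, fun i => p.step i⟩

variable [IsLocalRing S] [IsNoetherianRing S]

lemma DimLT.sup_span {s : ℕ} {J : Ideal S} {x : S} (h : DimLT (s + 1) J) (hs : s ≠ 0)
    (hx : ∀ Q ∈ J.minimalPrimes, Q ≠ maximalIdeal S → x ∉ Q) :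
    DimLT s (J ⊔ Ideal.span {x}) := by
  refine dimLT_of_forall_prime fun P hP hJP => ?_
  obtain ⟨Q, hQ, hQP⟩ := Ideal.exists_minimalPrimes_le (le_sup_left.trans hJP)
  have hxP : x ∈ P := hJP (Ideal.mem_sup_right (Ideal.mem_span_singleton_self x))
  have := hQ.1.1
  by_cases hQm : Q = maximalIdeal S
  · have h1 : DimLT 1 P := dimLT_one_iff.2 ⟨1, by simpa [hQm] using hQP⟩
    exact h1.mono le_rfl (by omega)
  · exact (h.mono hQ.1.2 le_rfl).lt_of_prime (lt_of_le_of_ne hQP fun e => hx Q hQ hQm (e ▸ hxP))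

open scoped Pointwise in
lemma DimLT.of_sup_span {s : ℕ} {J : Ideal S} {x : S} (h : DimLT s (J ⊔ Ideal.span {x}))
    (hx : x ∈ maximalIdeal S) : DimLT (s + 1) J := by
  by_cases hJ : J = ⊤
  · exact hJ ▸ dimLT_top _
  have : Nontrivial (S ⧸ J) := Ideal.Quotient.nontrivial_iff.2 hJ
  have : IsLocalRing (S ⧸ J) := IsLocalRing.of_surjective' (Ideal.Quotient.mk J) Ideal.Quotient.mk_surjective
  rw [dimLT_iff_ringKrullDim_lt] at h ⊢
  have hxm : Ideal.Quotient.mk J x ∈ maximalIdeal (S ⧸ J) := by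
    have := Ideal.comap_isMaximal_of_surjective (Ideal.Quotient.mk J) Ideal.Quotient.mk_surjective
      (K := maximalIdeal (S ⧸ J))
    rw [← Ideal.mem_comap, IsLocalRing.eq_maximalIdeal this]
    exact hx
  have h1 := ringKrullDim_le_ringKrullDim_quotSMulTop_succ hxm
  have e : ((S ⧸ J) ⧸ (Ideal.Quotient.mk J x • (⊤ : Ideal (S ⧸ J)))) ≃+* S ⧸ (J ⊔ Ideal.span {x}) :=
    (Ideal.quotEquivOfEq (by
      rw [Ideal.map_span, Set.image_singleton, ← Submodule.ideal_span_singleton_smul, smul_eq_mul, Ideal.mul_top])).trans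
      (DoubleQuot.quotQuotEquivQuotSup J (Ideal.span {x}))
  rw [ringKrullDim_eq_of_ringEquiv e] at h1
  refine h1.trans_lt ?_
  push_cast
  by_cases hb : ringKrullDim (S ⧸ (J ⊔ Ideal.span {x})) = ⊥
  · rw [hb]; simp
  · obtain ⟨d, hd⟩ := WithBot.ne_bot_iff_exists.1 hb
    rw [← hd] at h ⊢
    have h' : d < (s : ℕ∞) := by exact_mod_cast h
    have : d + 1 < (s : ℕ∞) + 1 := by
      exact (ENat.add_lt_add_iff_right (by simp)).2 h'
    exact_mod_cast this

end Krull

section Gen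
variable (R S : Type) [CommRing R] [CommRing S] [IsLocalRing S] [Algebra R S]

/-- The filter of general elements of `S` coming from `R`: those lying in a given power of the
maximal ideal and avoiding given finitely many nonmaximal primes. -/
def genFilter : Filter S where
  sets := {P | ∃ F : Set (Ideal S), F.Finite ∧ (∀ p ∈ F, p.IsPrime ∧ p ≠ maximalIdeal S) ∧
    ∃ k : ℕ, ∀ a : R, algebraMap R S a ∈ maximalIdeal S ^ k →
      (∀ p ∈ F, algebraMap R S a ∉ p) → algebraMap R S a ∈ P}
  univ_sets := ⟨∅, Set.finite_empty, by simp, 0, by simp⟩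
  sets_of_superset := by
    rintro P Q ⟨F, hF, hp, k, h⟩ hPQ
    exact ⟨F, hF, hp, k, fun a h1 h2 => hPQ (h a h1 h2)⟩
  inter_sets := by
    rintro P Q ⟨F, hF, hp, k, h⟩ ⟨F', hF', hp', k', h'⟩
    refine ⟨F ∪ F', hF.union hF', fun p h => h.elim (hp p) (hp' p), max k k', fun a h1 h2 => ⟨?_, ?_⟩⟩
    · exact h a (Ideal.pow_le_pow_right (le_max_left _ _) h1) fun p hp => h2 p (Or.inl hp)
    · exact h' a (Ideal.pow_le_pow_right (le_max_right _ _) h1) fun p hp => h2 p (Or.inr hp)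

variable {R S}

lemma eventually_genFilter {P : S → Prop} : (∀ᶠ x in genFilter R S, P x) ↔
    ∃ F : Set (Ideal S), F.Finite ∧ (∀ p ∈ F, p.IsPrime ∧ p ≠ maximalIdeal S) ∧
    ∃ k : ℕ, ∀ a : R, algebraMap R S a ∈ maximalIdeal S ^ k →
      (∀ p ∈ F, algebraMap R S a ∉ p) → P (algebraMap R S a) := Iff.rfl

lemma genFilter_neBot [IsLocalRing R]
    (hm : maximalIdeal S = (maximalIdeal R).map (algebraMap R S)) : (genFilter R S).NeBot := by
  rw [Filter.neBot_iff, ne_eq, ← Filter.empty_mem_iff_bot]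
  rintro ⟨F, hF, hp, k, h⟩
  have hcov : ((maximalIdeal R ^ k : Ideal R) : Set R) ⊆
      ⋃ p ∈ F, (p.comap (algebraMap R S) : Set R) := by
    intro a ha
    by_contra hn
    refine h a ?_ fun p hpF hap => hn (Set.mem_biUnion hpF hap)
    rw [hm, ← Ideal.map_pow]
    exact Ideal.mem_map_of_mem _ ha
  obtain ⟨p, hpF, hle⟩ := (Ideal.subset_union_prime_finite hF (f := fun p => p.comap (algebraMap R S))
    ⊤ ⊤ fun p hpF _ _ => have := (hp p hpF).1; Ideal.comap_isPrime _ p).1 hcov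
  have := (hp p hpF).1
  have h1 : maximalIdeal R ≤ p.comap (algebraMap R S) := by
    rcases Nat.eq_zero_or_pos k with rfl | hk
    · simp only [pow_zero, Ideal.one_eq_top, top_le_iff] at hle
      rw [hle]
      exact le_top
    · exact ((Ideal.comap_isPrime (algebraMap R S) p).pow_le_iff hk.ne').1 hle
  rw [← Ideal.map_le_iff_le_comap, ← hm] at h1
  exact (hp p hpF).2 (((maximalIdeal.isMaximal S).eq_of_le this.ne_top h1).symm)

lemma gen_range : ∀ᶠ x in genFilter R S, ∃ a, algebraMap R S a = x :=
  eventually_genFilter.2 ⟨∅, Set.finite_empty, by simp, 0, fun a _ _ => ⟨a, rfl⟩⟩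

lemma gen_mem_pow (k : ℕ) : ∀ᶠ x in genFilter R S, x ∈ maximalIdeal S ^ k :=
  eventually_genFilter.2 ⟨∅, Set.finite_empty, by simp, k, fun _ h _ => h⟩

lemma gen_mem : ∀ᶠ x in genFilter R S, x ∈ maximalIdeal S := by simpa using gen_mem_pow (R := R) (S := S) 1

lemma gen_avoid {F : Set (Ideal S)} (hF : F.Finite) (hp : ∀ p ∈ F, p.IsPrime) :
    ∀ᶠ x in genFilter R S, ∀ p ∈ F, p ≠ maximalIdeal S → x ∉ p :=
  eventually_genFilter.2 ⟨{p ∈ F | p ≠ maximalIdeal S}, hF.subset (Set.sep_subset _ _),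
    fun p h => ⟨hp p h.1, h.2⟩, 0, fun _ _ h p hpF hpm => h p ⟨hpF, hpm⟩⟩

lemma gen_pow {P : S → Prop} (h : ∀ᶠ x in genFilter R S, P x) :
    ∀ᶠ x in genFilter R S, ∀ n ≠ 0, P (x ^ n) := by
  obtain ⟨F, hF, hp, k, h⟩ := eventually_genFilter.1 h
  refine eventually_genFilter.2 ⟨F, hF, hp, k, fun a h1 h2 n hn => ?_⟩
  rw [← map_pow]
  refine h _ ?_ fun p hpF hap => ?_
  · rw [map_pow]
    exact Ideal.pow_mem_of_mem _ h1 n (Nat.pos_of_ne_zero hn)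
  · rw [map_pow] at hap
    exact h2 p hpF ((hp p hpF).1.mem_of_pow_mem n hap)

end Gen

section Lists
variable {S : Type}

/-- A property holds for lists of length `d` whose entries are chosen successively general. -/
def EvList (𝓕 : Filter S) : ℕ → (List S → Prop) → Prop
  | 0, P => P []
  | d + 1, P => ∀ᶠ x in 𝓕, EvList 𝓕 d fun l => P (x :: l)

variable {𝓕 : Filter S} {d : ℕ} {P Q : List S → Prop}

lemma EvList.mono (h : EvList 𝓕 d P) (hPQ : ∀ l, P l → Q l) : EvList 𝓕 d Q := by
  induction d generalizing P Q with
  | zero => exact hPQ _ h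
  | succ d ih => exact Filter.Eventually.mono h fun x hx => ih hx fun l => hPQ _

lemma EvList.and (h : EvList 𝓕 d P) (hQ : EvList 𝓕 d Q) : EvList 𝓕 d fun l => P l ∧ Q l := by
  induction d generalizing P Q with
  | zero => exact ⟨h, hQ⟩
  | succ d ih => exact (Filter.Eventually.and h hQ).mono fun x hx => ih hx.1 hx.2

lemma EvList.of_forall (h : ∀ l, l.length = d → P l) : EvList 𝓕 d P := by
  induction d generalizing P with
  | zero => exact h _ rfl
  | succ d ih => exact Filter.Eventually.of_forall fun x => ih fun l hl => h _ (by simpa using hl)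

lemma EvList.of_forall_mem {p : S → Prop} (h : ∀ᶠ x in 𝓕, p x) :
    EvList 𝓕 d fun l => ∀ y ∈ l, p y := by
  induction d with
  | zero => simp [EvList]
  | succ d ih => exact h.mono fun x hx => ih.mono fun l hl => by simpa using ⟨hx, hl⟩

lemma EvList.exists [𝓕.NeBot] (h : EvList 𝓕 d P) : ∃ l, l.length = d ∧ P l := by
  induction d generalizing P with
  | zero => exact ⟨[], rfl, h⟩
  | succ d ih =>
    obtain ⟨x, hx⟩ := Filter.Eventually.exists h
    obtain ⟨l, hl, hP⟩ := ih hx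
    exact ⟨x :: l, by simpa using hl, hP⟩

end Lists

section GenModule
variable {R S : Type} [CommRing R] [CommRing S] [IsLocalRing S] [IsNoetherianRing S] [Algebra R S]
variable {M : Type} [AddCommGroup M] [Module S M] [Module.Finite S M]

lemma gen_regular {K : Submodule S M} (hK : satd 1 K ≤ K) :
    ∀ᶠ x in genFilter R S, ∀ u, x • u ∈ K → u ∈ K := by
  filter_upwards [gen_avoid (R := R) (associatedPrimes.finite S (M ⧸ K)) fun p hp => hp.isPrime] with x hx u hu
  by_contra huK
  have hne : K.mkQ u ≠ 0 := by simpa using huK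
  have hmem : x ∈ ⋃ p ∈ associatedPrimes S (M ⧸ K), (p : Set S) := by
    rw [biUnion_associatedPrimes_eq_zero_divisors]
    exact ⟨K.mkQ u, hne, by
      rw [← map_smul, Submodule.mkQ_apply, Submodule.Quotient.mk_eq_zero]
      exact hu⟩
  obtain ⟨p, hp, hxp⟩ := Set.mem_iUnion₂.1 hmem
  refine hx p hp ?_ hxp
  rintro rfl
  obtain ⟨_, v, hv⟩ := isAssociatedPrime_iff.1 hp
  obtain ⟨v, rfl⟩ := K.mkQ_surjective v
  have hvK : v ∈ K := hK (mem_satd_one.2 ⟨1, fun a ha => by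
    rw [pow_one, hv, Submodule.mem_colon_singleton, ← map_smul, Submodule.mem_bot,
      Submodule.mkQ_apply, Submodule.Quotient.mk_eq_zero] at ha
    exact ha⟩)
  have h0 : K.mkQ v = 0 := by simpa using hvK
  have : (1 : S) ∈ maximalIdeal S := by
    rw [hv, Submodule.mem_colon_singleton, h0]
    simp
  exact (maximalIdeal.isMaximal S).ne_top ((Ideal.eq_top_iff_one _).2 this)

lemma gen_colon (K : Submodule S M) :
    ∀ᶠ x in genFilter R S, ∀ u, x • u ∈ K ↔ u ∈ satd 1 K := by
  obtain ⟨J, hJ, hJ'⟩ := exists_dimLT_smul_le (IsNoetherian.noetherian (satd 1 K)) le_rfl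
  obtain ⟨k, hk⟩ := dimLT_one_iff.1 hJ
  filter_upwards [gen_regular (R := R) (satd_satd (s := 1) (L := K)).le, gen_mem_pow k] with x hx hxk u
  exact ⟨fun h => hx u (le_satd h), fun h => hJ' (Submodule.smul_mem_smul (hk hxk) h)⟩

omit [Module.Finite S M] in
lemma gen_dimLT {s : ℕ} {J : Ideal S} (h : DimLT (s + 1) J) (hs : s ≠ 0) :
    ∀ᶠ x in genFilter R S, DimLT s (J ⊔ Ideal.span {x}) := by
  filter_upwards [gen_avoid (R := R) J.finite_minimalPrimes_of_isNoetherianRing fun p hp => hp.1.1]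
    with x hx
  exact h.sup_span hs hx

omit [IsLocalRing S] [IsNoetherianRing S] [Module.Finite S M] in
lemma sup_span_smul_le_extBy {J : Ideal S} {K : Submodule S M} (h : J • ⊤ ≤ K) (x : S) :
    (J ⊔ Ideal.span {x}) • ⊤ ≤ extBy K x := by
  rw [Submodule.sup_smul]
  exact sup_le (h.trans le_extBy) le_sup_right

theorem evList_isStrong {d : ℕ} {J : Ideal S} {K : Submodule S M} (hJ : DimLT (d + 1) J)
    (hK : J • ⊤ ≤ K) : EvList (genFilter R S) d (IsStrong · K) := by
  induction d generalizing J K with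
  | zero =>
    obtain ⟨k, hk⟩ := dimLT_one_iff.1 hJ
    exact ⟨k, (Submodule.smul_mono_left hk).trans hK⟩
  | succ d ih =>
    filter_upwards [gen_colon (R := R) K, gen_dimLT (R := R) hJ (by simp)] with x hx hx'
    refine ((ih hx' (sup_span_smul_le_extBy hK x)).and
      (EvList.of_forall_mem (gen_colon (R := R) K))).mono fun l hl => ⟨?_, hl.1⟩
    rintro y (_ | ⟨_, hy⟩)
    exacts [hx, hl.2 y hy]

end GenModule

section Chern
variable {S : Type} [CommRing S] {M : Type} [AddCommGroup M] [Module S M]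

lemma relLength_add {A B C : Submodule S M} (hAB : A ≤ B) (hBC : B ≤ C) :
    relLength A C = relLength A B + relLength B C := by
  have hle : A.comap B.subtype = (A.comap C.subtype).comap (Submodule.inclusion hBC) := rfl
  have hle' : A.comap C.subtype ≤ B.comap C.subtype := Submodule.comap_mono hAB
  refine Module.length_eq_add_of_exact (Submodule.mapQ _ _ (Submodule.inclusion hBC) hle.le)
    (Submodule.factor hle') ?_ (Submodule.factor_surjective _) ?_
  · rw [← LinearMap.ker_eq_bot, Submodule.ker_mapQ, ← hle]
    exact Submodule.mkQ_map_self _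
  · rw [LinearMap.exact_iff, Submodule.range_mapQ, Submodule.range_inclusion]
    simp [Submodule.factor, Submodule.ker_mapQ]

lemma relLength_anti_left {A B C : Submodule S M} (hAB : A ≤ B) (hBC : B ≤ C) :
    relLength B C ≤ relLength A C := by
  rw [relLength_add hAB hBC]
  exact le_add_self

lemma extBy_sup (K L : Submodule S M) (x : S) : extBy (K ⊔ L) x = extBy K x ⊔ L := by
  rw [extBy, extBy, sup_right_comm]

variable [IsLocalRing S]

lemma pow_smul_top_eq_bot_of_length_le [IsNoetherianRing S] (n : ℕ) (N : Type) [AddCommGroup N] [Module S N]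
    [Module.Finite S N] (h : Module.length S N ≤ n) :
    maximalIdeal S ^ n • (⊤ : Submodule S N) = ⊥ := by
  induction n generalizing N with
  | zero =>
    have : Subsingleton N := by
      rw [← Module.length_eq_zero_iff (R := S)]
      simpa using h
    exact Subsingleton.elim _ _
  | succ n ih =>
    rcases subsingleton_or_nontrivial N with hN | hN
    · have : Subsingleton (Submodule S N) := inferInstance
      exact Subsingleton.elim _ _
    set P : Submodule S N := maximalIdeal S • ⊤ with hP
    have hne : P ≠ ⊤ := by
      intro hP
      have := Submodule.eq_bot_of_le_smul_of_le_jacobson_bot (maximalIdeal S) (⊤ : Submodule S N)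
        Module.Finite.fg_top hP.ge (IsLocalRing.maximalIdeal_le_jacobson _)
      exact absurd this top_ne_bot
    have h1 : Module.length S N = Module.length S P + Module.length S (N ⧸ P) :=
      Module.length_eq_add_of_exact P.subtype P.mkQ P.injective_subtype P.mkQ_surjective
        (LinearMap.exact_subtype_mkQ P)
    have h2 : Module.length S (N ⧸ P) ≠ 0 := by
      rw [Ne, Module.length_eq_zero_iff, Submodule.Quotient.subsingleton_iff]
      exact hne
    have h3 : Module.length S P ≤ n := by
      have h4 : Module.length S P + 1 ≤ (n : ℕ∞) + 1 := by
        calc _ ≤ Module.length S P + Module.length S (N ⧸ P) := by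
              gcongr
              exact Order.one_le_iff_ne_zero.2 h2
          _ ≤ _ := h1 ▸ (by exact_mod_cast h)
      exact (ENat.add_le_add_iff_right (by simp)).1 h4
    have h5 := congrArg (Submodule.map P.subtype) (ih P h3)
    rw [Submodule.map_smul'', Submodule.map_subtype_top, Submodule.map_bot] at h5
    rw [pow_succ, Submodule.mul_smul]
    exact h5

variable [IsNoetherianRing S] [Module.Finite S M]

lemma pow_smul_le_of_relLength_le {A B : Submodule S M} {n : ℕ} (h : relLength A B ≤ n) :
    maximalIdeal S ^ n • B ≤ A := by
  have := pow_smul_top_eq_bot_of_length_le n _ h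
  refine Submodule.smul_le.2 fun a ha b hb => ?_
  have h1 : a • (Submodule.Quotient.mk ⟨b, hb⟩ : B ⧸ A.comap B.subtype) ∈
      maximalIdeal S ^ n • (⊤ : Submodule S (B ⧸ A.comap B.subtype)) :=
    Submodule.smul_mem_smul ha trivial
  rw [this, Submodule.mem_bot, ← Submodule.Quotient.mk_smul, Submodule.Quotient.mk_eq_zero] at h1
  exact h1

lemma mem_of_forall_mem_sup_pow {K : Submodule S M} {u : M}
    (h : ∀ n, u ∈ K ⊔ maximalIdeal S ^ n • ⊤) : u ∈ K := by
  have := Ideal.iInf_pow_smul_eq_bot_of_isLocalRing (M := M ⧸ K) (maximalIdeal S)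
    (maximalIdeal.isMaximal S).ne_top
  rw [← Submodule.Quotient.mk_eq_zero, ← Submodule.mem_bot S, ← this, Submodule.mem_iInf]
  intro n
  obtain ⟨k, hk, w, hw, rfl⟩ := Submodule.mem_sup.1 (h n)
  rw [Submodule.Quotient.mk_add, (Submodule.Quotient.mk_eq_zero K).2 hk, zero_add]
  have h1 := Submodule.mem_map_of_mem (f := K.mkQ) hw
  rw [Submodule.map_smul''] at h1
  exact (show maximalIdeal S ^ n • Submodule.map K.mkQ ⊤ ≤ maximalIdeal S ^ n • ⊤ from
    smul_mono_right _ le_top) h1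

lemma mem_of_forall_mem_extBy_pow {K : Submodule S M} {u : M} {x : S} (hx : x ∈ maximalIdeal S)
    (h : ∀ n ≠ 0, u ∈ extBy K (x ^ n)) : u ∈ K := by
  refine mem_of_forall_mem_sup_pow fun n => ?_
  rcases eq_or_ne n 0 with rfl | hn
  · simp
  · exact sup_smul_mono K ((Ideal.span_singleton_le_iff_mem _).2 (Ideal.pow_mem_pow hx n)) (h n hn)

lemma le_satd_succ_of_smul_le_sup {s : ℕ} {I : Ideal S} {K V : Submodule S M} {x : S}
    (hI : DimLT s I) (hx : x ∈ maximalIdeal S) (h : I • V ≤ K ⊔ Ideal.span {x} • V) :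
    V ≤ satd (s + 1) K := by
  let N := V ⧸ K.comap V.subtype
  have hdim : DimLT (s + 1) (Module.annihilator S N) := by
    refine DimLT.of_sup_span (x := x) (dimLT_of_forall_prime fun P hP hle => hI.mono ?_ le_rfl) hx
    have h1 : (⟨P, hP⟩ : PrimeSpectrum S) ∈ Module.support S (N ⧸ Ideal.span {x} • (⊤ : Submodule S N)) := by
      rw [Module.support_quotient, Module.support_eq_zeroLocus]
      refine ⟨le_sup_left.trans hle, ?_⟩
      exact (le_sup_right (a := Module.annihilator S N)).trans hle
    rw [Module.support_eq_zeroLocus] at h1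
    refine le_trans ?_ h1
    intro b hb
    rw [Module.mem_annihilator]
    intro n
    obtain ⟨n, rfl⟩ := Submodule.Quotient.mk_surjective _ n
    obtain ⟨v, rfl⟩ := Submodule.Quotient.mk_surjective _ n
    obtain ⟨k, hk, w, hw, hkw⟩ := Submodule.mem_sup.1 (h (Submodule.smul_mem_smul hb v.2))
    rw [← Submodule.Quotient.mk_smul, Submodule.Quotient.mk_eq_zero]
    rw [Submodule.ideal_span_singleton_smul, Submodule.mem_smul_pointwise_iff_exists] at hw
    obtain ⟨w, hw, rfl⟩ := hw
    have : b • (Submodule.Quotient.mk v : N) = x • (Submodule.Quotient.mk ⟨w, hw⟩ : N) := by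
      rw [← Submodule.Quotient.mk_smul, ← Submodule.Quotient.mk_smul, Submodule.Quotient.eq]
      show b • (v : M) - x • w ∈ K
      rw [← hkw]
      simpa using hk
    rw [this]
    exact Submodule.smul_mem_smul (Ideal.mem_span_singleton_self x) trivial
  intro v hv
  refine ⟨_, hdim, fun a ha => ?_⟩
  have := Module.mem_annihilator.1 ha (Submodule.Quotient.mk ⟨v, hv⟩)
  rw [← Submodule.Quotient.mk_smul, Submodule.Quotient.mk_eq_zero] at this
  exact this

end Chern

section ChernBound
variable {S : Type} [CommRing S] [IsLocalRing S] [IsNoetherianRing S]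
variable {M : Type} [AddCommGroup M] [Module S M] [Module.Finite S M]

/-- The Chern number of a two-element strong sequence as a relative length. -/
lemma IsStrong.relLength_eq_chernNum {x y : S} {K : Submodule S M} (h : IsStrong [x, y] K) :
    ∃ n : ℕ, chernNum [x, y] K = n ∧
      relLength (extBy (satd 1 K) x) (satd 1 (extBy K x)) = n := by
  have h1 := h.coe_torLen
  have h2 := h.2.coe_torLen
  have hsup : extBy (satd 1 K) x = extBy K x ⊔ satd 1 K := by
    rw [← extBy_sup, sup_eq_right.2 le_satd]
  have h3 : relLength K (satd 1 K) = relLength (extBy K x) (extBy K x ⊔ satd 1 K) := by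
    rw [relLength_sup]
    congr 1
    refine le_antisymm (le_inf le_extBy le_satd) ?_
    rintro u ⟨hu1, hu2⟩
    refine h.satd_inf_le ⟨hu2, sup_smul_mono K ?_ hu1⟩
    rw [Ideal.ofList_cons]
    exact le_sup_left
  have h4 := relLength_add (A := extBy K x) (B := extBy (satd 1 K) x) (C := satd 1 (extBy K x))
    (extBy_mono le_satd x) (by
      rw [hsup]
      exact sup_le le_satd (satd_mono le_rfl le_extBy))
  rw [← h2, hsup, ← h3, ← h1] at h4
  have hle := h.torLen_le
  refine ⟨torLen (extBy K x) - torLen K, ?_, ?_⟩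
  · simp only [chernNum]
    omega
  · rw [hsup]
    obtain ⟨c, hc⟩ := Nat.exists_eq_add_of_le hle
    rw [hc, Nat.cast_add] at h4
    rw [hc, Nat.add_sub_cancel_left]
    exact ((ENat.add_right_injective_of_ne_top (ENat.natCast_ne_top _)) h4).symm

variable (R : Type) [CommRing R] [Algebra R S]

/-- The Chern numbers of general strong sequences of length `d` on `M ⧸ K` are at most `ℓ`. -/
def ChernLE (ℓ d : ℕ) (K : Submodule S M) : Prop :=
  EvList (genFilter R S) d fun l => IsStrong l K → chernNum l K ≤ ℓ

variable {R} {ℓ d : ℕ} {K : Submodule S M}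

lemma ChernLE.extBy (h : ChernLE R ℓ (d + 3) K) :
    ∀ᶠ x in genFilter R S, ∀ n ≠ 0, ChernLE R ℓ (d + 2) (extBy K (x ^ n)) := by
  refine gen_pow (P := fun x => ChernLE R ℓ (d + 2) (_root_.extBy K x)) ?_
  filter_upwards [h, gen_colon (R := R) K] with x hx hxK
  refine ((hx.and (EvList.of_forall_mem (gen_colon (R := R) K))).and
    (EvList.of_forall fun _ h => h)).mono fun l hl hs => ?_
  obtain ⟨⟨hl1, hl2⟩, hl3⟩ := hl
  have hst : IsStrong (x :: l) K := ⟨by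
    rintro y (_ | ⟨_, hy⟩)
    exacts [hxK, hl2 y hy], hs⟩
  obtain ⟨a, b, l, rfl⟩ : ∃ a b l', l = a :: b :: l' := by
    rcases l with _ | ⟨a, _ | ⟨b, l⟩⟩
    · simp at hl3
    · simp at hl3
    · exact ⟨_, _, _, rfl⟩
  exact hl1 hst

omit [IsNoetherianRing S] [Module.Finite S M] in
lemma ChernLE.of_extBy (h : ∀ᶠ x in genFilter R S, ChernLE R ℓ (d + 2) (_root_.extBy K x)) :
    ChernLE R ℓ (d + 3) K := by
  refine Filter.Eventually.mono h fun x hx => ?_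
  refine (hx.and (EvList.of_forall fun _ h => h)).mono fun l hl hs => ?_
  obtain ⟨hl1, hl3⟩ := hl
  obtain ⟨a, b, l, rfl⟩ : ∃ a b l', l = a :: b :: l' := by
    rcases l with _ | ⟨a, _ | ⟨b, l⟩⟩
    · simp at hl3
    · simp at hl3
    · exact ⟨_, _, _, rfl⟩
  exact hl1 hs.2

variable [(genFilter R S).NeBot]

lemma ChernLE.relLength_le {J : Ideal S} (hJ : DimLT 3 J) (hJK : J • ⊤ ≤ K) (h : ChernLE R ℓ 2 K) :
    ∀ᶠ x in genFilter R S, ∀ n ≠ 0,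
      relLength (_root_.extBy (satd 1 K) (x ^ n)) (satd 1 (_root_.extBy K (x ^ n))) ≤ ℓ := by
  refine gen_pow (P := fun x => relLength (_root_.extBy (satd 1 K) x) (satd 1 (_root_.extBy K x)) ≤ ℓ) ?_
  have h1 := h.and (evList_isStrong (R := R) (d := 2) hJ hJK)
  refine Filter.Eventually.mono h1 fun x hx => ?_
  obtain ⟨y, hy1, hy2⟩ := Filter.Eventually.exists hx
  obtain ⟨n, hn, hn'⟩ := hy2.relLength_eq_chernNum
  rw [hn']
  have := hy1 hy2
  rw [hn] at this
  exact_mod_cast this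

theorem ChernLE.of_le {V : Submodule S M} {J J₀ : Ideal S} (hKV : K ≤ V) (hJ : DimLT (d + 2) J)
    (hJV : J • V ≤ K) (hJ₀ : DimLT (d + 3) J₀) (hJ₀K : J₀ • ⊤ ≤ K) (h : ChernLE R ℓ (d + 2) K) :
    ChernLE R ℓ (d + 2) V ∧ V ≤ satd (d + 1) K := by
  have hsmul : ∀ x : S, (J ⊔ Ideal.span {x}) • V ≤ _root_.extBy K x := fun x => by
    rw [Submodule.sup_smul]
    exact sup_le (hJV.trans le_extBy) ((show Ideal.span {_} • _ ≤ Ideal.span {_} • _ from smul_mono_right _ le_top).trans le_sup_right)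
  induction d generalizing K V J J₀ with
  | zero =>
    have key := h.relLength_le hJ₀ hJ₀K
    have hdim : ∀ᶠ x in genFilter R S, ∀ n ≠ 0, DimLT 1 (J ⊔ Ideal.span {x ^ n}) :=
      gen_pow (P := fun x => DimLT 1 (J ⊔ Ideal.span {x})) (gen_dimLT hJ (by simp))
    have hsat : ∀ x, DimLT 1 (J ⊔ Ideal.span {x}) → V ≤ satd 1 (_root_.extBy K x) :=
      fun x hx v hv => ⟨_, hx, fun a ha => hsmul x (Submodule.smul_mem_smul ha hv)⟩
    constructor
    · filter_upwards [key, hdim] with x hx1 hx2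
      have hx1 := hx1 1 (by simp)
      have hx2 := hx2 1 (by simp)
      rw [pow_one] at hx1 hx2
      refine Filter.Eventually.of_forall fun y hy => ?_
      obtain ⟨n, hn, hn'⟩ := hy.relLength_eq_chernNum
      have hVK : satd 1 (_root_.extBy V x) = satd 1 (_root_.extBy K x) :=
        le_antisymm (satd_le_of_le (sup_le (hsat x hx2) (le_sup_right.trans le_satd)))
          (satd_mono le_rfl (extBy_mono hKV x))
      rw [hn]
      have h2 : relLength (_root_.extBy (satd 1 V) x) (satd 1 (_root_.extBy V x)) ≤ ℓ := by
        rw [hVK]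
        refine le_trans (relLength_anti_left (extBy_mono (satd_mono le_rfl hKV) x) ?_) hx1
        rw [← hVK]
        exact sup_le (satd_mono le_rfl le_extBy) (le_sup_right.trans le_satd)
      rw [hn'] at h2
      exact_mod_cast h2
    · obtain ⟨x, ⟨hx1, hx2⟩, hxm⟩ := ((key.and hdim).and (gen_mem (R := R))).exists
      intro v hv
      refine mem_satd_one_of_smul (k := ℓ) fun a ha => mem_of_forall_mem_extBy_pow hxm fun n hn => ?_
      exact pow_smul_le_of_relLength_le (hx1 n hn) (Submodule.smul_mem_smul ha (hsat _ (hx2 n hn) hv))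
  | succ d ih =>
    have hev : ∀ᶠ x in genFilter R S, ChernLE R ℓ (d + 2) (_root_.extBy V x) ∧
        V ≤ satd (d + 1) (_root_.extBy K x) := by
      filter_upwards [h.extBy, gen_dimLT (R := R) hJ (by simp), gen_dimLT (R := R) hJ₀ (by simp)]
        with x hx1 hx2 hx3
      have hx1 := hx1 1 (by simp)
      rw [pow_one] at hx1
      have hJx : (J ⊔ Ideal.span {x}) • _root_.extBy V x ≤ _root_.extBy K x := by
        rw [_root_.extBy, Submodule.smul_sup]
        exact sup_le (hsmul x) (Submodule.smul_le_right.trans le_sup_right)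
      have := ih (extBy_mono hKV x) hx2 hJx hx3 (sup_span_smul_le_extBy hJ₀K x) hx1 fun y => by
        rw [Submodule.sup_smul]
        exact sup_le (hJx.trans le_extBy) ((show Ideal.span {_} • _ ≤ Ideal.span {_} • _ from smul_mono_right _ le_top).trans le_sup_right)
      exact ⟨this.1, le_extBy.trans this.2⟩
    refine ⟨ChernLE.of_extBy (hev.mono fun x hx => hx.1), ?_⟩
    obtain ⟨x, ⟨hx, hxV⟩, hxm⟩ := ((hev.and (gen_colon (R := R) V)).and (gen_mem (R := R))).exists
    obtain ⟨I, hI, hIV⟩ := exists_dimLT_smul_le (IsNoetherian.noetherian V) hx.2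
    obtain ⟨I', hI', hIV'⟩ := exists_dimLT_smul_le (IsNoetherian.noetherian (satd 1 V)) le_rfl
    refine le_satd_succ_of_smul_le_sup ((hI'.mono le_rfl (by omega)).mul hI) hxm ?_
    rw [Submodule.mul_smul]
    refine Submodule.smul_le.2 fun a ha u hu => ?_
    obtain ⟨k, hk, w, rfl⟩ := mem_extBy.1 (hIV hu)
    have hw : w ∈ satd 1 V := by
      rw [← hxV]
      have := V.sub_mem (Submodule.smul_le_right hu : _ ∈ V) (hKV hk)
      simpa using this
    rw [smul_add, smul_comm]
    exact Submodule.add_mem_sup (K.smul_mem a hk) (Submodule.smul_mem_smul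
      (Ideal.mem_span_singleton_self x) (hIV' (Submodule.smul_mem_smul ha hw)))

end ChernBound

section Kills
variable (R : Type) [CommRing R] [IsLocalRing R]

/-- The `k`-th power of the maximal ideal kills the `i`-th local cohomology. -/
def Kills (k i : ℕ) (N : Type) [AddCommGroup N] [Module R N] : Prop :=
  ∀ r ∈ maximalIdeal R ^ k, ∀ x : LC R i N, r • x = 0

variable {R} {A B C : Type} [AddCommGroup A] [AddCommGroup B] [AddCommGroup C] [Module R A]
  [Module R B] [Module R C] {a b i : ℕ}

lemma Kills.mono (h : Kills R a i A) (hab : a ≤ b) : Kills R b i A :=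
  fun r hr x => h r (Ideal.pow_le_pow_right hab hr) x

lemma Kills.of_surjective {f : LC R i A →ₗ[R] LC R i B} (hf : Function.Surjective f)
    (h : Kills R a i A) : Kills R a i B := by
  intro r hr x
  obtain ⟨x, rfl⟩ := hf x
  rw [← map_smul, h r hr, map_zero]

lemma Kills.of_injective {f : LC R i A →ₗ[R] LC R i B} (hf : Function.Injective f)
    (h : Kills R a i B) : Kills R a i A := by
  intro r hr x
  apply hf
  rw [map_smul, h r hr, map_zero]

lemma Kills.of_exact {f : A →ₗ[R] B} {g : B →ₗ[R] C} (hf : Function.Injective f)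
    (hg : Function.Surjective g) (hfg : Function.Exact f g) (hB : Kills R a i B)
    (hA : Kills R b (i + 1) A) : Kills R (a + b) i C := by
  obtain ⟨-, δ, h1, -⟩ := exists_LC_connecting R f g hf hg hfg i
  intro r hr x
  rw [pow_add] at hr
  refine Submodule.mul_induction_on hr (fun r1 hr1 r2 hr2 => ?_) fun r1 r2 h1 h2 => ?_
  · obtain ⟨w, hw⟩ := (h1 (r2 • x)).1 (by rw [map_smul, hA r2 hr2])
    rw [mul_smul, ← hw, ← map_smul, hB r1 hr1, map_zero]
  · rw [add_smul, h1, h2, add_zero]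

lemma kills_zero_of_forall (h : ∀ u : A, (∃ k, ∀ r ∈ maximalIdeal R ^ k, r • u = 0) →
    ∀ r ∈ maximalIdeal R ^ a, r • u = 0) : Kills R a 0 A := by
  intro r hr x
  apply (LCzero_injective_and_range R).1
  rw [map_smul, map_zero]
  exact h _ (((LCzero_injective_and_range R).2 _).1 ⟨x, rfl⟩) r hr

lemma Kills.smul_eq_zero (h : Kills R a 0 A) {u : A}
    (hu : ∃ k, ∀ r ∈ maximalIdeal R ^ k, r • u = 0) {r : R} (hr : r ∈ maximalIdeal R ^ a) :
    r • u = 0 := by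
  obtain ⟨x, rfl⟩ := ((LCzero_injective_and_range R).2 u).2 hu
  rw [← map_smul, h r hr, map_zero]

variable [IsNoetherianRing R]

lemma LCmap_surjective_of_isMaxTorsion_ker {g : B →ₗ[R] C} (hg : Function.Surjective g)
    (h : IsMaxTorsion R (LinearMap.ker g)) (i : ℕ) : Function.Surjective (LCmap R i g) := by
  obtain ⟨-, δ, h1, -⟩ := exists_LC_connecting R (LinearMap.ker g).subtype g
    (Submodule.injective_subtype _) hg (LinearMap.exact_subtype_ker_map g) i
  intro x
  exact (h1 x).1 (LC_succ_eq_zero_of_isMaxTorsion R i h _)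

lemma LCmap_succ_injective_of_isMaxTorsion_ker {g : B →ₗ[R] C} (hg : Function.Surjective g)
    (h : IsMaxTorsion R (LinearMap.ker g)) (i : ℕ) : Function.Injective (LCmap R (i + 1) g) := by
  obtain ⟨h1, -⟩ := exists_LC_connecting R (LinearMap.ker g).subtype g
    (Submodule.injective_subtype _) hg (LinearMap.exact_subtype_ker_map g) (i + 1)
  rw [injective_iff_map_eq_zero]
  intro x hx
  obtain ⟨y, rfl⟩ := (h1 x).1 hx
  rw [LC_succ_eq_zero_of_isMaxTorsion R i h y, map_zero]

end Kills

section KillsQuotient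
variable {R S : Type} [CommRing R] [IsLocalRing R] [CommRing S] [IsLocalRing S]
  [Algebra R S]
  {M : Type} [AddCommGroup M] [Module R M] [Module S M] [IsScalarTower R S M]

lemma smul_mem_pow_of_mem_pow (hm : maximalIdeal S = (maximalIdeal R).map (algebraMap R S)) {k : ℕ}
    {r : R} (hr : r ∈ maximalIdeal R ^ k) : algebraMap R S r ∈ maximalIdeal S ^ k := by
  rw [hm, ← Ideal.map_pow]
  exact Ideal.mem_map_of_mem _ hr

lemma forall_maximalIdeal_pow_smul_mem (hm : maximalIdeal S = (maximalIdeal R).map (algebraMap R S))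
    {k : ℕ} {u : M} {K : Submodule S M} (h : ∀ r ∈ maximalIdeal R ^ k, r • u ∈ K) :
    ∀ a ∈ maximalIdeal S ^ k, a • u ∈ K := by
  have : maximalIdeal S ^ k ≤ K.colon {u} := by
    rw [hm, ← Ideal.map_pow, Ideal.map_le_iff_le_comap]
    intro r hr
    rw [Ideal.mem_comap, Submodule.mem_colon_singleton, algebraMap_smul]
    exact h r hr
  exact fun a ha => Submodule.mem_colon_singleton.1 (this ha)

variable [IsNoetherianRing S]

lemma mem_satd_one_iff_torsion (hm : maximalIdeal S = (maximalIdeal R).map (algebraMap R S))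
    {K : Submodule S M} {u : M} : u ∈ satd 1 K ↔
      ∃ k, ∀ r ∈ maximalIdeal R ^ k, r • (Submodule.Quotient.mk u : M ⧸ K) = 0 := by
  have h1 : ∀ r : R, r • (Submodule.Quotient.mk u : M ⧸ K) = 0 ↔ r • u ∈ K := fun r => by
    rw [← Submodule.Quotient.mk_smul, Submodule.Quotient.mk_eq_zero]
  simp_rw [h1]
  rw [mem_satd_one]
  refine exists_congr fun k => ⟨fun h r hr => ?_, forall_maximalIdeal_pow_smul_mem hm⟩
  rw [← algebraMap_smul S]
  exact h _ (smul_mem_pow_of_mem_pow hm hr)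

lemma kills_zero_quotient (hm : maximalIdeal S = (maximalIdeal R).map (algebraMap R S)) {k : ℕ}
    {K : Submodule S M} (h : maximalIdeal S ^ k • satd 1 K ≤ K) : Kills R k 0 (M ⧸ K) := by
  refine kills_zero_of_forall fun u hu r hr => ?_
  obtain ⟨u, rfl⟩ := Submodule.Quotient.mk_surjective _ u
  have hu := (mem_satd_one_iff_torsion hm).2 hu
  rw [← Submodule.Quotient.mk_smul, Submodule.Quotient.mk_eq_zero, ← algebraMap_smul S]
  exact h (Submodule.smul_mem_smul (smul_mem_pow_of_mem_pow hm hr) hu)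

lemma kills_zero_zero_quotient (hm : maximalIdeal S = (maximalIdeal R).map (algebraMap R S))
    {K : Submodule S M} (h : satd 1 K ≤ K) : Kills R 0 0 (M ⧸ K) :=
  kills_zero_quotient hm (Submodule.smul_le_right.trans h)

lemma Kills.smul_satd_le (hm : maximalIdeal S = (maximalIdeal R).map (algebraMap R S)) {k : ℕ}
    {K : Submodule S M} (h : Kills R k 0 (M ⧸ K)) : maximalIdeal S ^ k • satd 1 K ≤ K := by
  refine Submodule.smul_le.2 fun a ha u hu => ?_
  refine forall_maximalIdeal_pow_smul_mem hm (fun r hr => ?_) a ha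
  have := h.smul_eq_zero ((mem_satd_one_iff_torsion hm).1 hu) hr
  rwa [← Submodule.Quotient.mk_smul, Submodule.Quotient.mk_eq_zero] at this

variable (R) in
/-- The projection between quotients as a map over the base ring. -/
def quotMap {K L : Submodule S M} (h : K ≤ L) : (M ⧸ K) →ₗ[R] (M ⧸ L) :=
  (Submodule.factor h).restrictScalars R

omit [IsLocalRing R] [IsLocalRing S] [IsNoetherianRing S] in
lemma quotMap_mk {K L : Submodule S M} (h : K ≤ L) (u : M) :
    quotMap R h (Submodule.Quotient.mk u) = Submodule.Quotient.mk u := rfl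

omit [IsLocalRing R] [IsLocalRing S] [IsNoetherianRing S] in
lemma quotMap_surjective {K L : Submodule S M} (h : K ≤ L) : Function.Surjective (quotMap R h) :=
  Submodule.factor_surjective h

lemma isMaxTorsion_ker_quotMap (hm : maximalIdeal S = (maximalIdeal R).map (algebraMap R S))
    {K L : Submodule S M} (h : K ≤ L) (hL : L ≤ satd 1 K) :
    IsMaxTorsion R (LinearMap.ker (quotMap R h)) := by
  rintro ⟨u, hu⟩
  obtain ⟨u, rfl⟩ := Submodule.Quotient.mk_surjective _ u
  rw [LinearMap.mem_ker, quotMap_mk, Submodule.Quotient.mk_eq_zero] at hu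
  obtain ⟨k, hk⟩ := (mem_satd_one_iff_torsion hm).1 (hL hu)
  exact ⟨k, fun r hr => Subtype.ext (hk r hr)⟩

lemma Kills.quotient_of_le [IsNoetherianRing R]
    (hm : maximalIdeal S = (maximalIdeal R).map (algebraMap R S))
    {K L : Submodule S M} (h : K ≤ L) (hL : L ≤ satd 1 K) {k i : ℕ} (hK : Kills R k i (M ⧸ K)) :
    Kills R k i (M ⧸ L) :=
  hK.of_surjective (LCmap_surjective_of_isMaxTorsion_ker (quotMap_surjective h)
    (isMaxTorsion_ker_quotMap hm h hL) i)

lemma Kills.quotient_of_ge [IsNoetherianRing R]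
    (hm : maximalIdeal S = (maximalIdeal R).map (algebraMap R S))
    {K L : Submodule S M} (h : K ≤ L) (hL : L ≤ satd 1 K) {k i : ℕ}
    (hK : Kills R k (i + 1) (M ⧸ L)) : Kills R k (i + 1) (M ⧸ K) :=
  hK.of_injective (LCmap_succ_injective_of_isMaxTorsion_ker (quotMap_surjective h)
    (isMaxTorsion_ker_quotMap hm h hL) i)

variable (R) in
/-- Multiplication by `y` between quotients, as a map over the base ring. -/
def quotMul {A B : Submodule S M} (y : S) (h : ∀ u, y • u ∈ B ↔ u ∈ A) : (M ⧸ A) →ₗ[R] (M ⧸ B) :=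
  (Submodule.mapQ A B (LinearMap.lsmul S M y) fun u hu => (h u).2 hu).restrictScalars R

omit [IsLocalRing R] [IsLocalRing S] [IsNoetherianRing S] in
lemma quotMul_injective {A B : Submodule S M} {y : S} (h : ∀ u, y • u ∈ B ↔ u ∈ A) :
    Function.Injective (quotMul R y h) := by
  rw [injective_iff_map_eq_zero]
  intro u hu
  obtain ⟨u, rfl⟩ := Submodule.Quotient.mk_surjective _ u
  have : (Submodule.Quotient.mk (y • u) : M ⧸ B) = 0 := hu
  rw [Submodule.Quotient.mk_eq_zero] at this ⊢
  exact (h u).1 this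

omit [IsLocalRing R] [IsLocalRing S] [IsNoetherianRing S] in
lemma quotMul_exact {A B : Submodule S M} {y : S} (h : ∀ u, y • u ∈ B ↔ u ∈ A) :
    Function.Exact (quotMul R y h) (quotMap R (le_extBy (K := B) (x := y))) := by
  intro u
  obtain ⟨u, rfl⟩ := Submodule.Quotient.mk_surjective _ u
  rw [quotMap_mk, Submodule.Quotient.mk_eq_zero]
  constructor
  · intro hu
    obtain ⟨k, hk, w, rfl⟩ := mem_extBy.1 hu
    refine ⟨Submodule.Quotient.mk w, ?_⟩
    show (Submodule.Quotient.mk (y • w) : M ⧸ B) = _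
    rw [Submodule.Quotient.eq]
    simpa using hk
  · rintro ⟨w, hw⟩
    obtain ⟨w, rfl⟩ := Submodule.Quotient.mk_surjective _ w
    have hw : (Submodule.Quotient.mk (y • w) : M ⧸ B) = Submodule.Quotient.mk u := hw
    rw [Submodule.Quotient.eq] at hw
    exact mem_extBy.2 ⟨u - y • w, by rw [← neg_sub]; exact B.neg_mem hw, w, by simp⟩

omit [IsLocalRing S] [IsNoetherianRing S] in
lemma Kills.extBy {A B : Submodule S M} {y : S} (h : ∀ u, y • u ∈ B ↔ u ∈ A) {a b i : ℕ}
    (hB : Kills R a i (M ⧸ B)) (hA : Kills R b (i + 1) (M ⧸ A)) :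
    Kills R (a + b) i (M ⧸ _root_.extBy B y) :=
  Kills.of_exact (quotMul_injective h) (quotMap_surjective le_extBy) (quotMul_exact h) hB hA

end KillsQuotient

section SatdKills
variable {R S : Type} [CommRing R] [IsLocalRing R] [IsNoetherianRing R] [CommRing S] [IsLocalRing S]
  [IsNoetherianRing S] [Algebra R S]
  {M : Type} [AddCommGroup M] [Module R M] [Module S M] [IsScalarTower R S M] [Module.Finite S M]

lemma satd_succ_le_of_kills (hm : maximalIdeal S = (maximalIdeal R).map (algebraMap R S)) (t : ℕ) :
    ∀ (k : ℕ) (L : Submodule S M), (∀ i ≤ t, Kills R k i (M ⧸ L)) → satd (t + 1) L ≤ satd 1 L := by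
  have := genFilter_neBot hm
  induction t with
  | zero => intro k L _; simp
  | succ t ih =>
    intro k L hL u hu
    have hL' : ∀ i ≤ t + 1, Kills R k i (M ⧸ satd 1 L) := fun i hi =>
      (hL i hi).quotient_of_le hm le_satd le_rfl
    have hsat : satd 1 (satd 1 L) ≤ satd 1 L := satd_satd.le
    obtain ⟨J, hJ, hJu⟩ := mem_satd.1 (satd_mono le_rfl (le_satd (s := 1) (L := L)) hu)
    obtain ⟨z, hz, hreg, hdim⟩ := ((gen_mem (R := R) (S := S)).and
      ((gen_pow (gen_regular hsat)).and (gen_pow (gen_dimLT hJ (Nat.succ_ne_zero t))))).exists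
    have key : ∀ n ≠ 0, u ∈ satd 1 (extBy (satd 1 L) (z ^ n)) := by
      intro n hn
      refine ih (k + k) (extBy (satd 1 L) (z ^ n)) (fun i hi => ?_) ?_
      · exact Kills.extBy (fun v => ⟨hreg n hn v, fun h => Submodule.smul_mem _ _ h⟩)
          (hL' i (by omega)) (hL' (i + 1) (by omega))
      · refine mem_satd.2 ⟨_, hdim n hn, fun a ha => ?_⟩
        obtain ⟨b, hb, c, hc, rfl⟩ := Submodule.mem_sup.1 ha
        obtain ⟨c, rfl⟩ := Ideal.mem_span_singleton'.1 hc
        rw [add_smul, mul_comm, mul_smul]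
        exact add_mem (le_extBy (hJu b hb)) (smul_mem_extBy _)
    have h2 : ∀ a ∈ maximalIdeal S ^ (k + k), a • u ∈ satd 1 L := by
      intro a ha
      refine mem_of_forall_mem_extBy_pow hz fun n hn => ?_
      have : Kills R (k + k) 0 (M ⧸ extBy (satd 1 L) (z ^ n)) :=
        Kills.extBy (fun v => ⟨hreg n hn v, fun h => Submodule.smul_mem _ _ h⟩)
          (hL' 0 (by omega)) (hL' 1 (by omega))
      exact this.smul_satd_le hm (Submodule.smul_mem_smul ha (key n hn))
    exact mem_satd_one_of_smul h2

end SatdKills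

section Chevalley
variable {S : Type} [CommRing S] [IsLocalRing S] [IsNoetherianRing S]
  {M : Type} [AddCommGroup M] [Module S M] [Module.Finite S M]

lemma exists_forall_sup_pow_le {V : ℕ → Submodule S M} (hV : Antitone V) (k : ℕ) :
    ∃ N, ∀ n, V N ≤ V n ⊔ maximalIdeal S ^ k • ⊤ := by
  set Q : Submodule S M := maximalIdeal S ^ k • ⊤ with hQ
  have : IsArtinian S (M ⧸ Q) := by
    refine (isFiniteLength_iff_isNoetherian_isArtinian.1
      (isFiniteLength_of_pow_smul_eq_zero (k := k) fun a ha x => ?_)).2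
    obtain ⟨x, rfl⟩ := Submodule.Quotient.mk_surjective _ x
    rw [← Submodule.Quotient.mk_smul, Submodule.Quotient.mk_eq_zero]
    exact Submodule.smul_mem_smul ha trivial
  obtain ⟨N, hN⟩ := IsArtinian.monotone_stabilizes (R := S) (M := M ⧸ Q)
    ⟨fun n => OrderDual.toDual ((V n).map Q.mkQ), fun a b hab =>
      OrderDual.toDual_le_toDual.2 (Submodule.map_mono (hV hab))⟩
  refine ⟨N, fun n => ?_⟩
  rcases le_total n N with h | h
  · exact (hV h).trans le_sup_left
  · have h1 : (V N).map Q.mkQ = (V n).map Q.mkQ := OrderDual.toDual.injective (hN n h)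
    have h2 := Submodule.le_comap_map Q.mkQ (V N)
    rwa [h1, Submodule.comap_map_eq, Submodule.ker_mkQ] at h2

/-- Chevalley's theorem. -/
theorem exists_le_sup_pow_of_iInf_le [IsPrecomplete (maximalIdeal S) M]
    {V : ℕ → Submodule S M} (hV : Antitone V) {K : Submodule S M}
    (hK : ∀ u, (∀ n, u ∈ V n) → u ∈ K) (k : ℕ) : ∃ n, V n ≤ K ⊔ maximalIdeal S ^ k • ⊤ := by
  obtain ⟨N, hN⟩ := exists_forall_sup_pow_le hV k
  refine ⟨N, fun u hu => ?_⟩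
  have step : ∀ j, ∀ u : M, (∀ n, u ∈ V n ⊔ maximalIdeal S ^ j • ⊤) →
      ∃ v, (∀ n, v ∈ V n ⊔ maximalIdeal S ^ (j + 1) • ⊤) ∧
        v - u ∈ (maximalIdeal S ^ j • ⊤ : Submodule S M) := by
    intro j u hu
    obtain ⟨N, hN⟩ := exists_forall_sup_pow_le hV (j + 1)
    obtain ⟨v, hv, w, hw, rfl⟩ := Submodule.mem_sup.1 (hu N)
    exact ⟨v, fun n => hN n hv, by rw [sub_add_cancel_left]; exact neg_mem hw⟩
  choose! g hg1 hg2 using step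
  let f : ℕ → M := fun j => Nat.rec u (fun j v => g (k + j) v) j
  have hf : ∀ j n, f j ∈ V n ⊔ maximalIdeal S ^ (k + j) • ⊤ := by
    intro j
    induction j with
    | zero => exact fun n => hN n hu
    | succ j ih => exact hg1 _ _ ih
  have hf' : ∀ j, f (j + 1) - f j ∈ (maximalIdeal S ^ (k + j) • ⊤ : Submodule S M) :=
    fun j => hg2 _ _ (hf j)
  have hmono : ∀ {a b : ℕ}, a ≤ b →
      (maximalIdeal S ^ b • ⊤ : Submodule S M) ≤ maximalIdeal S ^ a • ⊤ :=
    fun hab => Submodule.smul_mono_left (Ideal.pow_le_pow_right hab)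
  have hcau : ∀ a b, f (a + b) - f a ∈ (maximalIdeal S ^ (k + a) • ⊤ : Submodule S M) := by
    intro a b
    induction b with
    | zero => simp
    | succ b ih =>
      rw [← sub_add_sub_cancel (f (a + (b + 1))) (f (a + b)) (f a)]
      exact add_mem (hmono (by omega) (hf' (a + b))) ih
  obtain ⟨L, hL⟩ := IsPrecomplete.prec (I := maximalIdeal S) (M := M) inferInstance (f := f)
    (by
      intro a b hab
      obtain ⟨b, rfl⟩ := Nat.exists_eq_add_of_le hab
      refine (SModEq.sub_mem.2 ?_).symm
      exact hmono (by omega) (hcau a b))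
  have hLK : L ∈ K := by
    refine hK _ fun n => mem_of_forall_mem_sup_pow fun j => ?_
    have h1 := SModEq.sub_mem.1 (hL j)
    have h2 := sup_le_sup_left (hmono (show j ≤ k + j by omega)) (V n) (hf j n)
    rw [← sub_sub_cancel (f j) L]
    exact sub_mem h2 (Submodule.mem_sup_right h1)
  have h1 := SModEq.sub_mem.1 (hL k)
  have h2 := hmono (Nat.le_add_right k 0) (hcau 0 k)
  rw [zero_add] at h2
  have : u = L + ((f k - L) - (f k - f 0)) := by
    simp only [sub_sub_sub_cancel_left]
    show u = L + (u - L)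
    abel
  rw [this]
  exact Submodule.add_mem_sup hLK (sub_mem h1 h2)

end Chevalley

section ExistsRegular
variable {S : Type} [CommRing S] [IsNoetherianRing S]
  {M : Type} [AddCommGroup M] [Module S M] [Module.Finite S M]

lemma exists_mem_regular {s : ℕ} {J : Ideal S} {V : Submodule S M} (hV : satd s V ≤ V)
    (hJ : DimLT s J) : ∃ a ∈ J, ∀ u, a • u ∈ V → u ∈ V := by
  by_contra! hcon
  have hcov : (J : Set S) ⊆ ⋃ p ∈ associatedPrimes S (M ⧸ V), (p : Set S) := by
    intro a ha
    obtain ⟨u, hu, huV⟩ := hcon a ha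
    rw [biUnion_associatedPrimes_eq_zero_divisors]
    exact ⟨V.mkQ u, by simpa using huV, by
      rw [← map_smul, Submodule.mkQ_apply, Submodule.Quotient.mk_eq_zero]
      exact hu⟩
  obtain ⟨p, hp, hle⟩ := (Ideal.subset_union_prime_finite (associatedPrimes.finite S (M ⧸ V))
    (f := id) ⊤ ⊤ fun p hp _ _ => hp.isPrime).1 hcov
  obtain ⟨hpp, v, hv⟩ := isAssociatedPrime_iff.1 hp
  obtain ⟨v, rfl⟩ := V.mkQ_surjective v
  have hvV : v ∈ V := hV (mem_satd.2 ⟨p, hJ.mono hle le_rfl, fun a ha => by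
    rw [hv, Submodule.mem_colon_singleton, ← map_smul, Submodule.mem_bot,
      Submodule.mkQ_apply, Submodule.Quotient.mk_eq_zero] at ha
    exact ha⟩)
  have h0 : V.mkQ v = 0 := by simpa using hvV
  refine hpp.ne_top ((Ideal.eq_top_iff_one _).2 ?_)
  rw [hv, Submodule.mem_colon_singleton, h0]
  simp

end ExistsRegular

section SmulKills
variable {R A C : Type} [CommRing R] [IsLocalRing R] [AddCommGroup A] [Module R A]
  [AddCommGroup C] [Module R C]

lemma Kills.smul_eq_zero_of_exact {f : A →ₗ[R] A} {g : A →ₗ[R] C} (hf : Function.Injective f)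
    (hg : Function.Surjective g) (hfg : Function.Exact f g) {s : R} (hs : ∀ u, f u = s • u)
    {ℓ i : ℕ} (h : Kills R ℓ i C) {y : LC R (i + 1) A} (hy : s • y = 0) {r : R}
    (hr : r ∈ maximalIdeal R ^ ℓ) : r • y = 0 := by
  obtain ⟨-, δ, -, h2⟩ := exists_LC_connecting R f g hf hg hfg i
  have hf' : f = s • LinearMap.id := LinearMap.ext hs
  obtain ⟨w, rfl⟩ := (h2 y).1 (by
    rw [hf', LCmap_smul_id]
    exact hy)
  rw [← map_smul, h r hr, map_zero]

end SmulKills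

section Main
variable {R S : Type} [CommRing R] [IsLocalRing R] [IsNoetherianRing R] [CommRing S] [IsLocalRing S]
  [IsNoetherianRing S] [Algebra R S]
  {M : Type} [AddCommGroup M] [Module R M] [Module S M] [IsScalarTower R S M]

omit [IsNoetherianRing R] [IsLocalRing S] [IsNoetherianRing S] in
lemma kills_succ_of_forall_extBy_pow {K : Submodule S M} {a : R} (ha : a ∈ maximalIdeal R)
    {ℓ i : ℕ} (hreg : ∀ n ≠ 0, ∀ u, algebraMap R S a ^ n • u ∈ K → u ∈ K)
    (h : ∀ n ≠ 0, Kills R ℓ i (M ⧸ extBy K (algebraMap R S a ^ n))) :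
    Kills R ℓ (i + 1) (M ⧸ K) := by
  intro r hr y
  obtain ⟨k, hk⟩ := LC_torsion R (i + 1) y
  have hk1 : a ^ (k + 1) • y = 0 := by
    rw [pow_succ', mul_smul, hk _ (Ideal.pow_mem_pow ha k), smul_zero]
  have hiff : ∀ u, algebraMap R S a ^ (k + 1) • u ∈ K ↔ u ∈ K :=
    fun u => ⟨hreg _ (by omega) u, fun h => K.smul_mem _ h⟩
  refine Kills.smul_eq_zero_of_exact (quotMul_injective (R := R) hiff)
    (quotMap_surjective le_extBy) (quotMul_exact hiff) (fun u => ?_) (h (k + 1) (by omega)) hk1 hr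
  obtain ⟨u, rfl⟩ := Submodule.Quotient.mk_surjective _ u
  show (Submodule.Quotient.mk (algebraMap R S a ^ (k + 1) • u) : M ⧸ K) =
    a ^ (k + 1) • Submodule.Quotient.mk u
  rw [← map_pow, algebraMap_smul, Submodule.Quotient.mk_smul]

omit [IsNoetherianRing R] in
lemma kills_of_forall_extBy_pow (hm : maximalIdeal S = (maximalIdeal R).map (algebraMap R S))
    {K : Submodule S M} {a : R} (ha : a ∈ maximalIdeal R) {ℓ δ : ℕ}
    (hreg : ∀ n ≠ 0, ∀ u, algebraMap R S a ^ n • u ∈ K → u ∈ K)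
    (h : ∀ n ≠ 0, ∀ i < δ, Kills R ℓ i (M ⧸ extBy K (algebraMap R S a ^ n))) :
    ∀ i < δ + 1, Kills R ℓ i (M ⧸ K) := by
  have hx : algebraMap R S a ∈ maximalIdeal S := hm ▸ Ideal.mem_map_of_mem _ ha
  rintro (_ | i) hi
  · refine (kills_zero_zero_quotient hm fun u hu => ?_).mono (Nat.zero_le _)
    obtain ⟨k, hk⟩ := mem_satd_one.1 hu
    exact hreg (k + 1) (by omega) u (by
      rw [pow_succ', mul_smul]; exact K.smul_mem _ (hk _ (Ideal.pow_mem_pow hx k)))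
  · exact kills_succ_of_forall_extBy_pow ha hreg fun n hn => h n hn i (by omega)

variable [Module.Finite S M]

lemma kills_extBy_of_chernLE (hm : maximalIdeal S = (maximalIdeal R).map (algebraMap R S))
    [IsPrecomplete (maximalIdeal S) M] {d ℓ : ℕ}
    (ih : ∀ (K : Submodule S M) (J : Ideal S), DimLT (d + 3) J → J • ⊤ ≤ K →
      satd (d + 2) K ≤ K → ChernLE R ℓ (d + 2) K → ∀ i < d + 2, Kills R ℓ i (M ⧸ K))
    {K : Submodule S M} {J₀ : Ideal S} (hJ₀K : J₀ • ⊤ ≤ K) (hsat : satd (d + 3) K ≤ K) {y : S}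
    (hy : y ∈ maximalIdeal S) (hreg : ∀ n ≠ 0, ∀ u, y ^ n • u ∈ K → u ∈ K)
    (hC : ∀ n ≠ 0, ChernLE R ℓ (d + 2) (extBy K (y ^ n)))
    (hdim : ∀ n ≠ 0, DimLT (d + 3) (J₀ ⊔ Ideal.span {y ^ n})) :
    ∀ i < d + 2, Kills R ℓ i (M ⧸ extBy K y) := by
  have := genFilter_neBot hm
  have hreg1 : ∀ u, y • u ∈ K → u ∈ K := by simpa using hreg 1 one_ne_zero
  set V : ℕ → Submodule S M := fun n => satd (d + 2) (extBy K (y ^ (n + 1))) with hVdef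
  have hVsat : ∀ n, satd (d + 2) (V n) ≤ V n := fun n => satd_satd.le
  have hKV : ∀ n, K ≤ V n := fun n => le_extBy.trans le_satd
  have hV : ∀ n, ChernLE R ℓ (d + 2) (V n) ∧ V n ≤ satd (d + 1) (extBy K (y ^ (n + 1))) := by
    intro n
    obtain ⟨J, hJ, hJV⟩ := exists_dimLT_smul_le (IsNoetherian.noetherian (V n)) le_rfl
    exact ChernLE.of_le le_satd hJ hJV (hdim (n + 1) (by omega)) (sup_span_smul_le_extBy hJ₀K _)
      (hC (n + 1) (by omega))
  have hVk : ∀ n, ∀ i < d + 2, Kills R ℓ i (M ⧸ V n) := fun n =>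
    ih (V n) _ (hdim (n + 1) (by omega)) ((sup_span_smul_le_extBy hJ₀K _).trans le_satd) (hVsat n)
      (hV n).1
  have hVy : ∀ n u, y • u ∈ V (n + 1) ↔ u ∈ V n := by
    intro n u
    constructor
    · rintro ⟨J, hJ, hJu⟩
      refine ⟨J, hJ, fun a ha => ?_⟩
      obtain ⟨k, hk, w, hw⟩ := mem_extBy.1 (hJu a ha)
      refine mem_extBy.2 ⟨a • u - y ^ (n + 1) • w, hreg1 _ ?_, w, by simp⟩
      rw [smul_sub, smul_comm, hw, ← mul_smul, ← pow_succ', add_sub_cancel_right]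
      exact hk
    · rintro ⟨J, hJ, hJu⟩
      refine ⟨J, hJ, fun a ha => ?_⟩
      obtain ⟨k, hk, w, hw⟩ := mem_extBy.1 (hJu a ha)
      refine mem_extBy.2 ⟨y • k, K.smul_mem _ hk, w, ?_⟩
      rw [smul_comm, hw, smul_add, ← mul_smul, ← pow_succ']
  have hanti : Antitone V := antitone_nat_of_succ_le fun n => by
    refine satd_mono le_rfl fun u hu => ?_
    obtain ⟨k, hk, w, rfl⟩ := mem_extBy.1 hu
    exact mem_extBy.2 ⟨k, hk, y • w, by rw [← mul_smul, ← pow_succ]⟩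
  obtain ⟨J, hJ, hJV⟩ := exists_dimLT_smul_le (IsNoetherian.noetherian (V 0)) (hV 0).2
  rw [zero_add, pow_one] at hJV
  have hJV : ∀ a ∈ J, ∀ e ∈ V 0, ∃ k ∈ K, ∃ w, a • e = k + y • w := fun a ha e he =>
    mem_extBy.1 (hJV (Submodule.smul_mem_smul ha he))
  have hinter : ∀ u, (∀ n, u ∈ V n) → u ∈ K := by
    intro u hu
    refine hsat (le_satd_succ_of_smul_le_sup (V := ⨅ n, V n) (hJ.mono le_rfl (Nat.le_succ _)) hy ?_
      ((Submodule.mem_iInf _).2 hu))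
    refine Submodule.smul_le.2 fun a ha v hv => ?_
    rw [Submodule.mem_iInf] at hv
    obtain ⟨k, hk, w, hw⟩ := hJV a ha v (hv 0)
    rw [hw]
    refine Submodule.add_mem_sup hk (Submodule.smul_mem_smul (Ideal.mem_span_singleton_self y)
      ((Submodule.mem_iInf _).2 fun n => (hVy n w).1 ?_))
    rw [eq_sub_of_add_eq' hw.symm]
    exact sub_mem (Submodule.smul_mem _ _ (hv _)) (hKV _ hk)
  have hloc : ∀ N, V 0 ≤ satd 1 (extBy (V (N + 1)) y) := by
    intro N e he
    obtain ⟨a, ha, hareg⟩ := exists_mem_regular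
      ((satd_mono (by omega) le_rfl).trans (hVsat (N + 1))) hJ
    have hareg' : ∀ u, a • u ∈ V N → u ∈ V N := fun u hu => by
      rw [← hVy] at hu ⊢
      rw [smul_comm] at hu
      exact hareg _ hu
    obtain ⟨k, hk, w, hw⟩ := hJV a ha e he
    have hw1 : w ∈ satd (d + 1) (extBy (V N) a) := by
      refine mem_satd.2 ⟨J, hJ, fun b hb => ?_⟩
      obtain ⟨k', hk', w', hw'⟩ := hJV b hb e he
      refine mem_extBy.2 ⟨b • w - a • w', hKV N (hreg1 _ ?_), w', by simp⟩
      have h1 : b • a • e = a • b • e := smul_comm _ _ _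
      rw [hw, hw'] at h1
      have h2 : y • (b • w - a • w') = a • k' - b • k := by
        rw [smul_sub, smul_comm y b, smul_comm y a]
        rw [smul_add, smul_add] at h1
        rw [sub_eq_sub_iff_add_eq_add, add_comm, h1]
        
      rw [h2]
      exact sub_mem (K.smul_mem _ hk') (K.smul_mem _ hk)
    have hw2 : w ∈ satd 1 (extBy (V N) a) :=
      satd_succ_le_of_kills hm d (ℓ + ℓ) _ (fun i hi => Kills.extBy
        (fun u => ⟨hareg' u, fun h => Submodule.smul_mem _ _ h⟩) (hVk N i (by omega))
        (hVk N (i + 1) (by omega))) hw1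
    obtain ⟨c, hc⟩ := mem_satd_one.1 hw2
    refine mem_satd_one.2 ⟨c, fun b hb => ?_⟩
    obtain ⟨v, hv, w', hw'⟩ := mem_extBy.1 (hc b hb)
    refine mem_extBy.2 ⟨b • e - y • w', hareg _ ?_, w', by simp⟩
    have : a • (b • e - y • w') = b • k + y • v := by
      rw [smul_sub, smul_comm a b, hw, smul_add, smul_comm b y, hw', smul_comm a y, smul_add,
        ← add_assoc, add_sub_cancel_right]
    rw [this]
    exact add_mem (Submodule.smul_mem _ _ (hKV _ hk)) ((hVy N v).2 hv)
  have hV0 : maximalIdeal S ^ ℓ • V 0 ≤ extBy K y := by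
    intro u hu
    refine mem_of_forall_mem_sup_pow fun c => ?_
    obtain ⟨n, hn⟩ := exists_le_sup_pow_of_iInf_le hanti hinter c
    have h1 : Kills R (0 + ℓ) 0 (M ⧸ extBy (V (n + 1)) y) :=
      Kills.extBy (hVy n) (kills_zero_zero_quotient hm
        ((satd_mono (by omega) le_rfl).trans (hVsat (n + 1)))) (hVk n 1 (by omega))
    rw [zero_add] at h1
    have h2 := h1.smul_satd_le hm (smul_mono_right (maximalIdeal S ^ ℓ) (hloc n) hu)
    rw [← extBy_sup]
    exact extBy_mono ((hanti (Nat.le_succ n)).trans hn) y h2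
  have hle : extBy K y ≤ V 0 := by
    have : extBy K (y ^ (0 + 1)) ≤ V 0 := le_satd
    simpa using this
  have hle' : V 0 ≤ satd 1 (extBy K y) := fun u hu =>
    mem_satd_one.2 ⟨ℓ, fun a ha => hV0 (Submodule.smul_mem_smul ha hu)⟩
  have hge : satd 1 (extBy K y) ≤ V 0 := by
    have : satd 1 (extBy K (y ^ (0 + 1))) ≤ V 0 := satd_mono (by omega) le_rfl
    simpa using this
  rintro (_ | i) hi
  · exact kills_zero_quotient hm ((smul_mono_right (maximalIdeal S ^ ℓ) hge).trans hV0)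
  · exact Kills.quotient_of_ge hm hle hle' (hVk 0 (i + 1) hi)

theorem kills_of_chernLE (hm : maximalIdeal S = (maximalIdeal R).map (algebraMap R S))
    [IsPrecomplete (maximalIdeal S) M] {ℓ : ℕ} (d : ℕ) :
    ∀ (K : Submodule S M) (J : Ideal S), DimLT (d + 3) J → J • ⊤ ≤ K →
      satd (d + 2) K ≤ K → ChernLE R ℓ (d + 2) K → ∀ i < d + 2, Kills R ℓ i (M ⧸ K) := by
  have := genFilter_neBot hm
  have hma : ∀ a, algebraMap R S a ∈ maximalIdeal S → a ∈ maximalIdeal R := by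
    intro a ha
    by_contra hn
    exact ha (IsUnit.map _ (by simpa using hn))
  induction d with
  | zero =>
    intro K J hJ hJK hsat h
    have hsat1 : satd 1 K ≤ K := (satd_mono (by omega) le_rfl).trans hsat
    obtain ⟨_, ⟨a, rfl⟩, ha, hreg, hlen⟩ := ((gen_range (R := R) (S := S)).and (gen_mem.and
      ((gen_pow (gen_regular hsat1)).and (h.relLength_le hJ hJK)))).exists
    refine kills_of_forall_extBy_pow hm (hma a ha) hreg fun n hn i hi => ?_
    obtain rfl : i = 0 := by omega
    exact kills_zero_quotient hm ((pow_smul_le_of_relLength_le (hlen n hn)).trans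
      (extBy_mono hsat1 _))
  | succ d ih =>
    intro K J hJ hJK hsat h
    have hsat1 : satd 1 K ≤ K := (satd_mono (by omega) le_rfl).trans hsat
    obtain ⟨_, ⟨a, rfl⟩, ha, hreg, hC, hdim⟩ := ((gen_range (R := R) (S := S)).and (gen_mem.and
      ((gen_pow (gen_regular hsat1)).and (h.extBy.and (gen_pow (gen_dimLT hJ (by simp))))))).exists
    refine kills_of_forall_extBy_pow hm (hma a ha) hreg fun n hn => ?_
    refine kills_extBy_of_chernLE hm ih hJK hsat (Ideal.pow_mem_of_mem _ ha n (Nat.pos_of_ne_zero hn))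
      ?_ ?_ ?_
    all_goals
      intro j hj
      rw [← pow_mul]
    exacts [hreg _ (mul_ne_zero hn hj), hC _ (mul_ne_zero hn hj), hdim _ (mul_ne_zero hn hj)]

end Main

section CompleteNoetherian
variable {R S : Type} [CommRing R] [CommRing S] [Algebra R S]

lemma exists_fg_le_sup {A C P : Submodule S S} (hP : P.FG) (h : P ≤ A ⊔ C) :
    ∃ B ≤ A, B.FG ∧ P ≤ B ⊔ C := by
  induction P, hP using Submodule.fg_induction with
  | singleton x =>
    obtain ⟨a, ha, c, hc, rfl⟩ := Submodule.mem_sup.1 (h (Submodule.mem_span_singleton_self x))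
    exact ⟨Submodule.span S {a}, (Submodule.span_singleton_le_iff_mem _ _).2 ha,
      Submodule.fg_span_singleton a, (Submodule.span_singleton_le_iff_mem _ _).2
        (Submodule.add_mem_sup (Submodule.mem_span_singleton_self a) hc)⟩
  | sup P Q _ _ h1 h2 =>
    obtain ⟨B1, hB1, hF1, hP1⟩ := h1 (le_sup_left.trans h)
    obtain ⟨B2, hB2, hF2, hP2⟩ := h2 (le_sup_right.trans h)
    exact ⟨B1 ⊔ B2, sup_le hB1 hB2, hF1.sup hF2,
      sup_le (hP1.trans (sup_le_sup_right le_sup_left _))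
        (hP2.trans (sup_le_sup_right le_sup_right _))⟩

variable (I : Ideal R)

lemma exists_sub_algebraMap_mem_pow_succ
    (hs : ∀ s : S, ∃ r : R, s - algebraMap R S r ∈ I.map (algebraMap R S)) (n : ℕ) :
    ∀ s ∈ I.map (algebraMap R S) ^ n, ∃ r ∈ I ^ n, s - algebraMap R S r ∈ I.map (algebraMap R S) ^ (n + 1) := by
  intro s hs'
  rw [← Ideal.map_pow] at hs'
  refine Submodule.span_induction (p := fun s _ => ∃ r ∈ I ^ n,
    s - algebraMap R S r ∈ I.map (algebraMap R S) ^ (n + 1)) ?_ ?_ ?_ ?_ hs'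
  · rintro _ ⟨r, hr, rfl⟩
    exact ⟨r, hr, by simp⟩
  · exact ⟨0, zero_mem _, by simp⟩
  · rintro x y - - ⟨r, hr, hx⟩ ⟨t, ht, hy⟩
    exact ⟨r + t, add_mem hr ht, by rw [map_add, add_sub_add_comm]; exact add_mem hx hy⟩
  · rintro a x - ⟨r, hr, hx⟩
    obtain ⟨t, ht⟩ := hs a
    refine ⟨t * r, Ideal.mul_mem_left _ _ hr, ?_⟩
    have : a • x - algebraMap R S (t * r) =
        a * (x - algebraMap R S r) + (a - algebraMap R S t) * algebraMap R S r := by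
      rw [map_mul, smul_eq_mul]
      ring
    rw [this]
    refine add_mem (Ideal.mul_mem_left _ _ hx) ?_
    rw [pow_succ']
    refine Ideal.mul_mem_mul ht ?_
    rw [← Ideal.map_pow]
    exact Ideal.mem_map_of_mem _ hr

/-- The filtration of leading forms of elements of `A`. -/
def leadFiltration (A : Ideal S) : I.Filtration R where
  N n := I ^ n ⊓ (A ⊔ I.map (algebraMap R S) ^ (n + 1)).comap (algebraMap R S)
  mono n := by
    rintro r ⟨h1, -⟩
    refine ⟨Ideal.pow_le_pow_right (Nat.le_succ n) h1, Submodule.mem_sup_right ?_⟩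
    rw [← Ideal.map_pow]
    exact Ideal.mem_map_of_mem _ h1
  smul_le n := by
    refine Submodule.smul_le.2 fun r hr x hx => ⟨?_, ?_⟩
    · rw [smul_eq_mul, pow_succ']
      exact Ideal.mul_mem_mul hr hx.1
    · have h : algebraMap R S x ∈ A ⊔ I.map (algebraMap R S) ^ (n + 1) := hx.2
      obtain ⟨a, ha, c, hc, hac⟩ := Submodule.mem_sup.1 h
      show algebraMap R S (r * x) ∈ A ⊔ I.map (algebraMap R S) ^ (n + 1 + 1)
      rw [map_mul, ← hac, mul_add]
      refine Submodule.add_mem_sup (Ideal.mul_mem_left _ _ ha) ?_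
      rw [pow_succ']
      exact Ideal.mul_mem_mul (Ideal.mem_map_of_mem _ hr) hc

variable [IsNoetherianRing R]

lemma exists_fg_inf_pow_le
    (hs : ∀ s : S, ∃ r : R, s - algebraMap R S r ∈ I.map (algebraMap R S)) (A : Ideal S) :
    ∃ B ≤ A, B.FG ∧ ∃ n₀ : ℕ, ∀ n, A ⊓ I.map (algebraMap R S) ^ n ≤
      I.map (algebraMap R S) ^ (n - n₀) * B ⊔ I.map (algebraMap R S) ^ (n + 1) := by
  set J := I.map (algebraMap R S) with hJ
  set F := leadFiltration I A with hF
  obtain ⟨n₀, hst⟩ : F.Stable := (I.stableFiltration_stable ⊤).of_le fun n => by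
    show F.N n ≤ I ^ n • ⊤
    rw [smul_eq_mul, Ideal.mul_top]
    exact inf_le_left
  have hst' : ∀ j, F.N (n₀ + j) = I ^ j • F.N n₀ := by
    intro j
    induction j with
    | zero => simp
    | succ j ih => rw [pow_succ', mul_smul, ← ih, hst (n₀ + j) (by omega)]; rfl
  have hmap : ∀ n, Ideal.map (algebraMap R S) (F.N n) ≤ A ⊔ J ^ (n + 1) := fun n =>
    Ideal.map_le_iff_le_comap.2 inf_le_right
  choose B hBA hBF hB using fun n => exists_fg_le_sup
    (Ideal.FG.map (IsNoetherian.noetherian (F.N n)) (algebraMap R S)) (hmap n)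
  refine ⟨⨆ n ∈ Finset.range (n₀ + 1), B n, iSup₂_le fun n _ => hBA n,
    Submodule.fg_biSup _ _ fun n _ => hBF n, n₀, fun n s hsn => ?_⟩
  obtain ⟨r, hr, hsr⟩ := exists_sub_algebraMap_mem_pow_succ I hs n s hsn.2
  have hrN : r ∈ F.N n := by
    refine ⟨hr, ?_⟩
    show algebraMap R S r ∈ A ⊔ J ^ (n + 1)
    rw [← sub_sub_cancel s (algebraMap R S r)]
    exact sub_mem (Submodule.mem_sup_left hsn.1) (Submodule.mem_sup_right hsr)
  suffices algebraMap R S r ∈ J ^ (n - n₀) * (⨆ n ∈ Finset.range (n₀ + 1), B n) ⊔ J ^ (n + 1) by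
    rw [← add_sub_cancel (algebraMap R S r) s]
    exact add_mem this (Submodule.mem_sup_right hsr)
  have hBle : ∀ k ≤ n₀, B k ≤ ⨆ n ∈ Finset.range (n₀ + 1), B n := fun k hk =>
    le_iSup₂_of_le k (Finset.mem_range.2 (by omega)) le_rfl
  rcases le_total n n₀ with h | h
  · rw [Nat.sub_eq_zero_of_le h, pow_zero, one_mul]
    exact sup_le_sup_right (hBle n h) _ (hB n (Ideal.mem_map_of_mem _ hrN))
  · obtain ⟨j, rfl⟩ := Nat.exists_eq_add_of_le h
    rw [hst' j] at hrN
    rw [Nat.add_sub_cancel_left]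
    have h1 := Ideal.mem_map_of_mem (algebraMap R S) hrN
    rw [smul_eq_mul, Ideal.map_mul, Ideal.map_pow] at h1
    have h2 := Ideal.mul_mono_right (I := J ^ j) ((hB n₀).trans (sup_le_sup_right (hBle n₀ le_rfl) _)) h1
    rw [Ideal.mul_sup, ← pow_add] at h2
    convert h2 using 3
    omega

theorem isNoetherianRing_of_isAdicComplete [IsAdicComplete (I.map (algebraMap R S)) S]
    (hs : ∀ s : S, ∃ r : R, s - algebraMap R S r ∈ I.map (algebraMap R S)) :
    IsNoetherianRing S := by
  refine (isNoetherianRing_iff_ideal_fg S).2 fun A => ?_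
  obtain ⟨B, hBA, hBF, n₀, hB⟩ := exists_fg_inf_pow_le I hs A
  set J := I.map (algebraMap R S) with hJ
  suffices A ≤ B by rwa [le_antisymm this hBA]
  obtain ⟨k, g, rfl⟩ := Submodule.fg_iff_exists_fin_generating_family.1 hBF
  intro s hsA
  have hg : ∀ i, g i ∈ A := fun i => hBA (Submodule.subset_span (Set.mem_range_self i))
  have step : ∀ n, ∀ u ∈ A ⊓ J ^ n, ∃ c : Fin k → S, (∀ i, c i ∈ J ^ (n - n₀)) ∧
      u - ∑ i, c i * g i ∈ A ⊓ J ^ (n + 1) := by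
    intro n u hu
    obtain ⟨v, hv, w, hw, rfl⟩ := Submodule.mem_sup.1 (hB n hu)
    rw [← smul_eq_mul, Submodule.mem_ideal_smul_span_iff_exists_sum] at hv
    obtain ⟨c, hc, rfl⟩ := hv
    have h1 : (c.sum fun i a => a • g i) = ∑ i, c i * g i := by
      rw [Finsupp.sum_fintype _ _ (by simp)]
      rfl
    refine ⟨c, hc, sub_mem hu.1 (sum_mem fun i _ => Ideal.mul_mem_left _ _ (hg i)), ?_⟩
    rw [h1, add_sub_cancel_left]
    exact hw
  choose! c hc1 hc2 using step
  let C : ℕ → Fin k → S := fun n =>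
    Nat.rec 0 (fun n C => C + c n (s - ∑ i, C i * g i)) n
  have hCs : ∀ n, C (n + 1) = C n + c n (s - ∑ i, C n i * g i) := fun n => rfl
  have hC : ∀ n, s - ∑ i, C n i * g i ∈ A ⊓ J ^ n := by
    intro n
    induction n with
    | zero => simpa [C] using hsA
    | succ n ih =>
      convert hc2 n _ ih using 1
      rw [hCs]
      simp only [Pi.add_apply, add_mul, Finset.sum_add_distrib]
      ring
  have hmono : ∀ {a b : ℕ}, a ≤ b → J ^ b ≤ J ^ a := fun hab => Ideal.pow_le_pow_right hab
  have hcau : ∀ i a b, C (a + b + n₀) i - C (a + n₀) i ∈ J ^ a := by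
    intro i a b
    induction b with
    | zero => simp
    | succ b ih =>
      rw [← sub_add_sub_cancel _ (C (a + b + n₀) i) _]
      refine add_mem ?_ ih
      have : C (a + (b + 1) + n₀) = C (a + b + n₀ + 1) := by
        rw [show a + (b + 1) + n₀ = a + b + n₀ + 1 by ring]
      rw [this, hCs, Pi.add_apply, add_sub_cancel_left]
      exact hmono (show a ≤ a + b + n₀ - n₀ by omega) (hc1 _ _ (hC _) i)
  have hlim : ∀ i, ∃ L, ∀ n, C (n + n₀) i - L ∈ J ^ n := by
    intro i
    obtain ⟨L, hL⟩ := IsPrecomplete.prec (I := J) (M := S) inferInstance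
      (f := fun n => C (n + n₀) i) (by
        intro a b hab
        obtain ⟨b, rfl⟩ := Nat.exists_eq_add_of_le hab
        refine (SModEq.sub_mem.2 ?_).symm
        rw [smul_eq_mul, Ideal.mul_top]
        exact hcau i a b)
    refine ⟨L, fun n => ?_⟩
    simpa using SModEq.sub_mem.1 (hL n)
  choose L hL using hlim
  have hs0 : s - ∑ i, L i * g i = 0 := by
    refine IsHausdorff.haus (I := J) (M := S) inferInstance _ fun n => ?_
    rw [SModEq.sub_mem, sub_zero, smul_eq_mul, Ideal.mul_top]
    have : s - ∑ i, L i * g i =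
        (s - ∑ i, C (n + n₀) i * g i) + ∑ i, (C (n + n₀) i - L i) * g i := by
      simp only [sub_mul, Finset.sum_sub_distrib]
      ring
    rw [this]
    exact add_mem (hmono (by omega) (hC _).2) (sum_mem fun i _ => Ideal.mul_mem_right _ _ (hL i n))
  rw [sub_eq_zero.1 hs0]
  exact sum_mem fun i _ => Ideal.mul_mem_left _ _ (Submodule.subset_span (Set.mem_range_self i))

end CompleteNoetherian

section Vanishing
variable {R : Type} [CommRing R] [IsLocalRing R] [IsNoetherianRing R]
  {M : Type} [AddCommGroup M] [Module R M] [Module.Finite R M]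

omit [IsNoetherianRing R] in
lemma maximalIdeal_eq_map_self : maximalIdeal R = (maximalIdeal R).map (algebraMap R R) := by
  simp

lemma exists_mem_maximalIdeal_regular {K : Submodule R M} (hK : satd 1 K ≤ K) {J : Ideal R} {s : ℕ}
    (hJ : DimLT (s + 2) J) : ∃ x ∈ maximalIdeal R, (∀ n ≠ 0, ∀ u, x ^ n • u ∈ K → u ∈ K) ∧
      ∀ n ≠ 0, DimLT (s + 1) (J ⊔ Ideal.span {x ^ n}) := by
  have := genFilter_neBot (maximalIdeal_eq_map_self (R := R))
  obtain ⟨x, hx, hreg, hdim⟩ := ((gen_mem (R := R) (S := R)).and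
    ((gen_pow (gen_regular hK)).and (gen_pow (gen_dimLT hJ (Nat.succ_ne_zero s))))).exists
  exact ⟨x, hx, hreg, hdim⟩

omit [Module.Finite R M] in
lemma isMaxTorsion_quotient {L : Submodule R M} (hL : ⊤ ≤ satd 1 L) : IsMaxTorsion R (M ⧸ L) := by
  intro u
  obtain ⟨u, rfl⟩ := Submodule.Quotient.mk_surjective _ u
  exact (mem_satd_one_iff_torsion (maximalIdeal_eq_map_self (R := R))).1 (hL trivial)

/-- Grothendieck vanishing. -/
theorem kills_zero_of_dimLT (s : ℕ) : ∀ (L : Submodule R M) (J : Ideal R), DimLT (s + 1) J →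
    J • ⊤ ≤ L → ∀ i ≥ s + 1, Kills R 0 i (M ⧸ L) := by
  have hm := maximalIdeal_eq_map_self (R := R)
  induction s with
  | zero =>
    intro L J hJ hJL i hi
    obtain ⟨i, rfl⟩ := Nat.exists_eq_add_of_le' hi
    intro r _ x
    rw [LC_succ_eq_zero_of_isMaxTorsion R i (isMaxTorsion_quotient fun u _ =>
      mem_satd.2 ⟨J, hJ, fun a ha => hJL (Submodule.smul_mem_smul ha trivial)⟩) x, smul_zero]
  | succ s ih =>
    intro L J hJ hJL i hi
    obtain ⟨i, rfl⟩ := Nat.exists_eq_add_of_le' (show 1 ≤ i by omega)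
    refine Kills.quotient_of_ge hm le_satd le_rfl ?_
    obtain ⟨x, hx, hreg, hdim⟩ := exists_mem_maximalIdeal_regular (K := satd 1 L) satd_satd.le hJ
    exact kills_succ_of_forall_extBy_pow hx hreg fun n hn =>
      ih _ _ (hdim n hn) (sup_span_smul_le_extBy (hJL.trans le_satd) _) i (by omega)

theorem isFiniteLength_LC_of_kills (i k : ℕ) : ∀ L : Submodule R M,
    (∀ j ≤ i, Kills R k j (M ⧸ L)) → IsFiniteLength R (LC R i (M ⧸ L)) := by
  have hm := maximalIdeal_eq_map_self (R := R)
  induction i generalizing k with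
  | zero =>
    intro L hL
    have : Module.Finite R (LC R 0 (M ⧸ L)) :=
      Module.Finite.of_injective (LCzero R (M ⧸ L)) (LCzero_injective_and_range R).1
    exact isFiniteLength_of_pow_smul_eq_zero (hL 0 le_rfl)
  | succ i ih =>
    intro L hL
    have hL' : ∀ j ≤ i + 1, Kills R k j (M ⧸ satd 1 L) := fun j hj =>
      (hL j hj).quotient_of_le hm le_satd le_rfl
    refine IsFiniteLength.of_injective (f := LCmap R (i + 1) (quotMap R (le_satd (s := 1) (L := L))))
      ?_ (LCmap_succ_injective_of_isMaxTorsion_ker (quotMap_surjective _)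
        (isMaxTorsion_ker_quotMap hm le_satd le_rfl) i)
    have := genFilter_neBot hm
    obtain ⟨x, hx, hreg⟩ := ((gen_mem (R := R) (S := R)).and
      (gen_pow (gen_regular (satd_satd (s := 1) (L := L)).le))).exists
    have hiff : ∀ u, x ^ (k + 1) • u ∈ satd 1 L ↔ u ∈ satd 1 L :=
      fun u => ⟨hreg _ (by omega) u, fun h => Submodule.smul_mem _ _ h⟩
    have hfin := ih (k + k) (extBy (satd 1 L) (x ^ (k + 1))) fun j hj =>
      Kills.extBy hiff (hL' j (by omega)) (hL' (j + 1) (by omega))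
    obtain ⟨-, δ, -, h2⟩ := exists_LC_connecting R (quotMul R _ hiff) (quotMap R le_extBy)
      (quotMul_injective hiff) (quotMap_surjective _) (quotMul_exact hiff) i
    have hf : quotMul R _ hiff = x ^ (k + 1) • LinearMap.id := LinearMap.ext fun u => by
      obtain ⟨u, rfl⟩ := Submodule.Quotient.mk_surjective _ u
      rfl
    refine IsFiniteLength.of_surjective hfin (f := δ) fun y => (h2 y).1 ?_
    rw [hf, LCmap_smul_id]
    show x ^ (k + 1) • y = 0
    exact hL' (i + 1) le_rfl _ (Ideal.pow_le_pow_right (Nat.le_succ k) (Ideal.pow_mem_pow hx _)) y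

end Vanishing

section Cokernel
variable (R : Type) [CommRing R] [IsLocalRing R]

/-- The cokernel of the completion map. -/
abbrev ComplCoker (A : Type) [AddCommGroup A] [Module R A] : Type :=
  AdicCompletion (maximalIdeal R) A ⧸ LinearMap.range (AdicCompletion.of (maximalIdeal R) A)

variable {A B C : Type} [AddCommGroup A] [Module R A] [AddCommGroup B] [Module R B]
  [AddCommGroup C] [Module R C]

/-- The map induced on cokernels of completion maps. -/
noncomputable def complCokerMap (f : A →ₗ[R] B) : ComplCoker R A →ₗ[R] ComplCoker R B :=
  Submodule.mapQ _ _ ((AdicCompletion.map (maximalIdeal R) f).restrictScalars R) <| by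
    rintro _ ⟨a, rfl⟩
    exact ⟨f a, (AdicCompletion.map_of _ f a).symm⟩

lemma complCokerMap_mk (f : A →ₗ[R] B) (u : AdicCompletion (maximalIdeal R) A) :
    complCokerMap R f (Submodule.Quotient.mk u) =
      Submodule.Quotient.mk (AdicCompletion.map (maximalIdeal R) f u) := rfl

lemma complCokerMap_comp (f : A →ₗ[R] B) (g : B →ₗ[R] C) (x : ComplCoker R A) :
    complCokerMap R g (complCokerMap R f x) = complCokerMap R (g ∘ₗ f) x := by
  obtain ⟨x, rfl⟩ := Submodule.Quotient.mk_surjective _ x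
  simp only [complCokerMap_mk, AdicCompletion.map_comp_apply]

lemma complCokerMap_smul_id (r : R) (x : ComplCoker R A) :
    complCokerMap R (r • LinearMap.id) x = r • x := by
  obtain ⟨x, rfl⟩ := Submodule.Quotient.mk_surjective _ x
  rw [complCokerMap_mk, ← Submodule.Quotient.mk_smul]
  congr 1

variable {R} [IsNoetherianRing R] [Module.Finite R B] {f : A →ₗ[R] B} {g : B →ₗ[R] C}
  (hf : Function.Injective f) (hg : Function.Surjective g) (hfg : Function.Exact f g)

omit [IsNoetherianRing R] [Module.Finite R B] in
include hg in
lemma complCokerMap_surjective : Function.Surjective (complCokerMap R g) := by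
  intro y
  obtain ⟨y, rfl⟩ := Submodule.Quotient.mk_surjective _ y
  obtain ⟨x, rfl⟩ := AdicCompletion.map_surjective (maximalIdeal R) hg y
  exact ⟨Submodule.Quotient.mk x, rfl⟩

include hf hg hfg in
lemma complCokerMap_injective [Module.Finite R C] : Function.Injective (complCokerMap R f) := by
  refine (injective_iff_map_eq_zero _).2 fun x hx => ?_
  obtain ⟨x, rfl⟩ := Submodule.Quotient.mk_surjective _ x
  rw [complCokerMap_mk, Submodule.Quotient.mk_eq_zero] at hx
  obtain ⟨b, hb⟩ := hx
  have h1 : AdicCompletion.map (maximalIdeal R) g (AdicCompletion.map (maximalIdeal R) f x) = 0 :=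
    (AdicCompletion.map_exact hf hfg hg _).2 ⟨x, rfl⟩
  rw [← hb, AdicCompletion.map_of] at h1
  have h2 : g b = 0 := AdicCompletion.of_injective (maximalIdeal R) C (by rw [h1, map_zero])
  obtain ⟨a, rfl⟩ := (hfg b).1 h2
  rw [Submodule.Quotient.mk_eq_zero]
  exact ⟨a, AdicCompletion.map_injective (maximalIdeal R) hf (by rw [AdicCompletion.map_of, hb])⟩

include hf hg hfg in
lemma complCokerMap_exact : Function.Exact (complCokerMap R f) (complCokerMap R g) := by
  intro y
  obtain ⟨y, rfl⟩ := Submodule.Quotient.mk_surjective _ y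
  constructor
  · intro hy
    rw [complCokerMap_mk, Submodule.Quotient.mk_eq_zero] at hy
    obtain ⟨c, hc⟩ := hy
    obtain ⟨b, rfl⟩ := hg c
    obtain ⟨a, ha⟩ := (AdicCompletion.map_exact hf hfg hg
      (y - AdicCompletion.of (maximalIdeal R) B b)).1
      (by rw [map_sub, AdicCompletion.map_of, hc, sub_self])
    refine ⟨Submodule.Quotient.mk a, ?_⟩
    rw [complCokerMap_mk, ha, Submodule.Quotient.eq]
    exact ⟨-b, by rw [map_neg]; abel⟩
  · rintro ⟨x, hx⟩
    obtain ⟨x, rfl⟩ := Submodule.Quotient.mk_surjective _ x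
    rw [← hx, complCokerMap_mk, complCokerMap_mk,
      (AdicCompletion.map_exact hf hfg hg (AdicCompletion.map (maximalIdeal R) f x)).2 ⟨x, rfl⟩]
    rfl

omit [Module.Finite R B] in
lemma subsingleton_complCoker_of_isMaxTorsion [Module.Finite R A] (hA : IsMaxTorsion R A) :
    Subsingleton (ComplCoker R A) := by
  obtain ⟨k, hk⟩ := exists_pow_smul_eq_zero_of_fg R hA (Module.Finite.fg_top (R := R) (M := A))
  have : IsPrecomplete (maximalIdeal R) A := by
    refine ⟨fun f hf => ⟨f k, fun n => ?_⟩⟩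
    rcases le_total n k with h | h
    · exact hf h
    · have h0 : maximalIdeal R ^ k • (⊤ : Submodule R A) = ⊥ :=
        le_bot_iff.1 (Submodule.smul_le.2 fun a ha u _ => hk a ha u trivial)
      have h1 := hf h
      rw [h0, SModEq.bot] at h1
      rw [h1]
  rw [Submodule.Quotient.subsingleton_iff, LinearMap.range_eq_top]
  exact AdicCompletion.of_surjective _ _

end Cokernel

section CokernelVanishing
variable {R : Type} [CommRing R] [IsLocalRing R] [IsNoetherianRing R]
  {M : Type} [AddCommGroup M] [Module R M] [Module.Finite R M]

lemma complCokerMap_quotMap_bijective {K L : Submodule R M} (h : K ≤ L) (hL : L ≤ satd 1 K) :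
    Function.Bijective (complCokerMap R (quotMap R h)) := by
  refine ⟨(injective_iff_map_eq_zero _).2 fun x hx => ?_,
    complCokerMap_surjective (quotMap_surjective h)⟩
  have := subsingleton_complCoker_of_isMaxTorsion
    (isMaxTorsion_ker_quotMap (maximalIdeal_eq_map_self (R := R)) h hL)
  obtain ⟨w, rfl⟩ := (complCokerMap_exact (Submodule.injective_subtype _) (quotMap_surjective h)
    (LinearMap.exact_subtype_ker_map (quotMap R h)) x).1 hx
  rw [Subsingleton.elim w 0, map_zero]

theorem kills_zero_complCoker (j : ℕ) : ∀ K : Submodule R M,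
    Kills R 0 j (ComplCoker R (M ⧸ K)) := by
  induction j with
  | zero =>
    intro K
    refine Kills.of_injective (LCequiv R 0 (LinearEquiv.ofBijective _
      (complCokerMap_quotMap_bijective (le_satd (s := 1) (L := K)) le_rfl))).injective ?_
    obtain ⟨x, hx, hreg, -⟩ := exists_mem_maximalIdeal_regular (K := satd 1 K) satd_satd.le
      (dimLT_top (S := R) (s := 2))
    refine kills_zero_of_forall fun u ⟨k, hk⟩ r _ => ?_
    have hiff : ∀ u, x ^ (k + 1) • u ∈ satd 1 K ↔ u ∈ satd 1 K :=
      fun u => ⟨hreg _ (by omega) u, fun h => Submodule.smul_mem _ _ h⟩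
    have hu : u = 0 := by
      apply complCokerMap_injective (quotMul_injective (R := R) hiff)
        (quotMap_surjective le_extBy) (quotMul_exact hiff)
      have : quotMul R (x ^ (k + 1)) hiff = x ^ (k + 1) • LinearMap.id := by
        ext u; rfl
      rw [this, complCokerMap_smul_id, map_zero, pow_succ', mul_smul,
        hk _ (Ideal.pow_mem_pow hx k), smul_zero]
    rw [hu, smul_zero]
  | succ j ih =>
    intro K
    refine Kills.of_injective (LCequiv R (j + 1) (LinearEquiv.ofBijective _
      (complCokerMap_quotMap_bijective (le_satd (s := 1) (L := K)) le_rfl))).injective ?_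
    obtain ⟨x, hx, hreg, -⟩ := exists_mem_maximalIdeal_regular (K := satd 1 K) satd_satd.le
      (dimLT_top (S := R) (s := 2))
    intro r hr y
    obtain ⟨k, hk⟩ := LC_torsion R (j + 1) y
    have hk1 : x ^ (k + 1) • y = 0 := by
      rw [pow_succ', mul_smul, hk _ (Ideal.pow_mem_pow hx k), smul_zero]
    have hiff : ∀ u, x ^ (k + 1) • u ∈ satd 1 K ↔ u ∈ satd 1 K :=
      fun u => ⟨hreg _ (by omega) u, fun h => Submodule.smul_mem _ _ h⟩
    refine Kills.smul_eq_zero_of_exact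
      (complCokerMap_injective (quotMul_injective (R := R) hiff)
        (quotMap_surjective le_extBy) (quotMul_exact hiff))
      (complCokerMap_surjective (quotMap_surjective le_extBy))
      (complCokerMap_exact (quotMul_injective (R := R) hiff)
        (quotMap_surjective le_extBy) (quotMul_exact hiff)) (fun u => ?_) (ih _) hk1 hr
    have : quotMul R (x ^ (k + 1)) hiff = x ^ (k + 1) • LinearMap.id := by
      ext u; rfl
    rw [this, complCokerMap_smul_id]

/-- Completion is injective on local cohomology. -/
theorem LCmap_of_injective (i : ℕ) :
    Function.Injective (LCmap R i (AdicCompletion.of (maximalIdeal R) M)) := by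
  have hinj := AdicCompletion.of_injective (maximalIdeal R) M
  cases i with
  | zero =>
    refine (injective_iff_map_eq_zero _).2 fun x hx => ?_
    apply (LCzero_injective_and_range R).1
    apply hinj
    rw [← LCzero_LCmap, hx]
    simp
  | succ i =>
    obtain ⟨-, δ, -, h2⟩ := exists_LC_connecting R _ _ hinj (Submodule.mkQ_surjective _)
      (LinearMap.exact_map_mkQ_range (AdicCompletion.of (maximalIdeal R) M)) i
    refine (injective_iff_map_eq_zero _).2 fun x hx => ?_
    obtain ⟨w, rfl⟩ := (h2 x).1 hx
    let e : M ≃ₗ[R] M ⧸ (⊥ : Submodule R M) := (Submodule.quotEquivOfEqBot _ rfl).symm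
    have hid : ((1 : R) • LinearMap.id : (M ⧸ (⊥ : Submodule R M)) →ₗ[R] _) =
        e.toLinearMap ∘ₗ e.symm.toLinearMap := by ext; simp
    have hid' : ((1 : R) • LinearMap.id : M →ₗ[R] M) =
        e.symm.toLinearMap ∘ₗ e.toLinearMap := by ext; simp
    let e' : ComplCoker R M ≃ₗ[R] ComplCoker R (M ⧸ (⊥ : Submodule R M)) :=
      LinearEquiv.ofLinearMap (complCokerMap R e.toLinearMap) (complCokerMap R e.symm.toLinearMap)
        (LinearMap.ext fun x => by
          rw [LinearMap.comp_apply, complCokerMap_comp, ← hid, complCokerMap_smul_id, one_smul]; rfl)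
        (LinearMap.ext fun x => by
          rw [LinearMap.comp_apply, complCokerMap_comp, ← hid', complCokerMap_smul_id, one_smul]; rfl)
    have : Kills R 0 i (ComplCoker R M) :=
      Kills.of_injective (LCequiv R i e').injective (kills_zero_complCoker i ⊥)
    rw [← one_smul R w, this 1 (by simp) w, map_zero]

end CokernelVanishing

section CompletionFacts
variable (R : Type) [CommRing R] [IsLocalRing R] [IsNoetherianRing R]

lemma isNoetherianRing_completion : IsNoetherianRing (AdicCompletion (maximalIdeal R) R) := by
  have hm := AdicCompletion.maximalIdeal_eq_map (R := R)
  have : IsAdicComplete ((maximalIdeal R).map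
      (algebraMap R (AdicCompletion (maximalIdeal R) R))) (AdicCompletion (maximalIdeal R) R) := by
    rw [← hm]; infer_instance
  refine isNoetherianRing_of_isAdicComplete (maximalIdeal R) fun s => ?_
  obtain ⟨r, hr⟩ := (AdicCompletion.residueField_map_bijective R).2 (residue _ s)
  obtain ⟨r, rfl⟩ := residue_surjective r
  refine ⟨r, ?_⟩
  rw [← hm, ← residue_eq_zero_iff, map_sub, ← hr, ResidueField.map_residue, sub_self]

variable (M : Type) [AddCommGroup M] [Module R M] [Module.Finite R M]

omit [IsNoetherianRing R] in
lemma module_finite_completion : Module.Finite (AdicCompletion (maximalIdeal R) R)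
    (AdicCompletion (maximalIdeal R) M) :=
  Module.Finite.of_surjective _
    (AdicCompletion.ofTensorProduct_surjective_of_finite (maximalIdeal R) M)

omit [Module.Finite R M] in
lemma isPrecomplete_completion : IsPrecomplete (maximalIdeal (AdicCompletion (maximalIdeal R) R))
    (AdicCompletion (maximalIdeal R) M) := by
  rw [AdicCompletion.maximalIdeal_eq_map, IsPrecomplete.map_algebraMap_iff]
  exact (AdicCompletion.isAdicComplete (IsNoetherian.noetherian _)).toIsPrecomplete

variable {R M} {r : ℕ} (hr : mDim R M = (r : ℕ∞)) (hu : IsUnmixed R M)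

include hr hu in
lemma dimLT_annihilator_completion : DimLT (r + 1)
    (Module.annihilator (AdicCompletion (maximalIdeal R) R)
      (AdicCompletion (maximalIdeal R) M)) := by
  have := isNoetherianRing_completion R
  have := module_finite_completion R M
  refine DimLT.of_forall_minimalPrimes fun P hP => dimLT_iff_ringKrullDim_lt.2 ?_
  rw [hu P (Module.associatedPrimes.minimalPrimes_annihilator_subset_associatedPrimes _ _ hP), hr]
  exact_mod_cast Nat.lt_succ_self r

omit [Module.Finite R M] in
include hr hu in
lemma satd_bot_completion_le : satd r
    (⊥ : Submodule (AdicCompletion (maximalIdeal R) R) (AdicCompletion (maximalIdeal R) M)) ≤ ⊥ := by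
  have := isNoetherianRing_completion R
  intro u hu'
  obtain ⟨J, hJ, h⟩ := mem_satd.1 hu'
  by_contra hne
  obtain ⟨P, hP, hle⟩ := exists_le_isAssociatedPrime_of_isNoetherianRing
    (AdicCompletion (maximalIdeal R) R) u hne
  have h1 := dimLT_iff_ringKrullDim_lt.1 (hJ.mono (le_trans (fun a ha =>
    Submodule.mem_colon_singleton.2 (h a ha)) hle) le_rfl)
  rw [hu P hP, hr] at h1
  exact absurd h1 (lt_irrefl _)

end CompletionFacts

section LengthTransfer
variable {R S N : Type} [CommRing R] [CommRing S] [Algebra R S] [AddCommGroup N] [Module R N]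
  [Module S N] [IsScalarTower R S N]

/-- The length does not change if every scalar acts as a scalar of the base ring. -/
lemma length_eq_of_forall_exists_smul_eq (h : ∀ s : S, ∃ r : R, ∀ x : N, s • x = r • x) :
    Module.length R N = Module.length S N := by
  rw [← WithBot.coe_inj, Module.coe_length, Module.coe_length]
  refine (Order.krullDim_eq_of_orderIso
    (RelIso.ofSurjective (Submodule.restrictScalarsEmbedding R S N) fun L => ?_)).symm
  refine ⟨{ L with smul_mem' := fun s x hx => ?_ }, rfl⟩
  obtain ⟨r, hr⟩ := h s
  rw [hr]
  exact L.smul_mem r hx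

end LengthTransfer

section CompletionQuotient
variable {R : Type} [CommRing R] [IsLocalRing R] [IsNoetherianRing R]
  {M : Type} [AddCommGroup M] [Module R M] [Module.Finite R M]

lemma of_mem_map_smul_iff (Q : Ideal R) (u : M) : AdicCompletion.of (maximalIdeal R) M u ∈
      Q.map (algebraMap R (AdicCompletion (maximalIdeal R) R)) •
        (⊤ : Submodule (AdicCompletion (maximalIdeal R) R) (AdicCompletion (maximalIdeal R) M)) ↔
    u ∈ Q • (⊤ : Submodule R M) := by
  constructor
  · intro h
    have hle : Q.map (algebraMap R (AdicCompletion (maximalIdeal R) R)) •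
        (⊤ : Submodule (AdicCompletion (maximalIdeal R) R) (AdicCompletion (maximalIdeal R) M)) ≤
        LinearMap.ker (AdicCompletion.map (maximalIdeal R)
          (Q • (⊤ : Submodule R M)).mkQ) := by
      have hann : Q.map (algebraMap R (AdicCompletion (maximalIdeal R) R)) ≤
          Module.annihilator (AdicCompletion (maximalIdeal R) R)
            (AdicCompletion (maximalIdeal R) (M ⧸ Q • (⊤ : Submodule R M))) := by
        rw [Ideal.map_le_iff_le_comap]
        intro q hq
        rw [Ideal.mem_comap, Module.mem_annihilator]
        intro v
        rw [algebraMap_smul]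
        ext n
        rw [AdicCompletion.val_smul_apply]
        obtain ⟨w, hw⟩ := Submodule.Quotient.mk_surjective _ (v.val n)
        obtain ⟨w, rfl⟩ := Submodule.Quotient.mk_surjective _ w
        rw [← hw, ← Submodule.Quotient.mk_smul, ← Submodule.Quotient.mk_smul,
          (Submodule.Quotient.mk_eq_zero _).2 (Submodule.smul_mem_smul hq Submodule.mem_top)]
        rfl
      refine Submodule.smul_le.2 fun a ha v _ => ?_
      rw [LinearMap.mem_ker, map_smul, Module.mem_annihilator.1 (hann ha)]
    have h1 := hle h
    rw [LinearMap.mem_ker, AdicCompletion.map_of] at h1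
    rw [← Submodule.Quotient.mk_eq_zero]
    exact AdicCompletion.of_injective (maximalIdeal R) _ (h1.trans (map_zero _).symm)
  · intro h
    refine Submodule.smul_induction_on h (fun a ha v _ => ?_) fun v w hv hw => ?_
    · rw [map_smul, ← algebraMap_smul (AdicCompletion (maximalIdeal R) R) a
        (AdicCompletion.of (maximalIdeal R) M v)]
      exact Submodule.smul_mem_smul (Ideal.mem_map_of_mem _ ha) trivial
    · rw [map_add]
      exact Submodule.add_mem _ hv hw

omit [Module.Finite R M] in
lemma exists_of_sub_mem (k : ℕ) (y : AdicCompletion (maximalIdeal R) M) :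
    ∃ u, y - AdicCompletion.of (maximalIdeal R) M u ∈
      maximalIdeal (AdicCompletion (maximalIdeal R) R) ^ k •
        (⊤ : Submodule (AdicCompletion (maximalIdeal R) R) (AdicCompletion (maximalIdeal R) M)) := by
  obtain ⟨u, hu⟩ := Submodule.Quotient.mk_surjective _ (AdicCompletion.eval (maximalIdeal R) M k y)
  refine ⟨u, ?_⟩
  have h1 : y - AdicCompletion.of (maximalIdeal R) M u ∈
      LinearMap.ker (AdicCompletion.eval (maximalIdeal R) M k) := by
    rw [LinearMap.mem_ker, map_sub, ← hu, sub_eq_zero]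
    rfl
  rw [← AdicCompletion.pow_smul_top_eq_ker_eval (IsNoetherian.noetherian _)] at h1
  refine Submodule.smul_induction_on h1 (fun a ha v _ => ?_) fun v w hv hw =>
    Submodule.add_mem _ hv hw
  rw [← algebraMap_smul (AdicCompletion (maximalIdeal R) R) a v]
  exact Submodule.smul_mem_smul
    (smul_mem_pow_of_mem_pow AdicCompletion.maximalIdeal_eq_map ha) trivial

/-- Lengths of quotients by primary ideals are unchanged by completion. -/
lemma length_quotient_completion {Q : Ideal R} {k : ℕ}
    (hQ : maximalIdeal (AdicCompletion (maximalIdeal R) R) ^ k •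
        (⊤ : Submodule (AdicCompletion (maximalIdeal R) R) (AdicCompletion (maximalIdeal R) M)) ≤
      Q.map (algebraMap R (AdicCompletion (maximalIdeal R) R)) • ⊤) :
    Module.length R (M ⧸ Q • (⊤ : Submodule R M)) =
      Module.length (AdicCompletion (maximalIdeal R) R) (AdicCompletion (maximalIdeal R) M ⧸
        Q.map (algebraMap R (AdicCompletion (maximalIdeal R) R)) •
          (⊤ : Submodule (AdicCompletion (maximalIdeal R) R)
            (AdicCompletion (maximalIdeal R) M))) := by
  set L := Q.map (algebraMap R (AdicCompletion (maximalIdeal R) R)) •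
    (⊤ : Submodule (AdicCompletion (maximalIdeal R) R) (AdicCompletion (maximalIdeal R) M)) with hL
  let φ : M →ₗ[R] AdicCompletion (maximalIdeal R) M ⧸ L :=
    L.mkQ.restrictScalars R ∘ₗ AdicCompletion.of (maximalIdeal R) M
  have hker : LinearMap.ker φ = Q • (⊤ : Submodule R M) := by
    ext u
    rw [LinearMap.mem_ker, ← of_mem_map_smul_iff, ← hL]
    exact Submodule.Quotient.mk_eq_zero L
  have hsurj : Function.Surjective φ := by
    intro y
    obtain ⟨y, rfl⟩ := Submodule.Quotient.mk_surjective _ y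
    obtain ⟨u, hu⟩ := exists_of_sub_mem k y
    refine ⟨u, Eq.symm ?_⟩
    exact (Submodule.Quotient.eq L).2 (hQ hu)
  rw [← length_eq_of_forall_exists_smul_eq (R := R)
    (S := AdicCompletion (maximalIdeal R) R), ← hker]
  · exact (φ.quotKerEquivOfSurjective hsurj).length_eq
  · intro s
    obtain ⟨r, hr⟩ := exists_of_sub_mem (M := R) k s
    refine ⟨r, fun x => ?_⟩
    obtain ⟨x, rfl⟩ := Submodule.Quotient.mk_surjective _ x
    rw [← algebraMap_smul (AdicCompletion (maximalIdeal R) R) r, ← sub_eq_zero, ← sub_smul,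
      ← Submodule.Quotient.mk_smul, Submodule.Quotient.mk_eq_zero]
    refine hQ (Submodule.smul_mem_smul ?_ trivial)
    exact (Ideal.mul_top (maximalIdeal (AdicCompletion (maximalIdeal R) R) ^ k)).le hr

lemma neg_chernNum_mem_Lambda {l : List (AdicCompletion (maximalIdeal R) R)}
    (hrange : ∀ y ∈ l, ∃ a, algebraMap R (AdicCompletion (maximalIdeal R) R) a = y)
    (hmem : ∀ y ∈ l, y ∈ maximalIdeal (AdicCompletion (maximalIdeal R) R))
    (h2 : 2 ≤ l.length)
    (h : IsStrong l (⊥ : Submodule (AdicCompletion (maximalIdeal R) R)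
      (AdicCompletion (maximalIdeal R) M))) :
    -chernNum l (⊥ : Submodule (AdicCompletion (maximalIdeal R) R)
      (AdicCompletion (maximalIdeal R) M)) ∈ Lambda R M l.length := by
  have := isNoetherianRing_completion R
  have := module_finite_completion R M
  obtain ⟨l, rfl⟩ : l ∈ Set.range (List.map
      (algebraMap R (AdicCompletion (maximalIdeal R) R))) := by
    rw [Set.range_list_map]
    exact hrange
  rw [← hilbCoeff_one h2]
  have hlen : ∀ n, (hilb (l.map (algebraMap R (AdicCompletion (maximalIdeal R) R)))
      (⊥ : Submodule (AdicCompletion (maximalIdeal R) R)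
        (AdicCompletion (maximalIdeal R) M)) n : ℕ∞) =
      Module.length R (M ⧸ Ideal.ofList l ^ (n + 1) • (⊤ : Submodule R M)) := by
    intro n
    have hprim := h.isPrim_sup.sup_pow (n + 1)
    rw [hilb, hprim.coe_colen]
    rw [bot_sup_eq, ← Ideal.map_ofList, ← Ideal.map_pow] at hprim ⊢
    obtain ⟨k, hk⟩ := hprim
    exact (length_quotient_completion hk).symm
  refine ⟨Ideal.ofList l, _, ⟨?_, ⟨fun i => l.get (i.cast (by simp)), ?_⟩, ?_⟩,
    ⟨0, fun n _ => ⟨_, ?_, h.hilb_eq n⟩⟩, rfl⟩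
  · refine Ideal.span_le.2 fun a ha => ?_
    have := hmem _ (List.mem_map_of_mem ha)
    exact fun hu => this (hu.map _)
  · rw [Ideal.ofList]
    congr 1
    ext a
    constructor
    · intro ha
      obtain ⟨i, rfl⟩ := List.mem_iff_get.1 ha
      exact ⟨i.cast (by simp), rfl⟩
    · rintro ⟨i, rfl⟩
      exact List.get_mem _ _
  · rw [← Module.length_ne_top_iff, ← pow_one (Ideal.ofList l), ← zero_add 1, ← hlen 0]
    exact ENat.natCast_ne_top _
  · rw [hlen n, Module.coe_length]
    rfl

lemma chernLE_bot {ℓ r : ℕ} (hr2 : 2 ≤ r) (hmin : -(ℓ : ℤ) ∈ lowerBounds (Lambda R M r)) :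
    ChernLE R ℓ r (⊥ : Submodule (AdicCompletion (maximalIdeal R) R)
      (AdicCompletion (maximalIdeal R) M)) := by
  have := isNoetherianRing_completion R
  refine (((EvList.of_forall_mem gen_range).and (EvList.of_forall_mem gen_mem)).and
    (EvList.of_forall fun l hl => hl)).mono ?_
  rintro l ⟨⟨h1, h3⟩, rfl⟩ h
  exact neg_le_neg_iff.1 (hmin (neg_chernNum_mem_Lambda h1 h3 hr2 h))

end CompletionQuotient

theorem kills_of_isUnmixed {R : Type} [CommRing R] [IsLocalRing R] [IsNoetherianRing R]
    {M : Type} [AddCommGroup M] [Module R M] [Module.Finite R M]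
    {r : ℕ} (hr : mDim R M = (r : ℕ∞)) (hr2 : 2 ≤ r) (hu : IsUnmixed R M)
    {ℓ : ℕ} (hmin : -(ℓ : ℤ) ∈ lowerBounds (Lambda R M r)) {i : ℕ} (hi : i < r) :
    Kills R ℓ i M := by
  have := isNoetherianRing_completion R
  have := module_finite_completion R M
  have := isPrecomplete_completion R M
  obtain ⟨d, rfl⟩ := Nat.exists_eq_add_of_le' hr2
  have h := kills_of_chernLE (R := R) AdicCompletion.maximalIdeal_eq_map d ⊥ _
    (dimLT_annihilator_completion hr hu)
    (Submodule.smul_le.2 fun a ha u _ => by simpa using Module.mem_annihilator.1 ha u)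
    (satd_bot_completion_le hr hu) (chernLE_bot hr2 hmin) i hi
  let e := ((Submodule.quotEquivOfEqBot (⊥ : Submodule (AdicCompletion (maximalIdeal R) R)
      (AdicCompletion (maximalIdeal R) M)) rfl).restrictScalars R).symm
  exact (h.of_injective (LCequiv R i e).injective).of_injective (LCmap_of_injective i)

theorem kills_of_lt {R : Type} [CommRing R] [IsLocalRing R] [IsNoetherianRing R]
    {M : Type} [AddCommGroup M] [Module R M] [Module.Finite R M]
    {r : ℕ} (hr : mDim R M = (r : ℕ∞)) {i : ℕ} (hi : r < i) : Kills R 0 i M := by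
  have hJ : DimLT (r + 1) (Submodule.annihilator (⊤ : Submodule R M)) :=
    dimLT_iff_ringKrullDim_lt.2 (hr.trans_lt (by exact_mod_cast Nat.lt_succ_self r))
  exact (kills_zero_of_dimLT r ⊥ _ hJ (Submodule.annihilator_smul _).le i hi).of_injective
    (LCequiv R i (Submodule.quotEquivOfEqBot (⊥ : Submodule R M) rfl).symm).injective

lemma Kills.pow_smul_top_eq_bot {R : Type} [CommRing R] [IsLocalRing R] {N : Type}
    [AddCommGroup N] [Module R N] {k i : ℕ} (h : Kills R k i N) :
    maximalIdeal R ^ k • (⊤ : Submodule R (LC R i N)) = ⊥ :=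
  le_bot_iff.1 (Submodule.smul_le.2 fun a ha u _ => h a ha u)

theorem statement11 (R : Type) [CommRing R] [IsLocalRing R] [IsNoetherianRing R]
    (M : Type) [AddCommGroup M] [Module R M] [Module.Finite R M]
    (r : ℕ) (hr : mDim R M = (r : ℕ∞)) (hr2 : 2 ≤ r)
    (hu : IsUnmixed R M)
    (hfin : (Lambda R M r).Finite)
    (ℓ : ℕ) (hmin : IsLeast (Lambda R M r) (-(ℓ : ℤ))) :
    (∀ i : ℕ, i ≠ r →
      (maximalIdeal R) ^ ℓ • (⊤ : Submodule R ↥(LC R i M)) = ⊥) ∧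
    IsGenCM R M r := by
  have hkills : ∀ i < r, Kills R ℓ i M := fun i hi => kills_of_isUnmixed hr hr2 hu hmin.2 hi
  refine ⟨fun i hi => ?_, fun i hi => ?_⟩
  · rcases lt_or_gt_of_ne hi with h | h
    · exact (hkills i h).pow_smul_top_eq_bot
    · exact ((kills_of_lt hr h).mono (Nat.zero_le ℓ)).pow_smul_top_eq_bot
  · let e := (Submodule.quotEquivOfEqBot (⊥ : Submodule R M) rfl).symm
    exact (isFiniteLength_LC_of_kills i ℓ ⊥ fun j hj => (hkills j (hj.trans_lt hi)).of_injective
      (LCequiv R j e.symm).injective).of_injective (LCequiv R i e).injective
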